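/- Nekrashevych's finite presentability theorem: Let d ≥ 2 and let G be a contracting self-similar group of synchronous rational homeomorphisms of the d-ary Cantor space 𝔠_d. Then the Röver–Nekrashevych group V_dG, the subgroup of the homeomorphism group of 𝔠_d generated by G together with Thompson's group V_d, is finitely presented. -/

import Mathlib

/-- Concatenation of a finite word with an infinite sequence. -/
def wordAppend {A : Type*} (α : List A) (x : ℕ → A) : ℕ → A :=
  fun n => if h : n < α.length then α.get ⟨n, h⟩ else x (n - α.length)

/-- The cone determined by a finite word: all sequences having it as a prefix. -/
def cone {A : Type*} (α : List A) : Set (ℕ → A) := Set.range (wordAppend α)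

/-- `g` is the local action of the homeomorphism `f` at the word `α`:
there is a word `β` with `f (α ⌢ x) = β ⌢ (g x)` for all `x`, and `β` is the longest
common prefix of the image of the cone `C_α` (witnessed by two image points that
differ in the coordinate immediately after `β`). -/
def IsLocalAction {A : Type*} [TopologicalSpace A] (f : (ℕ → A) ≃ₜ (ℕ → A)) (α : List A)
    (g : (ℕ → A) → (ℕ → A)) : Prop :=
  ∃ β : List A, (∀ x, f (wordAppend α x) = wordAppend β (g x)) ∧ ∃ x y, g x 0 ≠ g y 0

/-- A homeomorphism of a Cantor space of sequences is rational if it has only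
finitely many distinct local actions. -/
def IsRational {A : Type*} [TopologicalSpace A] (f : (ℕ → A) ≃ₜ (ℕ → A)) : Prop :=
  {g | ∃ α, IsLocalAction f α g}.Finite

/-- A homeomorphism is synchronous if it maps every cone onto a cone. -/
def IsSynchronous {A : Type*} [TopologicalSpace A] (f : (ℕ → A) ≃ₜ (ℕ → A)) : Prop :=
  ∀ α : List A, ∃ β : List A, f '' cone α = cone β

/-- The group of self-homeomorphisms of a topological space, under composition. -/
instance homeoGroup {X : Type*} [TopologicalSpace X] : Group (X ≃ₜ X) where
  mul f g := g.trans f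
  one := Homeomorph.refl X
  inv := Homeomorph.symm
  mul_assoc _ _ _ := rfl
  one_mul _ := Homeomorph.ext fun _ => rfl
  mul_one _ := Homeomorph.ext fun _ => rfl
  inv_mul_cancel := Homeomorph.self_trans_symm

/-- Membership in Thompson's group `V` over the alphabet `A`: `f` carries a finite
partition of the space into cones onto another such partition by prefix replacement. -/
def InThompsonV {A : Type*} [TopologicalSpace A] (f : (ℕ → A) ≃ₜ (ℕ → A)) : Prop :=
  ∃ (k : ℕ) (αs βs : Fin k → List A),
    (⋃ i, cone (αs i)) = Set.univ ∧ Pairwise (Function.onFun Disjoint (cone ∘ αs)) ∧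
    (⋃ i, cone (βs i)) = Set.univ ∧ Pairwise (Function.onFun Disjoint (cone ∘ βs)) ∧
    ∀ i x, f (wordAppend (αs i) x) = wordAppend (βs i) x

/-- A group is finitely presented if it is isomorphic to the quotient of a finitely
generated free group by the normal closure of a finite set of relators. -/
def IsFinitelyPresented (H : Type*) [Group H] : Prop :=
  ∃ (n : ℕ) (R : Finset (FreeGroup (Fin n))),
    Nonempty (H ≃* FreeGroup (Fin n) ⧸ Subgroup.normalClosure (R : Set (FreeGroup (Fin n))))


/-! ## Basics on words, cones and homeomorphisms -/

notation:65 a:66 "⌢" b:65 => wordAppend a b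

theorem take_pfx {A : Type*} (k : ℕ) (l : List A) : l.take k <+: l :=
  ⟨l.drop k, List.take_append_drop k l⟩

theorem pfx_or_pfx {A : Type*} {a b c : List A} (h1 : a <+: c) (h2 : b <+: c) :
    a <+: b ∨ b <+: a :=
  (le_total a.length b.length).imp (List.prefix_of_prefix_length_le h1 h2)
    (List.prefix_of_prefix_length_le h2 h1)

section Basics
variable {d : ℕ}

abbrev Wd (d : ℕ) := List (Fin (d + 2))
abbrev Cs (d : ℕ) := ℕ → Fin (d + 2)
abbrev Hm (d : ℕ) := Cs d ≃ₜ Cs d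

theorem hm_mul_apply (f g : Hm d) (x : Cs d) : (f * g) x = f (g x) := rfl
theorem hm_one_apply (x : Cs d) : (1 : Hm d) x = x := rfl
theorem hm_inv_apply_self (f : Hm d) (x : Cs d) : f⁻¹ (f x) = x := f.symm_apply_apply x
theorem hm_apply_inv_self (f : Hm d) (x : Cs d) : f (f⁻¹ x) = x := f.apply_symm_apply x
theorem hm_ext {f g : Hm d} (h : ∀ x, f x = g x) : f = g := Homeomorph.ext h

theorem wa_nil (x : Cs d) : ([] : Wd d) ⌢ x = x := by
  funext n; simp [wordAppend]

theorem wa_append (α β : Wd d) (x : Cs d) : (α ++ β) ⌢ x = α ⌢ (β ⌢ x) := by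
  funext n
  simp only [wordAppend, List.length_append, List.get_eq_getElem]
  by_cases h1 : n < α.length
  · simp [h1, List.getElem_append_left, show n < α.length + β.length by omega]
  · by_cases h2 : n - α.length < β.length
    · simp [h1, h2, show n < α.length + β.length by omega,
        List.getElem_append_right (show α.length ≤ n by omega)]
    · simp only [h1, h2, show ¬ n < α.length + β.length by omega, dite_false]
      congr 1; omega

def dropC (k : ℕ) (x : Cs d) : Cs d := fun n => x (n + k)

theorem dropC_wa (α : Wd d) (x : Cs d) : dropC α.length (α ⌢ x) = x := by
  funext n; simp [dropC, wordAppend]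

theorem wa_inj {α : Wd d} {x y : Cs d} (h : α ⌢ x = α ⌢ y) : x = y := by
  rw [← dropC_wa α x, h, dropC_wa]

theorem wa_get (α : Wd d) (x : Cs d) (i : ℕ) (h : i < α.length) : (α ⌢ x) i = α[i] := by
  simp [wordAppend, h]

theorem wa_cons_zero (a : Fin (d + 2)) (α : Wd d) (x : Cs d) : ((a :: α) ⌢ x) 0 = a := by
  simp [wordAppend]

theorem wa_ofFn (k : ℕ) (x : Cs d) : (List.ofFn fun i : Fin k => x i) ⌢ dropC k x = x := by
  funext n
  simp only [wordAppend, dropC, List.length_ofFn, List.get_eq_getElem, List.getElem_ofFn]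
  split_ifs with h
  · rfl
  · congr 1; omega

theorem wa_decomp (k : ℕ) (x : Cs d) : ∃ (α : Wd d) (y : Cs d), α.length = k ∧ x = α ⌢ y :=
  ⟨List.ofFn fun i : Fin k => x i, dropC k x, by simp, (wa_ofFn k x).symm⟩

theorem wa_eq_len {α β : Wd d} {x y : Cs d} (hl : α.length = β.length) (h : α ⌢ x = β ⌢ y) :
    α = β ∧ x = y := by
  have : α = β := by
    apply List.ext_getElem hl
    intro i h1 h2
    rw [← wa_get α x i h1, h, wa_get]
  subst this
  exact ⟨rfl, wa_inj h⟩

theorem wa_pfx {α β : Wd d} {x y : Cs d} (hl : α.length ≤ β.length) (h : α ⌢ x = β ⌢ y) :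
    α <+: β := by
  rw [← List.take_append_drop α.length β, wa_append] at h
  have := (wa_eq_len (by simp [hl]) h).1
  rw [this]; exact take_pfx _ _

def Dj (α β : Wd d) : Prop := ¬ α <+: β ∧ ¬ β <+: α

theorem Dj.symm {α β : Wd d} (h : Dj α β) : Dj β α := ⟨h.2, h.1⟩
theorem dj_comm {α β : Wd d} : Dj α β ↔ Dj β α := ⟨Dj.symm, Dj.symm⟩

theorem Dj.ne {α β : Wd d} (h : Dj α β) : α ≠ β := by
  rintro rfl; exact h.1 (List.prefix_refl _)

theorem wa_comparable {α β : Wd d} {x y : Cs d} (h : α ⌢ x = β ⌢ y) : ¬ Dj α β := by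
  rintro ⟨h1, h2⟩
  rcases le_total α.length β.length with hl | hl
  · exact h1 (wa_pfx hl h)
  · exact h2 (wa_pfx hl h.symm)

theorem dj_of_len {α β : Wd d} (hl : α.length = β.length) (hne : α ≠ β) : Dj α β :=
  ⟨fun h => hne (h.eq_of_length hl), fun h => hne (h.eq_of_length hl.symm).symm⟩

theorem Dj.append {α β : Wd d} (h : Dj α β) (u v : Wd d) : Dj (α ++ u) (β ++ v) := by
  refine ⟨fun h1 => ?_, fun h1 => ?_⟩
  · have h2 : α <+: β ++ v := (List.prefix_append α u).trans h1
    rcases pfx_or_pfx h2 (List.prefix_append β v) with h3 | h3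
    · exact h.1 h3
    · exact h.2 h3
  · have h2 : β <+: α ++ u := (List.prefix_append β v).trans h1
    rcases pfx_or_pfx h2 (List.prefix_append α u) with h3 | h3
    · exact h.2 h3
    · exact h.1 h3

theorem Dj.mono {α β α' β' : Wd d} (h : Dj α β) (h1 : α <+: α') (h2 : β <+: β') : Dj α' β' := by
  obtain ⟨u, rfl⟩ := h1
  obtain ⟨v, rfl⟩ := h2
  exact h.append u v

theorem Dj.left {α β : Wd d} (h : Dj α β) (u : Wd d) : Dj (α ++ u) β := by
  simpa using h.append u []
theorem Dj.right {α β : Wd d} (h : Dj α β) (u : Wd d) : Dj α (β ++ u) := by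
  simpa using h.append [] u

theorem dj_append_left {α u v : Wd d} : Dj (α ++ u) (α ++ v) ↔ Dj u v := by
  simp [Dj, List.prefix_append_right_inj]

theorem dj_wa {α β : Wd d} (h : Dj α β) (x y : Cs d) : α ⌢ x ≠ β ⌢ y := fun e => wa_comparable e h

theorem wa_forall_pfx {α β : Wd d} (h : ∀ x, ∃ y, α ⌢ x = β ⌢ y) : β <+: α := by
  by_contra hc
  rcases le_total β.length α.length with hl | hl
  · obtain ⟨y, hy⟩ := h (fun _ => 0)
    exact hc (wa_pfx hl hy.symm)
  · obtain ⟨y0, hy0⟩ := h (fun _ => 0)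
    obtain ⟨y1, hy1⟩ := h (fun _ => 1)
    have hlt : α.length < β.length := by
      rcases hl.lt_or_eq with h | h
      · exact h
      · exact absurd (wa_eq_len h hy0).1 (fun e => hc (e ▸ List.prefix_refl _))
    have e0 := congrFun hy0 α.length
    have e1 := congrFun hy1 α.length
    rw [wa_get β _ _ hlt] at e0 e1
    simp [wordAppend] at e0 e1
    rw [← e0] at e1
    exact absurd e1 (by simp)

theorem wa_forall_eq {α β : Wd d} (h : ∀ x, α ⌢ x = β ⌢ x) : α = β := by
  have h1 : β <+: α := wa_forall_pfx fun x => ⟨x, h x⟩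
  have h2 : α <+: β := wa_forall_pfx fun x => ⟨x, (h x).symm⟩
  exact List.IsPrefix.eq_of_length h2 (le_antisymm h2.length_le h1.length_le)

theorem mem_cone {α : Wd d} {x : Cs d} : x ∈ cone α ↔ ∃ y, α ⌢ y = x := Iff.rfl

theorem continuous_wa (α : Wd d) : Continuous (wordAppend α : Cs d → Cs d) := by
  refine continuous_pi fun n => ?_
  by_cases h : n < α.length
  · simp only [wordAppend, h, dite_true]; exact continuous_const
  · simp only [wordAppend, h, dite_false]; exact continuous_apply _

theorem continuous_dropC (k : ℕ) : Continuous (dropC k : Cs d → Cs d) :=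
  continuous_pi fun _ => continuous_apply _

theorem mem_cone_iff {α : Wd d} {x : Cs d} : x ∈ cone α ↔ α ⌢ dropC α.length x = x := by
  constructor
  · rintro ⟨y, rfl⟩; rw [dropC_wa]
  · intro h; exact ⟨_, h⟩

theorem mem_cone_iff_ofFn {α : Wd d} {x : Cs d} :
    x ∈ cone α ↔ (fun i : Fin α.length => x i) = α.get := by
  constructor
  · rintro ⟨y, rfl⟩; funext i; simp [wordAppend]
  · intro h
    refine ⟨dropC α.length x, ?_⟩
    conv_rhs => rw [← wa_ofFn α.length x]
    congr 1
    rw [h]; simp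

theorem isClopen_cone (α : Wd d) : IsClopen (cone α) := by
  have : cone α = (fun x : Cs d => (fun i : Fin α.length => x i)) ⁻¹' {α.get} := by
    ext x; exact mem_cone_iff_ofFn
  rw [this]
  refine IsClopen.preimage (isClopen_discrete _) ?_
  exact continuous_pi fun _ => continuous_apply _

/-- `h` maps the cone at `α` to the cone at `β` acting by `g`. -/
def At (h : Hm d) (α β : Wd d) (g : Hm d) : Prop := ∀ x, h (α ⌢ x) = β ⌢ (g x)
def Mv (h : Hm d) (α β : Wd d) : Prop := ∀ x, h (α ⌢ x) = β ⌢ x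

theorem mv_iff_at {h : Hm d} {α β : Wd d} : Mv h α β ↔ At h α β 1 := Iff.rfl

theorem Mv.append {h : Hm d} {α β : Wd d} (H : Mv h α β) (u : Wd d) : Mv h (α ++ u) (β ++ u) := by
  intro x; rw [wa_append, H, wa_append]

theorem Mv.unique {h : Hm d} {α β β' : Wd d} (H : Mv h α β) (H' : Mv h α β') : β = β' :=
  wa_forall_eq fun x => by rw [← H, H']

theorem Mv.inv {h : Hm d} {α β : Wd d} (H : Mv h α β) : Mv h⁻¹ β α := by
  intro x; rw [← H, hm_inv_apply_self]

theorem Mv.mul {h k : Hm d} {α β γ : Wd d} (H : Mv h β γ) (H' : Mv k α β) : Mv (h * k) α γ := by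
  intro x; rw [hm_mul_apply, H', H]

theorem mv_one (α : Wd d) : Mv (1 : Hm d) α α := fun _ => rfl

theorem At.inv {h : Hm d} {α β : Wd d} {g : Hm d} (H : At h α β g) : At h⁻¹ β α g⁻¹ := by
  intro x
  have := H (g⁻¹ x)
  rw [hm_apply_inv_self] at this
  rw [← this, hm_inv_apply_self]

theorem At.mul {h k : Hm d} {α β γ : Wd d} {g g' : Hm d} (H : At h β γ g) (H' : At k α β g') :
    At (h * k) α γ (g * g') := by
  intro x; rw [hm_mul_apply, H', H]; rfl

theorem At.dj {h : Hm d} {α β α' β' : Wd d} {g g' : Hm d} (H : At h α α' g) (H' : At h β β' g')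
    (hd : Dj α β) : Dj α' β' := by
  by_contra hc
  have key : ∀ {p q : Wd d} (_ : p <+: q), ∃ x y : Cs d, q ⌢ x = p ⌢ y := by
    rintro p q ⟨u, rfl⟩
    exact ⟨fun _ => 0, u ⌢ (fun _ => 0), wa_append _ _ _⟩
  have : ∃ x y : Cs d, α' ⌢ x = β' ⌢ y := by
    simp only [Dj, not_and_or, not_not] at hc
    rcases hc with hc | hc
    · obtain ⟨x, y, h⟩ := key hc; exact ⟨y, x, h.symm⟩
    · exact key hc
  obtain ⟨x, y, e⟩ := this
  rw [← hm_apply_inv_self g x, ← hm_apply_inv_self g' y, ← H, ← H'] at e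
  exact dj_wa hd _ _ (h.injective e)

theorem Mv.dj {h : Hm d} {α β α' β' : Wd d} (H : Mv h α α') (H' : Mv h β β')
    (hd : Dj α β) : Dj α' β' := At.dj (mv_iff_at.1 H) (mv_iff_at.1 H') hd

theorem At.not_mem {h : Hm d} {α α' : Wd d} {g : Hm d} (H : At h α α' g) {x : Cs d}
    (hx : x ∉ cone α) : h x ∉ cone α' := by
  rintro ⟨y, hy⟩
  rw [← hm_apply_inv_self g y, ← H] at hy
  exact hx ⟨_, h.injective hy⟩

open Classical in
noncomputable def swapFun (α β : Wd d) (x : Cs d) : Cs d :=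
  if x ∈ cone α then β ⌢ dropC α.length x else
    if x ∈ cone β then α ⌢ dropC β.length x else x

theorem swapFun_left (α β : Wd d) (x : Cs d) : swapFun α β (α ⌢ x) = β ⌢ x := by
  simp [swapFun, show α ⌢ x ∈ cone α from ⟨x, rfl⟩, dropC_wa]

theorem not_mem_cone_of_dj {α β : Wd d} (h : Dj α β) (x : Cs d) : α ⌢ x ∉ cone β := by
  rintro ⟨y, hy⟩; exact dj_wa h _ _ hy.symm

theorem swapFun_right {α β : Wd d} (h : Dj α β) (x : Cs d) : swapFun α β (β ⌢ x) = α ⌢ x := by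
  simp [swapFun, show β ⌢ x ∈ cone β from ⟨x, rfl⟩, not_mem_cone_of_dj h.symm, dropC_wa]

theorem swapFun_other {α β : Wd d} {x : Cs d} (h1 : x ∉ cone α) (h2 : x ∉ cone β) :
    swapFun α β x = x := by
  simp [swapFun, h1, h2]

theorem swapFun_invol {α β : Wd d} (h : Dj α β) : Function.Involutive (swapFun α β) := by
  intro x
  by_cases h1 : x ∈ cone α
  · obtain ⟨y, rfl⟩ := h1
    rw [swapFun_left, swapFun_right h]
  · by_cases h2 : x ∈ cone β
    · obtain ⟨y, rfl⟩ := h2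
      rw [swapFun_right h, swapFun_left]
    · rw [swapFun_other h1 h2, swapFun_other h1 h2]

theorem continuous_ite_clopen {s : Set (Cs d)} (hs : IsClopen s) {f g : Cs d → Cs d}
    (hf : Continuous f) (hg : Continuous g) [∀ x, Decidable (x ∈ s)] :
    Continuous fun x => if x ∈ s then f x else g x := by
  refine Continuous.if ?_ hf hg
  intro a ha
  have : frontier {x | x ∈ s} = ∅ := hs.frontier_eq
  rw [this] at ha; exact ha.elim

theorem continuous_swapFun (α β : Wd d) : Continuous (swapFun α β) := by
  classical
  unfold swapFun
  exact continuous_ite_clopen (isClopen_cone α) ((continuous_wa β).comp (continuous_dropC _))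
    (continuous_ite_clopen (isClopen_cone β) ((continuous_wa α).comp (continuous_dropC _))
      continuous_id)

open Classical in
noncomputable def swapH (α β : Wd d) : Hm d :=
  if h : Dj α β then
    { toFun := swapFun α β
      invFun := swapFun α β
      left_inv := swapFun_invol h
      right_inv := swapFun_invol h
      continuous_toFun := continuous_swapFun α β
      continuous_invFun := continuous_swapFun α β }
  else 1

theorem swapH_apply {α β : Wd d} (h : Dj α β) (x : Cs d) : swapH α β x = swapFun α β x := by
  rw [swapH, dif_pos h]; rfl

theorem swapH_left {α β : Wd d} (h : Dj α β) : Mv (swapH α β) α β := fun x => by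
  rw [swapH_apply h, swapFun_left]
theorem swapH_right {α β : Wd d} (h : Dj α β) : Mv (swapH α β) β α := fun x => by
  rw [swapH_apply h, swapFun_right h]
theorem swapH_other {α β : Wd d} {x : Cs d} (h1 : x ∉ cone α) (h2 : x ∉ cone β) :
    swapH α β x = x := by
  by_cases h : Dj α β
  · rw [swapH_apply h, swapFun_other h1 h2]
  · simp [swapH, h]
theorem swapH_fix {α β γ : Wd d} (h1 : Dj γ α) (h2 : Dj γ β) : Mv (swapH α β) γ γ := fun x =>
  swapH_other (not_mem_cone_of_dj h1 x) (not_mem_cone_of_dj h2 x)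

theorem swapH_mul_self (α β : Wd d) : swapH α β * swapH α β = 1 := by
  by_cases h : Dj α β
  · apply hm_ext; intro x
    rw [hm_mul_apply, swapH_apply h, swapH_apply h, swapFun_invol h]; rfl
  · simp [swapH, h]

theorem swapH_inv (α β : Wd d) : (swapH α β)⁻¹ = swapH α β :=
  inv_eq_of_mul_eq_one_left (swapH_mul_self α β)

/-- conjugation principle with sections -/
theorem swap_conj_at {h : Hm d} {α β α' β' : Wd d} {g : Hm d} (H : At h α α' g)
    (H' : At h β β' g) (hd : Dj α β) : h * swapH α β * h⁻¹ = swapH α' β' := by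
  have hd' := H.dj H' hd
  rw [mul_inv_eq_iff_eq_mul]
  apply hm_ext; intro x
  rw [hm_mul_apply, hm_mul_apply]
  by_cases h1 : x ∈ cone α
  · obtain ⟨y, rfl⟩ := h1
    rw [swapH_left hd, H', H, swapH_left hd']
  · by_cases h2 : x ∈ cone β
    · obtain ⟨y, rfl⟩ := h2
      rw [swapH_right hd, H', H, swapH_right hd']
    · rw [swapH_other h1 h2, swapH_other (H.not_mem h1) (H'.not_mem h2)]

theorem swap_conj {h : Hm d} {α β α' β' : Wd d} (H : Mv h α α')
    (H' : Mv h β β') (hd : Dj α β) : h * swapH α β * h⁻¹ = swapH α' β' :=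
  swap_conj_at (g := 1) H H' hd

theorem swapH_symm (α β : Wd d) : swapH α β = swapH β α := by
  by_cases h : Dj α β
  · have := swap_conj (swapH_left h) (swapH_right h) h
    rw [swapH_inv, mul_assoc, swapH_mul_self, mul_one] at this
    exact this
  · have h' : ¬ Dj β α := fun e => h e.symm
    simp [swapH, h, h']

open Classical in
noncomputable def atFun (g : Hm d) (α : Wd d) (x : Cs d) : Cs d :=
  if x ∈ cone α then α ⌢ g (dropC α.length x) else x

theorem atFun_in (g : Hm d) (α : Wd d) (x : Cs d) : atFun g α (α ⌢ x) = α ⌢ g x := by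
  simp [atFun, show α ⌢ x ∈ cone α from ⟨x, rfl⟩, dropC_wa]
theorem atFun_out (g : Hm d) {α : Wd d} {x : Cs d} (h : x ∉ cone α) : atFun g α x = x := by
  simp [atFun, h]
theorem atFun_mul (g h : Hm d) (α : Wd d) (x : Cs d) :
    atFun (g * h) α x = atFun g α (atFun h α x) := by
  by_cases h1 : x ∈ cone α
  · obtain ⟨y, rfl⟩ := h1
    rw [atFun_in, atFun_in, atFun_in]; rfl
  · rw [atFun_out _ h1, atFun_out _ h1, atFun_out _ h1]
theorem atFun_one (α : Wd d) (x : Cs d) : atFun 1 α x = x := by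
  by_cases h1 : x ∈ cone α
  · obtain ⟨y, rfl⟩ := h1
    rw [atFun_in]; rfl
  · rw [atFun_out _ h1]
theorem continuous_atFun (g : Hm d) (α : Wd d) : Continuous (atFun g α) := by
  classical
  unfold atFun
  exact continuous_ite_clopen (isClopen_cone α)
    ((continuous_wa α).comp (g.continuous.comp (continuous_dropC _))) continuous_id

noncomputable def atH (g : Hm d) (α : Wd d) : Hm d where
  toFun := atFun g α
  invFun := atFun g⁻¹ α
  left_inv x := by rw [← atFun_mul, inv_mul_cancel, atFun_one]
  right_inv x := by rw [← atFun_mul, mul_inv_cancel, atFun_one]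
  continuous_toFun := continuous_atFun g α
  continuous_invFun := continuous_atFun g⁻¹ α

theorem atH_at (g : Hm d) (α : Wd d) : At (atH g α) α α g := atFun_in g α
theorem atH_out (g : Hm d) {α : Wd d} {x : Cs d} (h : x ∉ cone α) : atH g α x = x :=
  atFun_out g h
theorem atH_fix (g : Hm d) {α γ : Wd d} (h : Dj γ α) : Mv (atH g α) γ γ := fun x =>
  atH_out g (not_mem_cone_of_dj h x)
theorem atH_mul (g h : Hm d) (α : Wd d) : atH (g * h) α = atH g α * atH h α :=
  hm_ext (atFun_mul g h α)
theorem atH_one (α : Wd d) : atH (1 : Hm d) α = 1 := hm_ext (atFun_one α)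
theorem atH_inv (g : Hm d) (α : Wd d) : atH g⁻¹ α = (atH g α)⁻¹ :=
  eq_inv_of_mul_eq_one_left (by rw [← atH_mul, inv_mul_cancel, atH_one])

theorem atH_nil (g : Hm d) : atH g [] = g := hm_ext fun x => by
  have := atH_at g [] x
  rwa [wa_nil, wa_nil] at this

theorem atH_inj {g h : Hm d} {α : Wd d} (e : atH g α = atH h α) : g = h := hm_ext fun x => by
  apply wa_inj (α := α)
  rw [← atH_at, e, atH_at]

theorem at_conj {h : Hm d} {α α' : Wd d} {k : Hm d} (H : At h α α' k) (g : Hm d) :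
    h * atH g α * h⁻¹ = atH (k * g * k⁻¹) α' := by
  rw [mul_inv_eq_iff_eq_mul]
  apply hm_ext; intro x
  rw [hm_mul_apply, hm_mul_apply]
  by_cases h1 : x ∈ cone α
  · obtain ⟨y, rfl⟩ := h1
    rw [atH_at, H, H, atH_at, hm_mul_apply, hm_mul_apply, hm_inv_apply_self]
  · rw [atH_out _ h1, atH_out _ (H.not_mem h1)]

theorem at_conj_mv {h : Hm d} {α α' : Wd d} (H : Mv h α α') (g : Hm d) :
    h * atH g α * h⁻¹ = atH g α' := by
  simpa using at_conj (mv_iff_at.1 H) g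

theorem atH_comm {α β : Wd d} (h : Dj α β) (g g' : Hm d) :
    atH g α * atH g' β = atH g' β * atH g α := by
  have := at_conj_mv (atH_fix g h.symm) g'
  rwa [mul_inv_eq_iff_eq_mul] at this

def pm : Equiv.Perm (Fin (d + 2)) →* Hm d where
  toFun π :=
    { toFun := fun x n => if n = 0 then π (x 0) else x n
      invFun := fun x n => if n = 0 then π⁻¹ (x 0) else x n
      left_inv := fun x => by funext n; by_cases h : n = 0 <;> simp [h]
      right_inv := fun x => by funext n; by_cases h : n = 0 <;> simp [h]
      continuous_toFun := by
        refine continuous_pi fun n => ?_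
        by_cases h : n = 0
        · simp only [h, if_true]; exact continuous_of_discreteTopology.comp (continuous_apply 0)
        · simp only [h, if_false]; exact continuous_apply n
      continuous_invFun := by
        refine continuous_pi fun n => ?_
        by_cases h : n = 0
        · simp only [h, if_true]; exact continuous_of_discreteTopology.comp (continuous_apply 0)
        · simp only [h, if_false]; exact continuous_apply n }
  map_one' := hm_ext fun x => by
    funext n; by_cases h : n = 0 <;> simp [h]
  map_mul' π ρ := hm_ext fun x => by
    funext n; by_cases h : n = 0 <;> simp [h]

theorem pm_mv (π : Equiv.Perm (Fin (d + 2))) (i : Fin (d + 2)) : Mv (pm π) [i] [π i] := by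
  intro x; funext n
  by_cases h : n = 0 <;> simp [h, pm, wordAppend]

/-- two homeomorphisms agreeing on the cones of a fixed level are equal -/
theorem hm_ext_level {f g : Hm d} (n : ℕ)
    (h : ∀ α : Wd d, α.length = n → ∀ x, f (α ⌢ x) = g (α ⌢ x)) : f = g := hm_ext fun x => by
  obtain ⟨α, y, hα, rfl⟩ := wa_decomp n x
  exact h α hα y

theorem mv_level_eq_one {f : Hm d} (n : ℕ) (h : ∀ α : Wd d, α.length = n → Mv f α α) : f = 1 :=
  hm_ext_level n fun α hα x => h α hα x

/-- fresh words -/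
theorem pick (l : List (Wd d)) (hl : l.length ≤ 7) :
    ∃ c : Wd d, c.length = 3 ∧ ∀ w ∈ l, ¬ c <+: w := by
  classical
  by_contra hc
  push Not at hc
  let f : (Fin 3 → Fin (d + 2)) → Wd d := fun v => List.ofFn v
  have h1 : (Finset.univ.image f) ⊆ (l.map (List.take 3)).toFinset := by
    intro c hcm
    obtain ⟨v, -, rfl⟩ := Finset.mem_image.1 hcm
    obtain ⟨w, hw, hp⟩ := hc (f v) (by simp [f])
    rw [List.mem_toFinset, List.mem_map]
    refine ⟨w, hw, ?_⟩
    have := List.prefix_iff_eq_take.1 hp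
    rw [this]; simp [f]
  have h2 := Finset.card_le_card h1
  have h3 := List.toFinset_card_le (l.map (List.take 3))
  rw [Finset.card_image_of_injective _ (fun a b e => List.ofFn_injective e)] at h2
  simp only [Finset.card_univ, Fintype.card_fun, Fintype.card_fin, List.length_map] at h2 h3
  have : 2 ^ 3 ≤ (d + 2) ^ 3 := Nat.pow_le_pow_left (by omega) 3
  omega

/-- fresh words disjoint from words of length at least 3 -/
theorem pick_dj (l : List (Wd d)) (hl : l.length ≤ 7) (h3 : ∀ w ∈ l, 3 ≤ w.length) :
    ∃ c : Wd d, c.length = 3 ∧ ∀ w ∈ l, Dj c w := by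
  obtain ⟨c, hc, h⟩ := pick l hl
  refine ⟨c, hc, fun w hw => ⟨h w hw, fun hp => h w hw ?_⟩⟩
  have := hp.eq_of_length (le_antisymm hp.length_le (by rw [hc]; exact h3 w hw))
  rw [this]

end Basics

/-! ## Extension of equivariant families from short words to all words -/
section Ext
variable {d : ℕ}

def Sig0 (γ γ' : Wd d) : Prop := (γ.length = 3 ∨ γ.length = 4) ∧ γ'.length = 3 ∧ Dj γ γ'

theorem prefix_or_dj {γ w : Wd d} (h : γ.length ≤ w.length) : γ <+: w ∨ Dj γ w := by
  by_cases h1 : γ <+: w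
  · exact Or.inl h1
  · refine Or.inr ⟨h1, fun h2 => h1 ?_⟩
    rw [h2.eq_of_length (le_antisymm h2.length_le h)]

theorem tri_of_mv {γ γ' w w' : Wd d} (hs : Sig0 γ γ') (h3 : 3 ≤ w.length) (h3' : 3 ≤ w'.length)
    (h : Mv (swapH γ γ') w w') :
    (∃ u, w = γ ++ u ∧ w' = γ' ++ u) ∨ (∃ u, w = γ' ++ u ∧ w' = γ ++ u) ∨
      (Dj γ w ∧ Dj γ' w ∧ w' = w) := by
  obtain ⟨hl, hl', hd⟩ := hs
  have hg' := prefix_or_dj (γ := γ') (w := w) (by omega)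
  by_cases hg : γ <+: w
  · obtain ⟨u, rfl⟩ := hg
    exact Or.inl ⟨u, rfl, h.unique ((swapH_left hd).append u)⟩
  · rcases hg' with ⟨u, rfl⟩ | hg'
    · exact Or.inr (Or.inl ⟨u, rfl, h.unique ((swapH_right hd).append u)⟩)
    · by_cases hw : w <+: γ
      · obtain ⟨u, rfl⟩ := hw
        have h1 := (h.append u).unique (swapH_left hd)
        have : u ≠ [] := by
          rintro rfl; exact hg (by simp)
        have hpos := List.length_pos_of_ne_nil this
        have := congrArg List.length h1
        simp at this; omega
      · have hgd : Dj γ w := ⟨hg, hw⟩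
        exact Or.inr (Or.inr ⟨hgd, hg', h.unique (swapH_fix hgd.symm hg'.symm)⟩)

variable {ι : Type}

def Mvs (h : Hm d) (ω ω' : ι → Wd d) : Prop := ∀ i, Mv h (ω i) (ω' i)

theorem Mvs.trans {h k g : Hm d} {ω ω' ω'' : ι → Wd d} (H : Mvs k ω ω') (H' : Mvs h ω' ω'')
    (e : h * k = g) : Mvs g ω ω'' := fun i => by
  rw [← e]; exact (H' i).mul (H i)

theorem Mvs.symm {α β : Wd d} {ω ω' : ι → Wd d} (H : Mvs (swapH α β) ω ω') :
    Mvs (swapH α β) ω' ω := fun i => by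
  rw [← swapH_inv]; exact (H i).inv

theorem Mvs.unique {h : Hm d} {ω ω' ω'' : ι → Wd d} (H : Mvs h ω ω') (H' : Mvs h ω ω'') :
    ω' = ω'' := funext fun i => (H i).unique (H' i)

structure Valid (ω : ι → Wd d) : Prop where
  len : ∀ i, 3 ≤ (ω i).length
  dj : ∀ i j, i ≠ j → Dj (ω i) (ω j)

theorem Mvs.valid {h : Hm d} {ω ω' : ι → Wd d} (H : Mvs h ω ω') (hv : Valid ω)
    (hl : ∀ i, 3 ≤ (ω' i).length) : Valid ω' :=
  ⟨hl, fun i j hij => (H i).dj (H j) (hv.dj i j hij)⟩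

structure Sh (ω : ι → Wd d) (π c : Wd d) : Prop where
  lp : π.length = 4
  lc : c.length = 3
  ex : ∃ j, π <+: ω j
  dj : ∀ i, Dj c (ω i)

theorem Sh.dj' {ω : ι → Wd d} {π c : Wd d} (h : Sh ω π c) : Dj π c := by
  obtain ⟨j, hj⟩ := h.ex
  refine ⟨fun h1 => ?_, fun h1 => (h.dj j).1 (h1.trans hj)⟩
  have := h1.length_le
  rw [h.lp, h.lc] at this; omega

theorem Sh.sig {ω : ι → Wd d} {π c : Wd d} (h : Sh ω π c) : Sig0 π c :=
  ⟨Or.inr h.lp, h.lc, h.dj'⟩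

theorem Sh.dich {ω : ι → Wd d} {π c : Wd d} (h : Sh ω π c) (hv : Valid ω) (i : ι) :
    π <+: ω i ∨ Dj π (ω i) := by
  by_cases h1 : π <+: ω i
  · exact Or.inl h1
  · refine Or.inr ⟨h1, fun h2 => ?_⟩
    obtain ⟨j, hj⟩ := h.ex
    by_cases hij : i = j
    · subst hij; exact h1 hj
    · exact (hv.dj i j hij).1 (h2.trans hj)

variable [Fintype ι]

def wsz (ω : ι → Wd d) : ℕ := ∑ i, (ω i).length

theorem Sh.mv {ω : ι → Wd d} {π c : Wd d} (h : Sh ω π c) (hv : Valid ω) :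
    ∃ ω', Mvs (swapH π c) ω ω' ∧ Valid ω' ∧ wsz ω' < wsz ω := by
  have key : ∀ i, ∃ w, Mv (swapH π c) (ω i) w ∧ 3 ≤ w.length ∧ w.length ≤ (ω i).length ∧
      (π <+: ω i → w.length < (ω i).length) := by
    intro i
    rcases h.dich hv i with ⟨u, hu⟩ | h1
    · refine ⟨c ++ u, ?_, ?_, ?_, ?_⟩
      · rw [← hu]; exact (swapH_left h.dj').append u
      · simp [h.lc]
      · rw [← hu]; simp [h.lc, h.lp]
      · rw [← hu]; simp [h.lc, h.lp]
    · exact ⟨ω i, swapH_fix h1.symm (h.dj i).symm, hv.len i, le_rfl, fun h2 => absurd h2 h1.1⟩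
  choose ω' h1 h2 h3 h4 using key
  refine ⟨ω', h1, Mvs.valid h1 hv h2, ?_⟩
  obtain ⟨j, hj⟩ := h.ex
  exact Finset.sum_lt_sum (fun i _ => h3 i) ⟨j, Finset.mem_univ _, h4 j hj⟩

theorem fresh (hι : Fintype.card ι ≤ 2) (l : List (Wd d)) (hl : l.length ≤ 5)
    (h3 : ∀ w ∈ l, 3 ≤ w.length) {ω : ι → Wd d} (hv : Valid ω) :
    ∃ c : Wd d, c.length = 3 ∧ (∀ w ∈ l, Dj c w) ∧ ∀ i, Dj c (ω i) := by
  classical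
  obtain ⟨c, hc, h⟩ := pick_dj (l ++ (Finset.univ : Finset ι).toList.map ω) (by
    simp only [List.length_append, List.length_map, Finset.length_toList, Finset.card_univ]
    omega) (by
    intro w hw
    rcases List.mem_append.1 hw with hw | hw
    · exact h3 w hw
    · obtain ⟨i, -, rfl⟩ := List.mem_map.1 hw
      exact hv.len i)
  refine ⟨c, hc, fun w hw => h w (List.mem_append_left _ hw), fun i => h _ ?_⟩
  exact List.mem_append_right _ (List.mem_map.2 ⟨i, by simp, rfl⟩)

theorem sh_ex (hι : Fintype.card ι ≤ 2) {ω : ι → Wd d} (hv : Valid ω) (hb : ¬ ∀ i, (ω i).length = 3)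
    (l : List (Wd d)) (hl : l.length ≤ 5)
    (h3 : ∀ w ∈ l, 3 ≤ w.length) :
    ∃ j π c, Sh ω π c ∧ (∀ w ∈ l, Dj c w) ∧ π <+: ω j := by
  push Not at hb
  obtain ⟨j, hj⟩ := hb
  have h4 : 4 ≤ (ω j).length := by have := hv.len j; omega
  obtain ⟨c, hc, h1, h2⟩ := fresh hι l hl h3 hv
  exact ⟨j, (ω j).take 4, c, ⟨by simp [h4], hc, ⟨j, take_pfx _ _⟩, h2⟩, h1,
    take_pfx _ _⟩

/-- connectivity -/
theorem ext_connect (hι : Fintype.card ι ≤ 2) (P : (ι → Wd d) → Prop)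
    (hb : ∀ ω, Valid ω → (∀ i, (ω i).length = 3) → P ω)
    (hs : ∀ ω ω' γ γ', Valid ω → Valid ω' → Sig0 γ γ' → Mvs (swapH γ γ') ω' ω →
      (∀ i, (ω' i).length ≤ (ω i).length) → P ω' → P ω) :
    ∀ ω, Valid ω → P ω := by
  suffices ∀ n ω, wsz ω ≤ n → Valid ω → P ω from fun ω hv => this _ ω le_rfl hv
  intro n
  induction n using Nat.strong_induction_on with
  | _ n ih =>
    intro ω hn hv
    by_cases hbb : ∀ i, (ω i).length = 3
    · exact hb ω hv hbb
    · obtain ⟨j, π, c, hsh, -⟩ := sh_ex hι hv hbb [] (by simp) (by simp)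
      obtain ⟨ω', h1, h2, h3⟩ := hsh.mv hv
      have hle : ∀ i, (ω' i).length ≤ (ω i).length := by
        intro i
        rcases hsh.dich hv i with ⟨u, hu⟩ | h4
        · have : ω' i = c ++ u := (h1 i).unique
            (by rw [← hu]; exact (swapH_left hsh.dj').append u)
          rw [this, ← hu]; simp [hsh.lc, hsh.lp]
        · rw [(h1 i).unique (swapH_fix h4.symm (hsh.dj i).symm)]
      exact hs ω ω' π c hv h2 hsh.sig h1.symm hle (ih (wsz ω') (by omega) ω' le_rfl h2)

variable {K : Type*} [Group K]

structure TRel (T : Wd d → Wd d → K) : Prop where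
  inv : ∀ {a b}, Sig0 a b → T a b * T a b = 1
  conj : ∀ {a b a1 b1 a2 b2}, Sig0 a b → Sig0 a1 b1 → Sig0 a2 b2 →
    swapH a b * swapH a1 b1 * swapH a b = swapH a2 b2 → T a b * T a1 b1 * T a b = T a2 b2

structure ExtHyp (T : Wd d → Wd d → K) (F0 : (ι → Wd d) → K) : Prop where
  bs : ∀ {a b : Wd d} {ω ω'}, Valid ω → Valid ω' → (∀ i, (ω i).length = 3) →
    (∀ i, (ω' i).length = 3) → Sig0 a b → Mvs (swapH a b) ω ω' → F0 ω' = T a b * F0 ω * T a b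
  bd : ∀ {a b : Wd d} {ω}, Valid ω → (∀ i, (ω i).length = 3) → Sig0 a b →
    (∀ i, Dj a (ω i)) → (∀ i, Dj b (ω i)) → F0 ω = T a b * F0 ω * T a b

inductive ER (T : Wd d → Wd d → K) (F0 : (ι → Wd d) → K) : (ι → Wd d) → K → Prop
  | base (ω) : (∀ i, (ω i).length = 3) → ER T F0 ω (F0 ω)
  | step (ω ω' π c k) : Sh ω π c → Mvs (swapH π c) ω ω' → ER T F0 ω' k →
      ER T F0 ω (T π c * k * T π c)

variable {T : Wd d → Wd d → K} {F0 : (ι → Wd d) → K}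

theorem cj_cancel {t k : K} (h : t * t = 1) : t * (t * k * t) * t = k := by
  have : t * (t * k * t) * t = (t * t) * k * (t * t) := by group
  rw [this, h]; simp

theorem er_total (hι : Fintype.card ι ≤ 2) : ∀ ω, Valid ω → ∃ k, ER T F0 ω k := by
  suffices ∀ n ω, wsz ω ≤ n → Valid ω → ∃ k, ER T F0 ω k from fun ω hv => this _ ω le_rfl hv
  intro n
  induction n using Nat.strong_induction_on with
  | _ n ih =>
    intro ω hn hv
    by_cases hbb : ∀ i, (ω i).length = 3
    · exact ⟨_, ER.base ω hbb⟩
    · obtain ⟨j, π, c, hsh, -⟩ := sh_ex hι hv hbb [] (by simp) (by simp)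
      obtain ⟨ω', h1, h2, h3⟩ := hsh.mv hv
      obtain ⟨k, hk⟩ := ih (wsz ω') (by omega) ω' le_rfl h2
      exact ⟨_, ER.step _ _ _ _ _ hsh h1 hk⟩

def ExtP (T : Wd d → Wd d → K) (F0 : (ι → Wd d) → K) (n : ℕ) : Prop :=
  ∀ ω, Valid ω → wsz ω < n → ∀ k, ER T F0 ω k →
    (∀ k', ER T F0 ω k' → k = k') ∧
    (∀ γ γ' ω', Sig0 γ γ' → Valid ω' → wsz ω' < n → Mvs (swapH γ γ') ω ω' →
      ER T F0 ω' (T γ γ' * k * T γ γ'))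

theorem swap_eq_of_mv {α β α' β' γ γ' : Wd d} (hd : Dj α β) (H : Mv (swapH γ γ') α α')
    (H' : Mv (swapH γ γ') β β') :
    swapH γ γ' * swapH α β * swapH γ γ' = swapH α' β' := by
  have := swap_conj H H' hd
  rwa [swapH_inv] at this

theorem swap_comm3 {α β γ γ' : Wd d} (hd : Dj α β) (h1 : Dj α γ) (h2 : Dj α γ') (h3 : Dj β γ)
    (h4 : Dj β γ') : swapH γ γ' * swapH α β * swapH γ γ' = swapH α β :=
  swap_eq_of_mv hd (swapH_fix h1 h2) (swapH_fix h3 h4)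

/-- three-term homeo manipulation: from `t*s*t = r`, `t*t=1` -/
theorem cj_move {t s r : K} (ht : t * t = 1) (h : t * s * t = r) : t * s = r * t := by
  rw [← h]; simp [mul_assoc, ht]

theorem claim_same (hT : TRel T) {n : ℕ} (ih : ExtP T F0 n) {ω ω1 ω2 : ι → Wd d} {π c1 c2 : Wd d}
    {k2 : K} (hv : Valid ω) (hn : wsz ω < n + 1) (s1 : Sh ω π c1) (s2 : Sh ω π c2)
    (m1 : Mvs (swapH π c1) ω ω1) (m2 : Mvs (swapH π c2) ω ω2) (hk : ER T F0 ω2 k2) :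
    ER T F0 ω1 (T π c1 * (T π c2 * k2 * T π c2) * T π c1) := by
  by_cases hc : c1 = c2
  · subst hc
    rw [cj_cancel (hT.inv s1.sig), m1.unique m2]; exact hk
  · have hdc : Dj c1 c2 := dj_of_len (by rw [s1.lc, s2.lc]) hc
    obtain ⟨ω1', m1', v1, z1⟩ := s1.mv hv
    obtain rfl := m1.unique m1'
    obtain ⟨ω2', m2', v2, z2⟩ := s2.mv hv
    obtain rfl := m2.unique m2'
    have sg : Sig0 c2 c1 := ⟨Or.inl s2.lc, s1.lc, hdc.symm⟩
    have e1 : swapH π c1 * swapH π c2 * swapH π c1 = swapH c2 c1 := by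
      rw [swapH_symm c2 c1]
      exact swap_eq_of_mv s2.dj' (swapH_left s1.dj') (swapH_fix s2.dj'.symm hdc.symm)
    have e2 : swapH c2 c1 * swapH π c2 * swapH c2 c1 = swapH π c1 :=
      swap_eq_of_mv s2.dj' (swapH_fix s2.dj' s1.dj') (swapH_left hdc.symm)
    have hT1 := hT.conj s1.sig s2.sig sg e1
    -- `π c1` fixes ω2
    have f2 : Mvs (swapH π c1) ω2 ω2 := by
      intro i
      rcases s2.dich hv i with ⟨u, hu⟩ | h1
      · have : ω2 i = c2 ++ u := (m2 i).unique (by rw [← hu]; exact (swapH_left s2.dj').append u)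
        rw [this]
        exact (swapH_fix s2.dj'.symm hdc.symm).append u
      · have : ω2 i = ω i := (m2 i).unique (swapH_fix h1.symm (s2.dj i).symm)
        rw [this]
        exact swapH_fix h1.symm (s1.dj i).symm
    have mr : Mvs (swapH c2 c1) ω2 ω1 := by
      have e3 : swapH π c1 * swapH π c2 = swapH c2 c1 * swapH π c1 :=
        cj_move (swapH_mul_self _ _) e1
      intro i
      have h1 := (m2.symm i)
      have h2 : Mv (swapH π c1 * swapH π c2) (ω2 i) (ω1 i) := (m1 i).mul h1
      rw [e3] at h2
      have h3 : Mv (swapH c2 c1 * swapH π c1 * swapH π c1) (ω2 i) (ω1 i) := h2.mul (f2 i)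
      rwa [mul_assoc, swapH_mul_self, mul_one] at h3
    obtain ⟨hU, hE⟩ := ih ω2 v2 (by omega) k2 hk
    have hk' := hU _ (hE π c1 ω2 s1.sig v2 (by omega) f2)
    have := hE c2 c1 ω1 sg v1 (by omega) mr
    have e4 : T π c1 * (T π c2 * k2 * T π c2) * T π c1 =
        T c2 c1 * (T π c1 * k2 * T π c1) * T c2 c1 := by
      rw [← hT1]
      have i1 := hT.inv s1.sig
      have : T π c1 * T π c2 * T π c1 * (T π c1 * k2 * T π c1) * (T π c1 * T π c2 * T π c1) =
        T π c1 * T π c2 * (T π c1 * T π c1) * k2 * (T π c1 * T π c1) * T π c2 * T π c1 := by group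
      rw [this, i1]; group
    rw [e4, ← hk']; exact this

theorem claim_diff (hT : TRel T) {n : ℕ} (ih : ExtP T F0 n) {ω ω1 ω2 : ι → Wd d}
    {π1 π2 c1 c2 : Wd d}
    {k2 : K} (hv : Valid ω) (hn : wsz ω < n + 1) (s1 : Sh ω π1 c1) (s2 : Sh ω π2 c2)
    (hp : π1 ≠ π2) (hc : c1 ≠ c2)
    (m1 : Mvs (swapH π1 c1) ω ω1) (m2 : Mvs (swapH π2 c2) ω ω2) (hk : ER T F0 ω2 k2) :
    ER T F0 ω1 (T π1 c1 * (T π2 c2 * k2 * T π2 c2) * T π1 c1) := by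
  have hdc : Dj c1 c2 := dj_of_len (by rw [s1.lc, s2.lc]) hc
  have hdp : Dj π1 π2 := dj_of_len (by rw [s1.lp, s2.lp]) hp
  have hnp : ∀ {a b : Wd d}, a.length = 3 → b.length = 4 → (∃ j, b <+: ω j) →
      (∀ i, Dj a (ω i)) → Dj a b := by
    rintro a b ha hb ⟨j, hj⟩ hd
    refine ⟨fun h => (hd j).1 (h.trans hj), fun h => ?_⟩
    have := h.length_le; omega
  have h12 : Dj c1 π2 := hnp s1.lc s2.lp s2.ex s1.dj
  have h21 : Dj c2 π1 := hnp s2.lc s1.lp s1.ex s2.dj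
  obtain ⟨ω1', m1', v1, z1⟩ := s1.mv hv
  obtain rfl := m1.unique m1'
  obtain ⟨ω2', m2', v2, z2⟩ := s2.mv hv
  obtain rfl := m2.unique m2'
  have main : ∀ {ω2 : ι → Wd d} {π1 π2 c1 c2 : Wd d}, Sh ω π1 c1 → Sh ω π2 c2 → Dj π1 π2 →
      Dj c1 c2 → Mvs (swapH π2 c2) ω ω2 → Sh ω2 π1 c1 := by
    intro ω2 π1 π2 c1 c2 s1 s2 hdp hdc m2
    refine ⟨s1.lp, s1.lc, ?_, ?_⟩
    · obtain ⟨j, hj⟩ := s1.ex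
      refine ⟨j, ?_⟩
      have : ω2 j = ω j := (m2 j).unique
        (swapH_fix (hdp.mono hj (List.prefix_refl _)) (s2.dj j).symm)
      rwa [this]
    · intro i
      rcases s2.dich hv i with ⟨u, hu⟩ | h1
      · have : ω2 i = c2 ++ u := (m2 i).unique (by rw [← hu]; exact (swapH_left s2.dj').append u)
        rw [this]; exact hdc.right u
      · have : ω2 i = ω i := (m2 i).unique (swapH_fix h1.symm (s2.dj i).symm)
        rw [this]; exact s1.dj i
  have s12 := main s1 s2 hdp hdc m2
  have s21 := main s2 s1 hdp.symm hdc.symm m1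
  obtain ⟨ω3, m3, v3, z3⟩ := s12.mv v2
  have e1 : swapH π1 c1 * swapH π2 c2 * swapH π1 c1 = swapH π2 c2 :=
    swap_comm3 s2.dj' hdp.symm h12.symm h21 hdc.symm
  have m4 : Mvs (swapH π2 c2) ω1 ω3 :=
    (m1.symm.trans m2 rfl).trans m3 (by rw [← mul_assoc, e1])
  have hE := (ih ω2 v2 (by omega) k2 hk).2 π1 c1 ω3 s1.sig v3 (by omega) m3
  have := ER.step _ _ _ _ _ s21 m4 hE
  have e2 := cj_move (hT.inv s1.sig) (hT.conj s1.sig s2.sig s2.sig e1)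
  have e3 : T π1 c1 * (T π2 c2 * k2 * T π2 c2) * T π1 c1 =
      (T π1 c1 * T π2 c2) * k2 * (T π2 c2 * T π1 c1) := by group
  rw [e3, ← e2, e2]
  have e4 : T π2 c2 * T π1 c1 * k2 * (T π1 c1 * T π2 c2) =
     T π2 c2 * (T π1 c1 * k2 * T π1 c1) * T π2 c2 := by group
  rw [← e4, e2] at this; exact this

theorem claim1 (hι : Fintype.card ι ≤ 2) (hT : TRel T) {n : ℕ} (ih : ExtP T F0 n)
    {ω ω1 : ι → Wd d} {π c : Wd d}
    {k : K} (hv : Valid ω) (hn : wsz ω < n + 1) (s1 : Sh ω π c)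
    (m1 : Mvs (swapH π c) ω ω1) (hk : ER T F0 ω k) :
    ER T F0 ω1 (T π c * k * T π c) := by
  cases hk with
  | base _ hb =>
    obtain ⟨j, hj⟩ := s1.ex
    have := hj.length_le
    rw [s1.lp, hb j] at this; omega
  | step _ ω2 π2 c2 k2 s2 m2 hk2 =>
    by_cases hp : π = π2
    · subst hp
      exact claim_same hT ih hv hn s1 s2 m1 m2 hk2
    · by_cases hc : c = c2
      · subst hc
        obtain ⟨c3, l3, d3, d3'⟩ := fresh hι [c] (by simp) (by simp [s1.lc]) hv
        have hcc : Dj c3 c := d3 c (by simp)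
        have s3 : Sh ω π c3 := ⟨s1.lp, l3, s1.ex, d3'⟩
        obtain ⟨ω3, m3, v3, z3⟩ := s3.mv hv
        have h3 := claim_diff hT ih hv hn s3 s2 hp hcc.ne m3 m2 hk2
        have := claim_same hT ih hv hn s1 s3 m1 m3 h3
        rwa [cj_cancel (hT.inv s3.sig)] at this
      · exact claim_diff hT ih hv hn s1 s2 hp hc m1 m2 hk2

theorem mv_sig3 {γ γ' w : Wd d} (h : γ.length = 3) (h' : γ'.length = 3) (hd : Dj γ γ')
    (hw : 3 ≤ w.length) : ∃ w', Mv (swapH γ γ') w w' ∧ w'.length = w.length := by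
  rcases prefix_or_dj (γ := γ) (w := w) (by omega) with ⟨u, rfl⟩ | h1
  · exact ⟨_, (swapH_left hd).append u, by simp [h, h']⟩
  · rcases prefix_or_dj (γ := γ') (w := w) (by omega) with ⟨u, rfl⟩ | h2
    · exact ⟨_, (swapH_right hd).append u, by simp [h, h']⟩
    · exact ⟨_, swapH_fix h1.symm h2.symm, rfl⟩

theorem extP_all (hι : Fintype.card ι ≤ 2) (hT : TRel T) (hF : ExtHyp T F0) (n : ℕ) :
    ExtP T F0 n := by
  induction n with
  | zero => intro ω _ h; omega
  | succ n ih =>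
    have hU : ∀ ω, Valid ω → wsz ω < n + 1 → ∀ k k', ER T F0 ω k → ER T F0 ω k' → k = k' := by
      intro ω hv hn k k' hk hk'
      cases hk' with
      | base _ hb =>
        cases hk with
        | base => rfl
        | step _ ω2 π2 c2 k2 s2 m2 hk2 =>
          obtain ⟨j, hj⟩ := s2.ex
          have := hj.length_le
          rw [s2.lp, hb j] at this; omega
      | step _ ω2 π2 c2 k2 s2 m2 hk2 =>
        have h1 := claim1 hι hT ih hv hn s2 m2 hk
        obtain ⟨ω2', m2', v2, z2⟩ := s2.mv hv
        obtain rfl := m2.unique m2'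
        have h2 := (ih ω2 v2 (by omega) _ h1).1 _ hk2
        rw [← h2, cj_cancel (hT.inv s2.sig)]
    -- equivariance, case length four with some ω j above γ
    have hA : ∀ ω, Valid ω → wsz ω < n + 1 → ∀ k, ER T F0 ω k →
        ∀ γ γ' ω', Sig0 γ γ' → γ.length = 4 → (∃ j, γ <+: ω j) → Valid ω' → wsz ω' < n + 1 →
        Mvs (swapH γ γ') ω ω' → ER T F0 ω' (T γ γ' * k * T γ γ') := by
      intro ω hv hn k hk γ γ' ω' sg hl hj hv' hn' m
      by_cases hc : ∀ i, ¬ γ' <+: ω i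
      · have s : Sh ω γ γ' := ⟨hl, sg.2.1, hj, fun i =>
          (prefix_or_dj (by rw [sg.2.1]; exact hv.len i)).resolve_left (hc i)⟩
        exact claim1 hι hT ih hv hn s m hk
      · push Not at hc
        obtain ⟨i, hi⟩ := hc
        obtain ⟨c, lc, dc, dcω⟩ := fresh hι [γ, γ'] (by simp) (by simp [hl, sg.2.1]) hv
        have dc1 : Dj c γ := dc γ (by simp)
        have dc2 : Dj c γ' := dc γ' (by simp)
        have fc : Mv (swapH γ γ') c c := swapH_fix dc1 dc2
        have s1 : Sh ω γ c := ⟨hl, lc, hj, dcω⟩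
        have s2 : Sh ω' γ c := by
          refine ⟨hl, lc, ⟨i, ?_⟩, fun i => fc.dj (m i) (dcω i)⟩
          obtain ⟨u, hu⟩ := hi
          have : ω' i = γ ++ u := (m i).unique
            (by rw [← hu]; exact (swapH_right sg.2.2).append u)
          rw [this]; exact List.prefix_append _ _
        obtain ⟨ω1, m1, v1, z1⟩ := s1.mv hv
        obtain ⟨ω2, m2, v2, z2⟩ := s2.mv hv'
        have h1 := claim1 hι hT ih hv hn s1 m1 hk
        have sr : Sig0 γ' c := ⟨Or.inl sg.2.1, lc, dc2.symm⟩
        have e1 : swapH γ c * swapH γ γ' * swapH γ c = swapH γ' c := by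
          rw [swapH_symm γ' c]
          exact swap_eq_of_mv sg.2.2 (swapH_left dc1.symm) (swapH_fix sg.2.2.symm dc2.symm)
        have mr : Mvs (swapH γ' c) ω1 ω2 :=
          (m1.symm.trans m rfl).trans m2 (by rw [← e1, mul_assoc])
        have h2 := (ih ω1 v1 (by omega) _ h1).2 γ' c ω2 sr v2 (by omega) mr
        have h3 := ER.step _ _ _ _ _ s2 m2 h2
        have e2 := hT.conj s1.sig sg sr e1
        have i1 := hT.inv s1.sig
        have e3 : T γ c * (T γ' c * (T γ c * k * T γ c) * T γ' c) * T γ c =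
          T γ γ' * k * T γ γ' := by
          rw [← e2]
          have : T γ c * (T γ c * T γ γ' * T γ c * (T γ c * k * T γ c) *
            (T γ c * T γ γ' * T γ c)) * T γ c = (T γ c * T γ c) * T γ γ' * (T γ c * T γ c) * k *
            (T γ c * T γ c) * T γ γ' * (T γ c * T γ c) := by group
          rw [this, i1]; group
        rwa [e3] at h3
    have hE : ∀ ω, Valid ω → wsz ω < n + 1 → ∀ k, ER T F0 ω k →
        ∀ γ γ' ω', Sig0 γ γ' → Valid ω' → wsz ω' < n + 1 →
        Mvs (swapH γ γ') ω ω' → ER T F0 ω' (T γ γ' * k * T γ γ') := by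
      intro ω hv hn k hk γ γ' ω' sg hv' hn' m
      rcases sg.1 with hl | hl
      · -- length three
        by_cases hb : ∀ i, (ω i).length = 3
        · have hb' : ∀ i, (ω' i).length = 3 := by
            intro i
            obtain ⟨w', h1, h2⟩ := mv_sig3 hl sg.2.1 sg.2.2 (hv.len i)
            rw [(m i).unique h1, h2, hb i]
          have : k = F0 ω := hU ω hv hn _ _ hk (ER.base ω hb)
          rw [this, ← hF.bs hv hv' hb hb' sg m]
          exact ER.base ω' hb'
        · obtain ⟨j, π, c, s1, dc, hj⟩ := sh_ex hι hv hb [γ, γ'] (by simp) (by simp [hl, sg.2.1])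
          have fc : Mv (swapH γ γ') c c := swapH_fix (dc γ (by simp)) (dc γ' (by simp))
          obtain ⟨π', mp, lp⟩ := mv_sig3 hl sg.2.1 sg.2.2 (w := π) (by rw [s1.lp]; omega)
          have s2 : Sh ω' π' c := by
            refine ⟨by rw [lp, s1.lp], s1.lc, ⟨j, ?_⟩, fun i => fc.dj (m i) (s1.dj i)⟩
            obtain ⟨u, hu⟩ := hj
            have : ω' j = π' ++ u := (m j).unique (by rw [← hu]; exact mp.append u)
            rw [this]; exact List.prefix_append _ _
          obtain ⟨ω1, m1, v1, z1⟩ := s1.mv hv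
          obtain ⟨ω2, m2, v2, z2⟩ := s2.mv hv'
          have h1 := claim1 hι hT ih hv hn s1 m1 hk
          have e1 : swapH γ γ' * swapH π c * swapH γ γ' = swapH π' c := swap_eq_of_mv s1.dj' mp fc
          have mt : Mvs (swapH γ γ') ω1 ω2 :=
            (m1.symm.trans m rfl).trans m2 (by
              rw [cj_move (swapH_mul_self _ _) e1, ← mul_assoc, swapH_mul_self, one_mul])
          have h2 := (ih ω1 v1 (by omega) _ h1).2 γ γ' ω2 sg v2 (by omega) mt
          have h3 := ER.step _ _ _ _ _ s2 m2 h2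
          have e2 := hT.conj sg s1.sig s2.sig e1
          have i1 := hT.inv s1.sig
          have i2 := hT.inv sg
          have e3 : T π' c * (T γ γ' * (T π c * k * T π c) * T γ γ') * T π' c =
            T γ γ' * k * T γ γ' := by
            rw [← e2]
            have : T γ γ' * T π c * T γ γ' * (T γ γ' * (T π c * k * T π c) * T γ γ') *
              (T γ γ' * T π c * T γ γ') = T γ γ' * T π c * (T γ γ' * T γ γ') * T π c * k * T π c *
              (T γ γ' * T γ γ') * T π c * T γ γ' := by group
            rw [this, i2]
            have : T γ γ' * T π c * 1 * T π c * k * T π c * 1 * T π c * T γ γ' =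
              T γ γ' * (T π c * T π c) * k * (T π c * T π c) * T γ γ' := by group
            rw [this, i1]; group
          rwa [e3] at h3
      · by_cases hA1 : ∃ j, γ <+: ω j
        · exact hA ω hv hn k hk γ γ' ω' sg hl hA1 hv' hn' m
        · by_cases hA2 : ∃ j, γ <+: ω' j
          · obtain ⟨k', hk'⟩ := er_total (T := T) (F0 := F0) hι ω' hv'
            have := hA ω' hv' hn' k' hk' γ γ' ω sg hl hA2 hv hn m.symm
            rw [hU ω hv hn _ _ hk this, cj_cancel (hT.inv sg)]; exact hk'
          · push Not at hA1 hA2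
            have tri : ∀ i, Dj γ (ω i) ∧ Dj γ' (ω i) ∧ ω' i = ω i := by
              intro i
              rcases tri_of_mv sg (hv.len i) (hv'.len i) (m i) with
                ⟨u, h1, h2⟩ | ⟨u, h1, h2⟩ | h
              · exact absurd ⟨u, h1.symm⟩ (hA1 i)
              · exact absurd ⟨u, h2.symm⟩ (hA2 i)
              · exact h
            have : ω' = ω := funext fun i => (tri i).2.2
            subst this
            by_cases hb : ∀ i, (ω' i).length = 3
            · have : k = F0 ω' := hU ω' hv hn _ _ hk (ER.base ω' hb)
              rw [this, ← hF.bd hv hb sg (fun i => (tri i).1) (fun i => (tri i).2.1)]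
              exact ER.base ω' hb
            · obtain ⟨j, π, c, s1, dc, hj⟩ :=
                sh_ex hι hv hb [γ, γ'] (by simp) (by simp [hl, sg.2.1])
              have hpg : Dj π γ := dj_of_len (by rw [s1.lp, hl])
                (fun e => hA1 j (e ▸ hj))
              have hpg' : Dj π γ' := by
                refine ⟨fun h => ?_, fun h => (tri j).2.1.1 (h.trans hj)⟩
                have := h.length_le
                rw [s1.lp, sg.2.1] at this; omega
              have e1 : swapH γ γ' * swapH π c * swapH γ γ' = swapH π c :=
                swap_comm3 s1.dj' hpg hpg' (dc γ (by simp)) (dc γ' (by simp))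
              obtain ⟨ω1, m1, v1, z1⟩ := s1.mv hv
              have h1 := claim1 hι hT ih hv hn s1 m1 hk
              have mt : Mvs (swapH γ γ') ω1 ω1 :=
                (m1.symm.trans m rfl).trans m1 (by
                  rw [cj_move (swapH_mul_self _ _) e1, ← mul_assoc, swapH_mul_self, one_mul])
              have h2 := (ih ω1 v1 (by omega) _ h1).2 γ γ' ω1 sg v1 (by omega) mt
              have h3 := ER.step _ _ _ _ _ s1 m1 h2
              have e2 := cj_move (hT.inv sg) (hT.conj sg s1.sig s1.sig e1)
              have e3 : T π c * (T γ γ' * (T π c * k * T π c) * T γ γ') * T π c =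
                T γ γ' * k * T γ γ' := by
                have : T π c * (T γ γ' * (T π c * k * T π c) * T γ γ') * T π c =
                  T π c * (T γ γ' * T π c) * k * (T π c * (T γ γ' * T π c)) := by group
                rw [this, e2]
                have : T π c * (T π c * T γ γ') * k * (T π c * (T π c * T γ γ')) =
                  (T π c * T π c) * T γ γ' * k * ((T π c * T π c) * T γ γ') := by group
                rw [this, hT.inv s1.sig]; group
              rwa [e3] at h3
    intro ω hv hn k hk
    exact ⟨fun k' hk' => hU ω hv hn k k' hk hk', hE ω hv hn k hk⟩

theorem ext_main (hι : Fintype.card ι ≤ 2) (hT : TRel T) (hF : ExtHyp T F0) :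
    ∃ F : (ι → Wd d) → K, (∀ ω, Valid ω → (∀ i, (ω i).length = 3) → F ω = F0 ω) ∧
      ∀ γ γ' ω ω', Sig0 γ γ' → Valid ω → Valid ω' → Mvs (swapH γ γ') ω ω' →
        F ω' = T γ γ' * F ω * T γ γ' := by
  classical
  have key : ∀ ω : ι → Wd d, ∃ k, Valid ω → ER T F0 ω k := by
    intro ω
    by_cases hv : Valid ω
    · obtain ⟨k, hk⟩ := er_total (T := T) (F0 := F0) hι ω hv
      exact ⟨k, fun _ => hk⟩
    · exact ⟨1, fun h => absurd h hv⟩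
  choose F hFF using key
  refine ⟨F, fun ω hv hb => ?_, fun γ γ' ω ω' sg hv hv' m => ?_⟩
  · exact (extP_all hι hT hF (wsz ω + 1) ω hv (by omega) _ (hFF ω hv)).1 _ (ER.base ω hb)
  · have h1 := (extP_all hι hT hF (wsz ω + wsz ω' + 1) ω hv (by omega) _ (hFF ω hv)).2 γ γ' ω' sg
      hv' (by omega) m
    exact (extP_all hι hT hF (wsz ω' + 1) ω' hv' (by omega) _ (hFF ω' hv')).1 _ h1

end Ext

/-! ## The systems of generators and the extended families -/
section SysSec
variable {d : ℕ}

inductive Contr (N : Set (Hm d)) : Hm d → Prop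
  | mem (g) : g ∈ N → Contr N g
  | node (g) (π : Equiv.Perm (Fin (d + 2))) (s : Fin (d + 2) → Hm d) :
      (∀ i, At g [i] [π i] (s i)) → (∀ i, Contr N (s i)) → Contr N g

structure Nuc (N : Set (Hm d)) : Prop where
  one : 1 ∈ N
  inv : ∀ g ∈ N, g⁻¹ ∈ N
  sec : ∀ g ∈ N, ∃ (π : Equiv.Perm (Fin (d + 2))) (s : Fin (d + 2) → Hm d),
    (∀ i, s i ∈ N) ∧ ∀ i, At g [i] [π i] (s i)
  contr : ∀ g ∈ N, ∀ h ∈ N, Contr N (g * h)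

def SE (N : Set (Hm d)) : Set (Hm d) :=
  {h | ∃ α β : Wd d, 3 ≤ α.length ∧ α.length ≤ 4 ∧ 3 ≤ β.length ∧ β.length ≤ 4 ∧ Dj α β ∧
    swapH α β = h} ∪
  {h | ∃ g ∈ N, ∃ α : Wd d, 3 ≤ α.length ∧ α.length ≤ 4 ∧ atH g α = h} ∪
  {h | ∃ (b : Wd d) (π : Equiv.Perm (Fin (d + 2))), b.length = 3 ∧ atH (pm π) b = h}

variable {K : Type*} [Group K]

structure Sys (N : Set (Hm d)) (φ : K →* Hm d) (σ : Hm d → K) : Prop where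
  sec : ∀ s ∈ SE N, φ (σ s) = s
  rel : ∀ l1 l2 : List (Hm d), (∀ s ∈ l1, s ∈ SE N) → (∀ s ∈ l2, s ∈ SE N) →
    l1.length ≤ d + 5 → l2.length ≤ d + 5 → l1.prod = l2.prod →
    (l1.map σ).prod = (l2.map σ).prod
  gen : Subgroup.closure (σ '' SE N) = ⊤

def pr {M : Type*} [Monoid M] (f : Fin (d + 2) → M) : M := ((List.finRange (d + 2)).map f).prod

theorem list_fix {ι : Type*} (f : ι → Hm d) (L : List ι) (x : Cs d) (h : ∀ i ∈ L, f i x = x) :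
    (L.map f).prod x = x := by
  induction L with
  | nil => rfl
  | cons a L ih =>
    rw [List.map_cons, List.prod_cons, hm_mul_apply, ih fun i hi => h i (by simp [hi]),
      h a (by simp)]

theorem list_single {ι : Type*} (f : ι → Hm d) (L : List ι) (hL : L.Nodup) (x : Cs d) (j : ι)
    (hj : j ∈ L)
    (h : ∀ i ∈ L, i ≠ j → f i x = x ∧ f i (f j x) = f j x) : (L.map f).prod x = f j x := by
  induction L with
  | nil => simp at hj
  | cons a L ih =>
    rw [List.map_cons, List.prod_cons, hm_mul_apply]
    rw [List.nodup_cons] at hL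
    by_cases ha : a = j
    · subst ha
      rw [list_fix]
      intro i hi
      exact (h i (by simp [hi]) (fun e => hL.1 (e ▸ hi))).1
    · have hj' : j ∈ L := by
        rcases List.mem_cons.1 hj with h1 | h1
        · exact absurd h1.symm ha
        · exact h1
      rw [ih hL.2 hj' fun i hi hne => h i (by simp [hi]) hne]
      exact (h a (by simp) ha).2

theorem pr_fix (f : Fin (d + 2) → Hm d) (x : Cs d) (h : ∀ i, f i x = x) : pr f x = x :=
  list_fix _ _ _ fun i _ => h i

theorem pr_single (f : Fin (d + 2) → Hm d) (x : Cs d) (j : Fin (d + 2))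
    (h : ∀ i, i ≠ j → f i x = x ∧ f i (f j x) = f j x) : pr f x = f j x :=
  list_single _ _ (List.nodup_finRange _) _ _ (List.mem_finRange j) fun i _ => h i

theorem map_pr {M M' : Type*} [Monoid M] [Monoid M'] (φ : M →* M') (f : Fin (d + 2) → M) :
    φ (pr f) = pr fun i => φ (f i) := by
  simp [pr, map_list_prod, Function.comp_def]

theorem pr_conj (t : K) (f : Fin (d + 2) → K) :
    t * pr f * t⁻¹ = pr fun i => t * f i * t⁻¹ := by
  have := map_pr (MulAut.conj t).toMonoidHom f
  simpa using this

theorem pr_conj' {t : K} (ht : t * t = 1) (f : Fin (d + 2) → K) :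
    t * pr f * t = pr fun i => t * f i * t := by
  have : t⁻¹ = t := inv_eq_of_mul_eq_one_left ht
  have h := pr_conj t f
  rwa [this] at h

theorem pr_congr {M : Type*} [Monoid M] {f g : Fin (d + 2) → M} (h : ∀ i, f i = g i) :
    pr f = pr g := by
  rw [funext h]

theorem pr_mem {f : Fin (d + 2) → K} {H : Subgroup K} (h : ∀ i, f i ∈ H) : pr f ∈ H := by
  apply Subgroup.list_prod_mem
  intro x hx
  obtain ⟨i, -, rfl⟩ := List.mem_map.1 hx
  exact h i

theorem mem_cone_split {α : Wd d} {x : Cs d} (h : x ∈ cone α) :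
    ∃ i y, x = (α ++ [i]) ⌢ y := by
  obtain ⟨z, rfl⟩ := h
  obtain ⟨w, y, hw, rfl⟩ := wa_decomp 1 z
  obtain ⟨i, rfl⟩ := List.length_eq_one_iff.1 hw
  exact ⟨i, y, (wa_append _ _ _).symm⟩

theorem not_mem_cone_append {α u : Wd d} {x : Cs d} (h : x ∉ cone α) : x ∉ cone (α ++ u) := by
  rintro ⟨y, rfl⟩
  exact h ⟨u ⌢ y, (wa_append _ _ _).symm⟩

theorem dj_single {i j : Fin (d + 2)} (h : i ≠ j) (α : Wd d) : Dj (α ++ [i]) (α ++ [j]) :=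
  dj_of_len (by simp) (by simpa using h)

theorem swapH_split {α β : Wd d} (h : Dj α β) :
    swapH α β = pr fun i => swapH (α ++ [i]) (β ++ [i]) := by
  apply hm_ext; intro x
  have hdj : ∀ i j, Dj (α ++ [i]) (β ++ [j]) := fun i j => h.append _ _
  by_cases h1 : x ∈ cone α
  · obtain ⟨i, y, rfl⟩ := mem_cone_split h1
    rw [pr_single _ _ i, swapH_left (hdj i i) y, (swapH_left h).append [i] y]
    intro j hji
    rw [swapH_left (hdj i i) y]
    exact ⟨swapH_fix (dj_single hji.symm _) (hdj i j) y,
      swapH_fix (hdj j i).symm (dj_single hji.symm _) y⟩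
  · by_cases h2 : x ∈ cone β
    · obtain ⟨i, y, rfl⟩ := mem_cone_split h2
      rw [pr_single _ _ i, swapH_right (hdj i i) y, (swapH_right h).append [i] y]
      intro j hji
      rw [swapH_right (hdj i i) y]
      exact ⟨swapH_fix (hdj j i).symm (dj_single hji.symm _) y,
        swapH_fix (dj_single hji.symm _) (hdj i j) y⟩
    · rw [swapH_other h1 h2, pr_fix]
      exact fun i => swapH_other (not_mem_cone_append h1) (not_mem_cone_append h2)

theorem pr_atH_at (s : Fin (d + 2) → Hm d) (α : Wd d) (i : Fin (d + 2)) :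
    At (pr fun j => atH (s j) (α ++ [j])) (α ++ [i]) (α ++ [i]) (s i) := by
  intro x
  rw [pr_single _ _ i, atH_at]
  intro j hji
  rw [atH_at]
  exact ⟨atH_fix _ (dj_single hji.symm _) x, atH_fix _ (dj_single hji.symm _) _⟩

theorem atH_split {g : Hm d} {π : Equiv.Perm (Fin (d + 2))} {s : Fin (d + 2) → Hm d}
    (h : ∀ i, At g [i] [π i] (s i)) (α : Wd d) :
    atH g α = atH (pm π) α * pr fun i => atH (s i) (α ++ [i]) := by
  apply hm_ext; intro x
  by_cases h1 : x ∈ cone α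
  · obtain ⟨i, y, rfl⟩ := mem_cone_split h1
    rw [hm_mul_apply, pr_atH_at, wa_append, atH_at, h, wa_append, atH_at, pm_mv]
  · rw [hm_mul_apply, pr_fix, atH_out _ h1, atH_out _ h1]
    exact fun i => atH_out _ (not_mem_cone_append h1)

theorem permH_swap (i j : Fin (d + 2)) (hij : i ≠ j) (b : Wd d) :
    atH (pm (Equiv.swap i j)) b = swapH (b ++ [i]) (b ++ [j]) := by
  apply hm_ext; intro x
  have hd := dj_single hij b
  by_cases h1 : x ∈ cone b
  · obtain ⟨k, y, rfl⟩ := mem_cone_split h1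
    rw [wa_append, atH_at, pm_mv, ← wa_append, ← wa_append]
    by_cases hk : k = i
    · subst hk; rw [Equiv.swap_apply_left, swapH_left hd]
    · by_cases hk' : k = j
      · subst hk'; rw [Equiv.swap_apply_right, swapH_right hd]
      · rw [Equiv.swap_apply_of_ne_of_ne hk hk', swapH_fix (dj_single hk b) (dj_single hk' b)]
  · rw [atH_out _ h1, swapH_other (not_mem_cone_append h1) (not_mem_cone_append h1)]

theorem connect2 (P : Wd d → Wd d → Prop)
    (hb : ∀ α β : Wd d, α.length = 3 → β.length = 3 → Dj α β → P α β)
    (hs : ∀ α β α' β' γ γ' : Wd d, 3 ≤ α.length → 3 ≤ β.length → Dj α β →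
      3 ≤ α'.length → 3 ≤ β'.length → Dj α' β' → Sig0 γ γ' → Mv (swapH γ γ') α' α →
      Mv (swapH γ γ') β' β → α'.length ≤ α.length → β'.length ≤ β.length → P α' β' → P α β)
    {α β : Wd d} (h1 : 3 ≤ α.length) (h2 : 3 ≤ β.length) (hd : Dj α β) : P α β := by
  have := ext_connect (d := d) (ι := Fin 2) (by simp) (fun ω => P (ω 0) (ω 1))
    (fun ω hv hl => hb _ _ (hl 0) (hl 1) (hv.dj 0 1 (by simp)))
    (fun ω ω' γ γ' hv hv' sg m hl hp => hs _ _ _ _ γ γ' (hv.len 0) (hv.len 1)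
      (hv.dj 0 1 (by simp)) (hv'.len 0) (hv'.len 1) (hv'.dj 0 1 (by simp)) sg (m 0) (m 1)
      (hl 0) (hl 1) hp) ![α, β]
    ⟨fun i => by fin_cases i <;> simp [h1, h2], fun i j hij => by
      fin_cases i <;> fin_cases j <;> simp_all [hd.symm]⟩
  simpa using this

theorem connect1 (P : Wd d → Prop)
    (hb : ∀ α : Wd d, α.length = 3 → P α)
    (hs : ∀ α α' γ γ' : Wd d, 3 ≤ α.length →
      3 ≤ α'.length → Sig0 γ γ' → Mv (swapH γ γ') α' α →
      α'.length ≤ α.length → P α' → P α)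
    {α : Wd d} (h1 : 3 ≤ α.length) : P α :=
  ext_connect (d := d) (ι := Unit) (by simp) (fun ω => P (ω ()))
    (fun ω hv hl => hb _ (hl ()))
    (fun ω ω' γ γ' hv hv' sg m hl hp => hs _ _ γ γ' (hv.len ()) (hv'.len ()) sg (m ())
      (hl ()) hp) (fun _ => α) ⟨fun _ => h1, fun i j hij => absurd rfl hij⟩

def USub (τ : Wd d → Wd d → K) (α : Wd d) : Subgroup K :=
  Subgroup.closure {k | ∃ i j : Fin (d + 2), i ≠ j ∧ τ (α ++ [i]) (α ++ [j]) = k}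

def VT (τ : Wd d → Wd d → K) : Subgroup K :=
  Subgroup.closure {k | ∃ γ γ', Sig0 γ γ' ∧ τ γ γ' = k}

/-- the derived structure -/
structure Cor (N : Set (Hm d)) (φ : K →* Hm d) (τ : Wd d → Wd d → K) (x : Hm d → Wd d → K) :
    Prop where
  phi_t : ∀ {α β}, 3 ≤ α.length → 3 ≤ β.length → Dj α β → φ (τ α β) = swapH α β
  phi_x : ∀ {g α}, g ∈ N → 3 ≤ α.length → φ (x g α) = atH g α
  sym : ∀ {α β}, 3 ≤ α.length → 3 ≤ β.length → Dj α β → τ α β = τ β α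
  inv : ∀ {α β}, 3 ≤ α.length → 3 ≤ β.length → Dj α β → τ α β * τ α β = 1
  split : ∀ {α β}, 3 ≤ α.length → 3 ≤ β.length → Dj α β →
    τ α β = pr fun i => τ (α ++ [i]) (β ++ [i])
  conj0 : ∀ {γ γ' α β α' β'}, Sig0 γ γ' → 3 ≤ α.length → 3 ≤ β.length → Dj α β →
    3 ≤ α'.length → 3 ≤ β'.length → Mv (swapH γ γ') α α' → Mv (swapH γ γ') β β' →
    τ γ γ' * τ α β * τ γ γ' = τ α' β'
  conjx0 : ∀ {γ γ' α α' g}, Sig0 γ γ' → g ∈ N → 3 ≤ α.length →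
    3 ≤ α'.length → Mv (swapH γ γ') α α' → τ γ γ' * x g α * τ γ γ' = x g α'
  tmem : ∀ {α β}, 3 ≤ α.length → 3 ≤ β.length → Dj α β → τ α β ∈ VT τ
  gen : Subgroup.closure ({k | ∃ γ γ', Sig0 γ γ' ∧ τ γ γ' = k} ∪
    {k | ∃ g ∈ N, ∃ α, 3 ≤ α.length ∧ x g α = k}) = ⊤
  xmul : ∀ {g h α}, g ∈ N → h ∈ N → g * h ∈ N → 3 ≤ α.length → x g α * x h α = x (g * h) α
  xcomm : ∀ {g h α β}, g ∈ N → h ∈ N → 3 ≤ α.length → 3 ≤ β.length → Dj α β →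
    x g α * x h β = x h β * x g α
  xsplit : ∀ {g α} {π : Equiv.Perm (Fin (d + 2))} {s : Fin (d + 2) → Hm d}, g ∈ N →
    (∀ i, At g [i] [π i] (s i)) → (∀ i, s i ∈ N) → 3 ≤ α.length →
    ∃ u ∈ USub τ α, x g α = u * pr fun i => x (s i) (α ++ [i])

theorem dj_append_iff {α β u : Wd d} (h : Dj (α ++ u) (β ++ u)) (hl : α.length = β.length) :
    Dj α β := by
  refine dj_of_len hl fun e => h.ne (by rw [e])

theorem sys_cor {N : Set (Hm d)} {φ : K →* Hm d} {σ : Hm d → K} (hN : Nuc N)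
    (S : Sys N φ σ) : ∃ τ x, Cor N φ τ x := by
  have sT : ∀ {α β : Wd d}, 3 ≤ α.length → α.length ≤ 4 → 3 ≤ β.length → β.length ≤ 4 →
      Dj α β → swapH α β ∈ SE N := fun h1 h2 h3 h4 h5 =>
    Or.inl (Or.inl ⟨_, _, h1, h2, h3, h4, h5, rfl⟩)
  have sS : ∀ {γ γ' : Wd d}, Sig0 γ γ' → swapH γ γ' ∈ SE N := by
    rintro γ γ' ⟨h1, h2, h3⟩
    exact sT (by omega) (by omega) (by omega) (by omega) h3
  have sX : ∀ {g : Hm d} {α : Wd d}, g ∈ N → 3 ≤ α.length → α.length ≤ 4 → atH g α ∈ SE N :=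
    fun h1 h2 h3 => Or.inl (Or.inr ⟨_, h1, _, h2, h3, rfl⟩)
  have sU : ∀ {b : Wd d} (π), b.length = 3 → atH (pm π) b ∈ SE N :=
    fun π h => Or.inr ⟨_, π, h, rfl⟩
  have r31 : ∀ {a b c : Hm d}, a ∈ SE N → b ∈ SE N → c ∈ SE N → a * b * a = c →
      σ a * σ b * σ a = σ c := by
    intro a b c ha hb hc h
    have := S.rel [a, b, a] [c] (by simp [ha, hb]) (by simp [hc]) (by simp) (by simp)
      (by simpa [mul_assoc] using h)
    simpa [mul_assoc] using this
  have r21 : ∀ {a b c : Hm d}, a ∈ SE N → b ∈ SE N → c ∈ SE N → a * b = c →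
      σ a * σ b = σ c := by
    intro a b c ha hb hc h
    have := S.rel [a, b] [c] (by simp [ha, hb]) (by simp [hc]) (by simp) (by simp)
      (by simpa using h)
    simpa using this
  have one_mem : (1 : Hm d) ∈ SE N := by
    have := sX (α := [0, 0, 0]) hN.one (by simp) (by simp)
    rwa [atH_one] at this
  have s1 : σ 1 = 1 := by
    have := r21 one_mem one_mem one_mem (one_mul 1)
    simpa using this
  have cjH : ∀ {γ γ' : Wd d} {a : Hm d}, swapH γ γ' * a * (swapH γ γ')⁻¹ =
      swapH γ γ' * a * swapH γ γ' := by
    intro γ γ' a; rw [swapH_inv]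
  have hT : TRel (fun α β : Wd d => σ (swapH α β)) := by
    refine ⟨fun h => ?_, fun h1 h2 h3 e => r31 (sS h1) (sS h2) (sS h3) e⟩
    rw [← s1]; exact r21 (sS h) (sS h) one_mem (swapH_mul_self _ _)
  have hF2 : ExtHyp (ι := Fin 2) (fun α β : Wd d => σ (swapH α β))
      (fun ω => σ (swapH (ω 0) (ω 1))) := by
    constructor
    · intro a b ω ω' hv hv' hl hl' sg m
      symm
      refine r31 (sS sg) (sT ?_ ?_ ?_ ?_ (hv.dj 0 1 (by simp)))
        (sT ?_ ?_ ?_ ?_ (hv'.dj 0 1 (by simp)))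
        (swap_eq_of_mv (hv.dj 0 1 (by simp)) (m 0) (m 1)) <;> simp [hl, hl']
    · intro a b ω hv hl sg h1 h2
      symm
      refine r31 (sS sg) (sT ?_ ?_ ?_ ?_ (hv.dj 0 1 (by simp)))
        (sT ?_ ?_ ?_ ?_ (hv.dj 0 1 (by simp)))
        (swap_comm3 (hv.dj 0 1 (by simp)) (h1 0).symm (h2 0).symm (h1 1).symm (h2 1).symm) <;>
        simp [hl]
  have hF1 : ∀ g : Hm d, g ∈ N → ExtHyp (ι := Unit) (fun α β : Wd d => σ (swapH α β))
      (fun ω => σ (atH g (ω ()))) := by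
    intro g hg
    constructor
    · intro a b ω ω' hv hv' hl hl' sg m
      symm
      refine r31 (sS sg) (sX hg ?_ ?_) (sX hg ?_ ?_) ?_
      iterate 4 simp [hl, hl']
      rw [← at_conj_mv (m ()) g, swapH_inv]
    · intro a b ω hv hl sg h1 h2
      symm
      refine r31 (sS sg) (sX hg ?_ ?_) (sX hg ?_ ?_) ?_
      iterate 4 simp [hl]
      conv_rhs => rw [← at_conj_mv (swapH_fix (h1 ()).symm (h2 ()).symm) g, swapH_inv]
  obtain ⟨F, hFb, hFe⟩ := ext_main (by simp) hT hF2
  have : ∀ g : Hm d, ∃ F : (Unit → Wd d) → K, g ∈ N →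
      (∀ ω, Valid ω → (∀ i, (ω i).length = 3) → F ω = σ (atH g (ω ()))) ∧
      ∀ γ γ' ω ω', Sig0 γ γ' → Valid ω → Valid ω' → Mvs (swapH γ γ') ω ω' →
        F ω' = σ (swapH γ γ') * F ω * σ (swapH γ γ') := by
    intro g
    by_cases hg : g ∈ N
    · obtain ⟨F, h⟩ := ext_main (by simp) hT (hF1 g hg)
      exact ⟨F, fun _ => h⟩
    · exact ⟨1, fun h => absurd h hg⟩
  choose Fx hFx using this
  let τ : Wd d → Wd d → K := fun α β => F ![α, β]
  let x : Hm d → Wd d → K := fun g α => Fx g fun _ => α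
  have v2 : ∀ {α β : Wd d}, 3 ≤ α.length → 3 ≤ β.length → Dj α β → Valid ![α, β] := by
    intro α β h1 h2 hd
    exact ⟨fun i => by fin_cases i <;> simp [h1, h2], fun i j hij => by
      fin_cases i <;> fin_cases j <;> simp_all [hd.symm]⟩
  have v1 : ∀ {α : Wd d}, 3 ≤ α.length → Valid (fun _ : Unit => α) := fun h =>
    ⟨fun _ => h, fun i j hij => absurd rfl hij⟩
  have tb : ∀ {α β : Wd d}, α.length = 3 → β.length = 3 → Dj α β → τ α β = σ (swapH α β) := by
    intro α β h1 h2 hd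
    exact hFb _ (v2 h1.ge h2.ge hd) (fun i => by fin_cases i <;> simp [h1, h2])
  have xb : ∀ {g : Hm d} {α : Wd d}, g ∈ N → α.length = 3 → x g α = σ (atH g α) := by
    intro g α hg h1
    exact (hFx g hg).1 _ (v1 h1.ge) (fun _ => h1)
  have te : ∀ {γ γ' α β α' β'}, Sig0 γ γ' → 3 ≤ α.length → 3 ≤ β.length → Dj α β →
    3 ≤ α'.length → 3 ≤ β'.length → Mv (swapH γ γ') α α' → Mv (swapH γ γ') β β' →
      τ α' β' = σ (swapH γ γ') * τ α β * σ (swapH γ γ') := by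
    intro γ γ' α β α' β' sg h1 h2 hd h1' h2' m1 m2
    exact hFe γ γ' _ _ sg (v2 h1 h2 hd) (v2 h1' h2' (m1.dj m2 hd))
      (fun i => by fin_cases i <;> simp [m1, m2])
  have xe : ∀ {γ γ' α α' g}, Sig0 γ γ' → g ∈ N → 3 ≤ α.length →
    3 ≤ α'.length → Mv (swapH γ γ') α α' →
      x g α' = σ (swapH γ γ') * x g α * σ (swapH γ γ') := by
    intro γ γ' α α' g sg hg h1 h1' m1
    exact (hFx g hg).2 γ γ' _ _ sg (v1 h1) (v1 h1') (fun i => m1)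
  have t4 : ∀ {α β : Wd d}, 3 ≤ α.length → 3 ≤ β.length → Dj α β → α.length ≤ 4 →
      β.length ≤ 4 → τ α β = σ (swapH α β) := by
    intro α β h1 h2 hd
    refine connect2 (fun α β => α.length ≤ 4 → β.length ≤ 4 → τ α β = σ (swapH α β)) ?_ ?_ h1 h2 hd
    · intro α β h1 h2 hd _ _
      exact tb h1 h2 hd
    · intro α β α' β' γ γ' h1 h2 hd h1' h2' hd' sg m1 m2 l1 l2 ih h3 h4
      rw [te sg h1' h2' hd' h1 h2 m1 m2, ih (by omega) (by omega)]
      exact r31 (sS sg) (sT h1' (by omega) h2' (by omega) hd') (sT h1 h3 h2 h4 hd)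
        (swap_eq_of_mv hd' m1 m2)
  have x4 : ∀ {g : Hm d} {α : Wd d}, g ∈ N → 3 ≤ α.length → α.length ≤ 4 →
      x g α = σ (atH g α) := by
    intro g α hg h1
    refine connect1 (fun α => α.length ≤ 4 → x g α = σ (atH g α)) ?_ ?_ h1
    · intro α h1 _
      exact xb hg h1
    · intro α α' γ γ' h1 h1' sg m1 l1 ih h3
      rw [xe sg hg h1' h1 m1, ih (by omega)]
      refine r31 (sS sg) (sX hg h1' (by omega)) (sX hg h1 h3) ?_
      rw [← at_conj_mv m1 g, swapH_inv]
  have tS : ∀ {γ γ' : Wd d}, Sig0 γ γ' → τ γ γ' = σ (swapH γ γ') := by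
    rintro γ γ' ⟨h1, h2, h3⟩
    exact t4 (by omega) (by omega) h3 (by omega) (by omega)
  have ti : ∀ {γ γ' : Wd d}, Sig0 γ γ' → τ γ γ' * τ γ γ' = 1 := by
    intro γ γ' h; rw [tS h]; exact hT.inv h
  have tii : ∀ {γ γ' : Wd d}, Sig0 γ γ' → (τ γ γ')⁻¹ = τ γ γ' := fun h =>
    inv_eq_of_mul_eq_one_left (ti h)
  have conj0 : ∀ {γ γ' α β α' β'}, Sig0 γ γ' → 3 ≤ α.length → 3 ≤ β.length → Dj α β →
    3 ≤ α'.length → 3 ≤ β'.length → Mv (swapH γ γ') α α' → Mv (swapH γ γ') β β' →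
    τ γ γ' * τ α β * τ γ γ' = τ α' β' := by
    intro γ γ' α β α' β' sg h1 h2 hd h1' h2' m1 m2
    rw [tS sg, te sg h1 h2 hd h1' h2' m1 m2]
  have conjx0 : ∀ {γ γ' α α' g}, Sig0 γ γ' → g ∈ N → 3 ≤ α.length →
    3 ≤ α'.length → Mv (swapH γ γ') α α' → τ γ γ' * x g α * τ γ γ' = x g α' := by
    intro γ γ' α α' g sg hg h1 h1' m1
    rw [tS sg, xe sg hg h1 h1' m1]
  have phi_t : ∀ {α β}, 3 ≤ α.length → 3 ≤ β.length → Dj α β → φ (τ α β) = swapH α β := by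
    intro α β h1 h2 hd
    refine connect2 (fun α β => φ (τ α β) = swapH α β) ?_ ?_ h1 h2 hd
    · intro α β h1 h2 hd
      rw [tb h1 h2 hd, S.sec _ (sT (by omega) (by omega) (by omega) (by omega) hd)]
    · intro α β α' β' γ γ' h1 h2 hd h1' h2' hd' sg m1 m2 l1 l2 ih
      rw [te sg h1' h2' hd' h1 h2 m1 m2, map_mul, map_mul, S.sec _ (sS sg), ih]
      exact swap_eq_of_mv hd' m1 m2
  have phi_x : ∀ {g α}, g ∈ N → 3 ≤ α.length → φ (x g α) = atH g α := by
    intro g α hg h1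
    refine connect1 (fun α => φ (x g α) = atH g α) ?_ ?_ h1
    · intro α h1
      rw [xb hg h1, S.sec _ (sX hg (by omega) (by omega))]
    · intro α α' γ γ' h1 h1' sg m1 l1 ih
      rw [xe sg hg h1' h1 m1, map_mul, map_mul, S.sec _ (sS sg), ih, ← at_conj_mv m1 g, swapH_inv]
  have sym : ∀ {α β}, 3 ≤ α.length → 3 ≤ β.length → Dj α β → τ α β = τ β α := by
    intro α β h1 h2 hd
    refine connect2 (fun α β => τ α β = τ β α) ?_ ?_ h1 h2 hd
    · intro α β h1 h2 hd
      rw [tb h1 h2 hd, tb h2 h1 hd.symm, swapH_symm]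
    · intro α β α' β' γ γ' h1 h2 hd h1' h2' hd' sg m1 m2 l1 l2 ih
      rw [te sg h1' h2' hd' h1 h2 m1 m2, te sg h2' h1' hd'.symm h2 h1 m2 m1, ih]
  have cjmul : ∀ {γ γ' : Wd d} (a b : K), Sig0 γ γ' →
      (τ γ γ' * a * τ γ γ') * (τ γ γ' * b * τ γ γ') = τ γ γ' * (a * b) * τ γ γ' := by
    intro γ γ' a b sg
    have : (τ γ γ' * a * τ γ γ') * (τ γ γ' * b * τ γ γ') =
      τ γ γ' * a * (τ γ γ' * τ γ γ') * b * τ γ γ' := by group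
    rw [this, ti sg]; group
  have inv : ∀ {α β}, 3 ≤ α.length → 3 ≤ β.length → Dj α β → τ α β * τ α β = 1 := by
    intro α β h1 h2 hd
    refine connect2 (fun α β => τ α β * τ α β = 1) ?_ ?_ h1 h2 hd
    · intro α β h1 h2 hd
      exact ti ⟨Or.inl h1, h2, hd⟩
    · intro α β α' β' γ γ' h1 h2 hd h1' h2' hd' sg m1 m2 l1 l2 ih
      rw [← conj0 sg h1' h2' hd' h1 h2 m1 m2, cjmul _ _ sg, ih, mul_one, ti sg]
  have split : ∀ {α β}, 3 ≤ α.length → 3 ≤ β.length → Dj α β →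
      τ α β = pr fun i => τ (α ++ [i]) (β ++ [i]) := by
    intro α β h1 h2 hd
    refine connect2 (fun α β => τ α β = pr fun i => τ (α ++ [i]) (β ++ [i])) ?_ ?_ h1 h2 hd
    · intro α β h1 h2 hd
      have e : ∀ i, τ (α ++ [i]) (β ++ [i]) = σ (swapH (α ++ [i]) (β ++ [i])) := fun i =>
        t4 (by simp [h1]) (by simp [h2]) (hd.append _ _) (by simp [h1]) (by simp [h2])
      rw [tb h1 h2 hd, pr_congr e]
      have := S.rel [swapH α β]
        ((List.finRange (d + 2)).map fun i => swapH (α ++ [i]) (β ++ [i]))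
        (by simp [sT h1.ge (by omega) h2.ge (by omega) hd])
        (by
          intro s hs
          obtain ⟨i, -, rfl⟩ := List.mem_map.1 hs
          exact sT (by simp [h1]) (by simp [h1]) (by simp [h2]) (by simp [h2]) (hd.append _ _))
        (by simp) (by simp) (by simpa [pr] using swapH_split hd)
      simpa [pr, Function.comp_def] using this
    · intro α β α' β' γ γ' h1 h2 hd h1' h2' hd' sg m1 m2 l1 l2 ih
      rw [← conj0 sg h1' h2' hd' h1 h2 m1 m2, ih, pr_conj' (ti sg)]
      apply pr_congr
      intro i
      exact conj0 sg (by simp; omega) (by simp; omega) (hd'.append _ _) (by simp; omega)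
        (by simp; omega) (m1.append _) (m2.append _)
  have tmem : ∀ {α β}, 3 ≤ α.length → 3 ≤ β.length → Dj α β → τ α β ∈ VT τ := by
    intro α β h1 h2 hd
    refine connect2 (fun α β => τ α β ∈ VT τ) ?_ ?_ h1 h2 hd
    · intro α β h1 h2 hd
      exact Subgroup.subset_closure ⟨α, β, ⟨Or.inl h1, h2, hd⟩, rfl⟩
    · intro α β α' β' γ γ' h1 h2 hd h1' h2' hd' sg m1 m2 l1 l2 ih
      rw [← conj0 sg h1' h2' hd' h1 h2 m1 m2]
      have : τ γ γ' ∈ VT τ := Subgroup.subset_closure ⟨γ, γ', sg, rfl⟩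
      exact mul_mem (mul_mem this ih) this
  have umem : ∀ {b : Wd d} (π : Equiv.Perm (Fin (d + 2))), b.length = 3 →
      σ (atH (pm π) b) ∈ USub τ b := by
    intro b π hb
    induction π using Equiv.Perm.swap_induction_on with
    | one => rw [map_one, atH_one, s1]; exact Subgroup.one_mem _
    | swap_mul f i j hij ih =>
      rw [map_mul, atH_mul, ← r21 (sU _ hb) (sU _ hb) (by
        rw [← atH_mul, ← map_mul]; exact sU _ hb) rfl]
      refine mul_mem ?_ ih
      rw [permH_swap i j hij, ← t4 (by simp [hb]) (by simp [hb]) (dj_single hij b)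
        (by simp [hb]) (by simp [hb])]
      exact Subgroup.subset_closure ⟨i, j, hij, rfl⟩
  refine ⟨τ, x, ⟨phi_t, phi_x, sym, inv, split, conj0, conjx0, tmem, ?_, ?_, ?_, ?_⟩⟩
  · rw [eq_top_iff, ← S.gen, Subgroup.closure_le]
    set C := Subgroup.closure ({k | ∃ γ γ', Sig0 γ γ' ∧ τ γ γ' = k} ∪
      {k | ∃ g ∈ N, ∃ α, 3 ≤ α.length ∧ x g α = k}) with hC
    have hV : VT τ ≤ C := Subgroup.closure_mono Set.subset_union_left
    rintro _ ⟨h, ((⟨α, β, h1, h2, h3, h4, hd, rfl⟩ | ⟨g, hg, α, h1, h2, rfl⟩) | ⟨b, π, hb, rfl⟩), rfl⟩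
    · rw [← t4 h1 h3 hd h2 h4]
      exact hV (tmem h1 h3 hd)
    · rw [← x4 hg h1 h2]
      exact Subgroup.subset_closure (Or.inr ⟨g, hg, α, h1, rfl⟩)
    · refine hV ((?_ : USub τ b ≤ VT τ) (umem π hb))
      rw [USub, Subgroup.closure_le]
      rintro _ ⟨i, j, hij, rfl⟩
      exact tmem (by simp [hb]) (by simp [hb]) (dj_single hij b)
  · intro g h α hg hh hgh h1
    refine connect1 (fun α => x g α * x h α = x (g * h) α) ?_ ?_ h1
    · intro α h1
      rw [xb hg h1, xb hh h1, xb hgh h1]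
      exact r21 (sX hg (by omega) (by omega)) (sX hh (by omega) (by omega))
        (sX hgh (by omega) (by omega)) (atH_mul _ _ _).symm
    · intro α α' γ γ' h1 h1' sg m1 l1 ih
      rw [← conjx0 sg hg h1' h1 m1, ← conjx0 sg hh h1' h1 m1, ← conjx0 sg hgh h1' h1 m1,
        cjmul _ _ sg, ih]
  · intro g h α β hg hh h1 h2 hd
    refine connect2 (fun α β => x g α * x h β = x h β * x g α) ?_ ?_ h1 h2 hd
    · intro α β h1 h2 hd
      rw [xb hg h1, xb hh h2]
      have := S.rel [atH g α, atH h β] [atH h β, atH g α]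
        (by simp [sX hg h1.ge (by omega), sX hh h2.ge (by omega)])
        (by simp [sX hg h1.ge (by omega), sX hh h2.ge (by omega)])
        (by simp) (by simp) (by simpa using atH_comm hd g h)
      simpa using this
    · intro α β α' β' γ γ' h1 h2 hd h1' h2' hd' sg m1 m2 l1 l2 ih
      rw [← conjx0 sg hg h1' h1 m1, ← conjx0 sg hh h2' h2 m2, cjmul _ _ sg, cjmul _ _ sg, ih]
  · intro g α π s hg hs hsN h1
    refine connect1 (fun α => ∃ u ∈ USub τ α, x g α = u * pr fun i => x (s i) (α ++ [i])) ?_ ?_ h1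
    · intro α h1
      refine ⟨_, umem π h1, ?_⟩
      have e : ∀ i, x (s i) (α ++ [i]) = σ (atH (s i) (α ++ [i])) := fun i =>
        x4 (hsN i) (by simp [h1]) (by simp [h1])
      rw [xb hg h1, pr_congr e]
      have := S.rel [atH g α]
        (atH (pm π) α :: (List.finRange (d + 2)).map fun i => atH (s i) (α ++ [i]))
        (by simp [sX hg h1.ge (by omega)])
        (by
          intro t ht
          rcases List.mem_cons.1 ht with rfl | ht
          · exact sU _ h1
          · obtain ⟨i, -, rfl⟩ := List.mem_map.1 ht
            exact sX (hsN i) (by simp [h1]) (by simp [h1]))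
        (by simp) (by simp) (by simpa [pr] using atH_split hs α)
      simpa [pr, Function.comp_def] using this
    · intro α α' γ γ' h1 h1' sg m1 l1 ⟨u, hu, e⟩
      refine ⟨τ γ γ' * u * τ γ γ', ?_, ?_⟩
      · have : USub τ α' ≤ (USub τ α).comap (MulAut.conj (τ γ γ')).toMonoidHom := by
          rw [USub, Subgroup.closure_le]
          rintro _ ⟨i, j, hij, rfl⟩
          simp only [Subgroup.coe_comap, Set.mem_preimage,
            MulAut.conj_apply, SetLike.mem_coe, MulEquiv.toMonoidHom_eq_coe, MonoidHom.coe_coe]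
          rw [tii sg, conj0 sg (by simp; omega) (by simp; omega) (dj_single hij _) (by simp; omega)
            (by simp; omega) (m1.append _) (m1.append _)]
          exact Subgroup.subset_closure ⟨i, j, hij, rfl⟩
        have h := this hu
        simpa [tii sg] using h
      · rw [← conjx0 sg hg h1' h1 m1, e, ← cjmul _ _ sg, pr_conj' (ti sg)]
        congr 1
        apply pr_congr
        intro i
        exact conjx0 sg (hsN i) (by simp; omega) (by simp; omega) (m1.append _)

end SysSec

/-! ## The Thompson part: structure of `VT` -/
section VTSec
variable {d : ℕ} {K : Type*} [Group K] {N : Set (Hm d)} {φ : K →* Hm d}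
  {τ : Wd d → Wd d → K} {x : Hm d → Wd d → K}

theorem Cor.sinv (C : Cor N φ τ x) {γ γ' : Wd d} (h : Sig0 γ γ') : (τ γ γ')⁻¹ = τ γ γ' := by
  obtain ⟨h1, h2, h3⟩ := h
  exact inv_eq_of_mul_eq_one_left (C.inv (by omega) (by omega) h3)

theorem Cor.tinv (C : Cor N φ τ x) {γ γ' : Wd d} (h1 : 3 ≤ γ.length) (h2 : 3 ≤ γ'.length)
    (h3 : Dj γ γ') : (τ γ γ')⁻¹ = τ γ γ' :=
  inv_eq_of_mul_eq_one_left (C.inv h1 h2 h3)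

theorem Cor.phi_s (C : Cor N φ τ x) {γ γ' : Wd d} (h : Sig0 γ γ') : φ (τ γ γ') = swapH γ γ' := by
  obtain ⟨h1, h2, h3⟩ := h
  exact C.phi_t (by omega) (by omega) h3

theorem Cor.vt_induct (C : Cor N φ τ x) {P : K → Prop} (h1 : P 1)
    (hm : ∀ γ γ' y, Sig0 γ γ' → y ∈ VT τ → P y → P (τ γ γ' * y)) {y : K} (hy : y ∈ VT τ) : P y := by
  induction hy using Subgroup.closure_induction_left with
  | one => exact h1
  | mul_left a ha y hy ih =>
    obtain ⟨γ, γ', sg, rfl⟩ := ha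
    exact hm _ _ _ sg hy ih
  | inv_mul_cancel a ha y hy ih =>
    obtain ⟨γ, γ', sg, rfl⟩ := ha
    rw [C.sinv sg]
    exact hm _ _ _ sg hy ih

/-- deep conjugation property -/
def DeepC (N : Set (Hm d)) (φ : K →* Hm d) (τ : Wd d → Wd d → K) (x : Hm d → Wd d → K)
    (y : K) (n : ℕ) : Prop :=
  (∀ α : Wd d, n ≤ α.length → ∃ α' : Wd d, 3 ≤ α'.length ∧ α.length ≤ α'.length + n ∧
    Mv (φ y) α α') ∧
  (∀ α β α' β' : Wd d, n ≤ α.length → n ≤ β.length → Dj α β → Mv (φ y) α α' → Mv (φ y) β β' →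
    y * τ α β * y⁻¹ = τ α' β') ∧
  (∀ g ∈ N, ∀ α α' : Wd d, n ≤ α.length → Mv (φ y) α α' → y * x g α * y⁻¹ = x g α')

theorem mv_sig4 {γ γ' w : Wd d} (sg : Sig0 γ γ') (hw : 4 ≤ w.length) :
    ∃ w', Mv (swapH γ γ') w w' ∧ w.length ≤ w'.length + 1 ∧ w'.length ≤ w.length + 1 := by
  obtain ⟨h1, h2, hd⟩ := sg
  rcases prefix_or_dj (γ := γ) (w := w) (by omega) with ⟨u, rfl⟩ | h3
  · exact ⟨_, (swapH_left hd).append u, by simp; omega, by simp; omega⟩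
  · rcases prefix_or_dj (γ := γ') (w := w) (by omega) with ⟨u, rfl⟩ | h4
    · exact ⟨_, (swapH_right hd).append u, by simp; omega, by simp; omega⟩
    · exact ⟨_, swapH_fix h3.symm h4.symm, by omega, by omega⟩

theorem Cor.deep (C : Cor N φ τ x) {y : K} (hy : y ∈ VT τ) :
    ∃ n, 3 ≤ n ∧ DeepC N φ τ x y n := by
  refine C.vt_induct (P := fun y => ∃ n, 3 ≤ n ∧ DeepC N φ τ x y n) ?_ ?_ hy
  · refine ⟨3, le_rfl, fun α h => ⟨α, h, by omega, by rw [map_one]; exact mv_one α⟩, ?_, ?_⟩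
    · intro α β α' β' _ _ _ m1 m2
      rw [map_one] at m1 m2
      rw [m1.unique (mv_one _), m2.unique (mv_one _)]; simp
    · intro g _ α α' _ m1
      rw [map_one] at m1
      rw [m1.unique (mv_one _)]; simp
  · rintro γ γ' y sg hy ⟨n, hn, d1, d2, d3⟩
    have key : ∀ α : Wd d, n + 4 ≤ α.length → ∃ α1 α2 : Wd d, 4 ≤ α1.length ∧ 3 ≤ α2.length ∧
        α.length ≤ α2.length + (n + 1) ∧
        Mv (φ y) α α1 ∧ Mv (swapH γ γ') α1 α2 ∧ Mv (φ (τ γ γ' * y)) α α2 := by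
      intro α hα
      obtain ⟨α1, h1, h2, h3⟩ := d1 α (by omega)
      obtain ⟨α2, h4, h5, h6⟩ := mv_sig4 sg (w := α1) (by omega)
      refine ⟨α1, α2, by omega, by omega, by omega, h3, h4, ?_⟩
      rw [map_mul, C.phi_s sg]; exact h4.mul h3
    refine ⟨n + 4, by omega, ?_, ?_, ?_⟩
    · intro α hα
      obtain ⟨α1, α2, h1, h2, h3, h4, h5, h6⟩ := key α hα
      exact ⟨α2, h2, by omega, h6⟩
    · intro α β α' β' hα hβ hd m1 m2
      obtain ⟨α1, α2, h1, h2, h3, h4, h5, h6⟩ := key α hα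
      obtain ⟨β1, β2, k1, k2, k3, k4, k5, k6⟩ := key β hβ
      have e1 := d2 α β α1 β1 (by omega) (by omega) hd h4 k4
      have e2 := C.conj0 sg (by omega) (by omega) (h4.dj k4 hd) h2 k2 h5 k5
      rw [m1.unique h6, m2.unique k6, ← e2, ← e1, mul_inv_rev, C.sinv sg]; group
    · intro g hg α α' hα m1
      obtain ⟨α1, α2, h1, h2, h3, h4, h5, h6⟩ := key α hα
      have e1 := d3 g hg α α1 (by omega) h4
      have e2 := C.conjx0 sg hg (by omega) h2 h5
      rw [m1.unique h6, ← e2, ← e1, mul_inv_rev, C.sinv sg]; group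

/-- general conjugation of transpositions by elements of `VT` -/
theorem Cor.f3 (C : Cor N φ τ x) {y : K} (hy : y ∈ VT τ) {α β α' β' : Wd d}
    (h1 : 3 ≤ α.length) (h2 : 3 ≤ β.length) (hd : Dj α β) (h1' : 3 ≤ α'.length)
    (h2' : 3 ≤ β'.length) (m1 : Mv (φ y) α α') (m2 : Mv (φ y) β β') :
    y * τ α β * y⁻¹ = τ α' β' := by
  obtain ⟨n, hn, d1, d2, d3⟩ := C.deep hy
  have key : ∀ m, ∀ α β α' β' : Wd d, n ≤ α.length + m → n ≤ β.length + m → 3 ≤ α.length →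
      3 ≤ β.length → Dj α β → 3 ≤ α'.length → 3 ≤ β'.length → Mv (φ y) α α' → Mv (φ y) β β' →
      y * τ α β * y⁻¹ = τ α' β' := by
    intro m
    induction m with
    | zero =>
      intro α β α' β' hα hβ _ _ hd _ _ m1 m2
      exact d2 α β α' β' hα hβ hd m1 m2
    | succ m ih =>
      intro α β α' β' hα hβ h1 h2 hd h1' h2' m1 m2
      rw [C.split h1 h2 hd, C.split h1' h2' (m1.dj m2 hd), pr_conj]
      apply pr_congr
      intro i
      exact ih _ _ _ _ (by simp; omega) (by simp; omega) (by simp; omega) (by simp; omega)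
        (hd.append _ _) (by simp; omega) (by simp; omega) (m1.append _) (m2.append _)
  exact key n α β α' β' (by omega) (by omega) h1 h2 hd h1' h2' m1 m2

/-! ### Symmetric groups on antichains -/

structure Anti (A : Set (Wd d)) : Prop where
  len : ∀ a ∈ A, 3 ≤ a.length
  dj : ∀ a ∈ A, ∀ b ∈ A, a ≠ b → Dj a b

theorem Anti.mono {A B : Set (Wd d)} (h : Anti B) (hs : A ⊆ B) : Anti A :=
  ⟨fun a ha => h.len a (hs ha), fun a ha b hb => h.dj a (hs ha) b (hs hb)⟩

def SA (τ : Wd d → Wd d → K) (A : Set (Wd d)) : Subgroup K :=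
  Subgroup.closure {k | ∃ a ∈ A, ∃ b ∈ A, a ≠ b ∧ τ a b = k}

theorem SA_mono {A B : Set (Wd d)} (h : A ⊆ B) : SA τ A ≤ SA τ B := by
  apply Subgroup.closure_mono
  rintro _ ⟨a, ha, b, hb, hab, rfl⟩
  exact ⟨a, h ha, b, h hb, hab, rfl⟩

theorem SA_mem {A : Set (Wd d)} {a b : Wd d} (ha : a ∈ A) (hb : b ∈ A) (h : a ≠ b) :
    τ a b ∈ SA τ A := Subgroup.subset_closure ⟨a, ha, b, hb, h, rfl⟩

theorem Cor.SA_le (C : Cor N φ τ x) {A : Set (Wd d)} (hA : Anti A) : SA τ A ≤ VT τ := by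
  rw [SA, Subgroup.closure_le]
  rintro _ ⟨a, ha, b, hb, hab, rfl⟩
  exact C.tmem (hA.len a ha) (hA.len b hb) (hA.dj a ha b hb hab)

theorem Cor.SA_induct (C : Cor N φ τ x) {A : Set (Wd d)} (hA : Anti A) {P : K → Prop} (h1 : P 1)
    (hm : ∀ a ∈ A, ∀ b ∈ A, a ≠ b → ∀ y ∈ SA τ A, P y → P (τ a b * y)) {y : K}
    (hy : y ∈ SA τ A) : P y := by
  induction hy using Subgroup.closure_induction_left with
  | one => exact h1
  | mul_left a ha y hy ih =>
    obtain ⟨a, ha, b, hb, hab, rfl⟩ := ha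
    exact hm _ ha _ hb hab _ hy ih
  | inv_mul_cancel a ha y hy ih =>
    obtain ⟨a, ha, b, hb, hab, rfl⟩ := ha
    rw [C.tinv (hA.len a ha) (hA.len b hb) (hA.dj a ha b hb hab)]
    exact hm _ ha _ hb hab _ hy ih

theorem Cor.SA_mv (C : Cor N φ τ x) {A : Set (Wd d)} (hA : Anti A) {y : K} (hy : y ∈ SA τ A) :
    ∀ a ∈ A, ∃ b ∈ A, Mv (φ y) a b := by
  refine C.SA_induct (P := fun y => ∀ a ∈ A, ∃ b ∈ A, Mv (φ y) a b) hA ?_ ?_ hy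
  · intro a ha; exact ⟨a, ha, by rw [map_one]; exact mv_one a⟩
  · intro b hb c hc hbc y hy ih a ha
    obtain ⟨a', ha', m⟩ := ih a ha
    have hd := hA.dj b hb c hc hbc
    have e := C.phi_t (hA.len b hb) (hA.len c hc) hd
    simp only [map_mul, e]
    by_cases h1 : a' = b
    · subst h1; exact ⟨c, hc, (swapH_left hd).mul m⟩
    · by_cases h2 : a' = c
      · subst h2; exact ⟨b, hb, (swapH_right hd).mul m⟩
      · exact ⟨a', ha', (swapH_fix (hA.dj _ ha' _ hb h1) (hA.dj _ ha' _ hc h2)).mul m⟩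

theorem Cor.SA_fixes (C : Cor N φ τ x) {A : Set (Wd d)} (hA : Anti A) {w : Wd d}
    (hw : ∀ a ∈ A, Dj w a) {y : K} (hy : y ∈ SA τ A) : Mv (φ y) w w := by
  refine C.SA_induct (P := fun y => Mv (φ y) w w) hA ?_ ?_ hy
  · rw [map_one]; exact mv_one w
  · intro b hb c hc hbc y hy ih
    rw [map_mul, C.phi_t (hA.len b hb) (hA.len c hc) (hA.dj b hb c hc hbc)]
    exact (swapH_fix (hw b hb) (hw c hc)).mul ih

theorem Cor.SA_decomp (C : Cor N φ τ x) {A : Set (Wd d)} (hA : Anti A) {a : Wd d} (ha : a ∈ A)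
    {y : K} (hy : y ∈ SA τ A) :
    y ∈ SA τ (A \ {a}) ∨ ∃ b ∈ A, b ≠ a ∧ ∃ z ∈ SA τ (A \ {a}), y = τ a b * z := by
  refine C.SA_induct (P := fun y => y ∈ SA τ (A \ {a}) ∨ ∃ b ∈ A, b ≠ a ∧
    ∃ z ∈ SA τ (A \ {a}), y = τ a b * z) hA (Or.inl (one_mem _)) ?_ hy
  have gen : ∀ c ∈ A, c ≠ a → ∀ y, (y ∈ SA τ (A \ {a}) ∨ ∃ b ∈ A, b ≠ a ∧
      ∃ z ∈ SA τ (A \ {a}), y = τ a b * z) → (τ a c * y ∈ SA τ (A \ {a}) ∨ ∃ b ∈ A, b ≠ a ∧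
      ∃ z ∈ SA τ (A \ {a}), τ a c * y = τ a b * z) := by
    rintro c hc hca y (h | ⟨b, hb, hba, z, hz, rfl⟩)
    · exact Or.inr ⟨c, hc, hca, y, h, rfl⟩
    · by_cases hbc : b = c
      · subst hbc
        left
        rw [← mul_assoc, C.inv (hA.len _ ha) (hA.len _ hb) (hA.dj _ ha _ hb hba.symm), one_mul]
        exact hz
      · right
        refine ⟨b, hb, hba, τ b c * z, mul_mem (SA_mem ⟨hb, hba⟩ ⟨hc, hca⟩ hbc) hz, ?_⟩
        have hab := hA.dj _ ha _ hb hba.symm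
        have hac := hA.dj _ ha _ hc hca.symm
        have hbc' := hA.dj _ hb _ hc hbc
        have e := C.f3 (C.tmem (hA.len _ ha) (hA.len _ hb) hab) (hA.len _ ha) (hA.len _ hc) hac
          (hA.len _ hb) (hA.len _ hc)
          (by rw [C.phi_t (hA.len _ ha) (hA.len _ hb) hab]; exact swapH_left hab)
          (by rw [C.phi_t (hA.len _ ha) (hA.len _ hb) hab]; exact swapH_fix hac.symm hbc'.symm)
        rw [← e, C.tinv (hA.len _ ha) (hA.len _ hb) hab]
        have i := C.inv (hA.len _ ha) (hA.len _ hb) hab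
        rw [← mul_assoc, ← mul_assoc, ← mul_assoc, ← mul_assoc, i, one_mul]
  intro b hb c hc hbc y hy ih
  by_cases h1 : b = a
  · subst h1
    exact gen c hc hbc.symm y ih
  · by_cases h2 : c = a
    · subst h2
      rw [C.sym (hA.len _ hb) (hA.len _ hc) (hA.dj _ hb _ hc hbc)]
      exact gen b hb h1 y ih
    · have hm : τ b c ∈ SA τ (A \ {a}) := SA_mem ⟨hb, h1⟩ ⟨hc, h2⟩ hbc
      rcases ih with ih | ⟨b', hb', hba', z, hz, rfl⟩
      · exact Or.inl (mul_mem hm ih)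
      · right
        have hA' : Anti (A \ {a}) := hA.mono Set.diff_subset
        obtain ⟨b'', ⟨hb'', hne⟩, m⟩ := C.SA_mv hA' hm b' ⟨hb', hba'⟩
        refine ⟨b'', hb'', hne, τ b c * z, mul_mem hm hz, ?_⟩
        have hbcd := hA.dj _ hb _ hc hbc
        have e := C.f3 (C.SA_le hA' hm) (hA.len _ ha) (hA.len _ hb') (hA.dj _ ha _ hb' hba'.symm)
          (hA.len _ ha) (hA.len _ hb'') (by
            rw [C.phi_t (hA.len _ hb) (hA.len _ hc) hbcd]
            exact swapH_fix (hA.dj _ ha _ hb (Ne.symm h1)) (hA.dj _ ha _ hc (Ne.symm h2))) m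
        rw [← e]; group

theorem Cor.SA_fix (C : Cor N φ τ x) {A : Set (Wd d)} (hA : Anti A) {a : Wd d} (ha : a ∈ A)
    {y : K} (hy : y ∈ SA τ A) (m : Mv (φ y) a a) : y ∈ SA τ (A \ {a}) := by
  rcases C.SA_decomp hA ha hy with h | ⟨b, hb, hba, z, hz, rfl⟩
  · exact h
  · exfalso
    have hd := hA.dj _ ha _ hb hba.symm
    have hA' : Anti (A \ {a}) := hA.mono Set.diff_subset
    have f := C.SA_fixes hA' (w := a) (fun c hc => hA.dj _ ha _ hc.1 (Ne.symm hc.2)) hz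
    rw [map_mul, C.phi_t (hA.len _ ha) (hA.len _ hb) hd] at m
    exact hba (((swapH_left hd).mul f).unique m)

theorem Cor.SA_inj (C : Cor N φ τ x) {A : Set (Wd d)} (hA : Anti A) (hf : A.Finite)
    {y : K} (hy : y ∈ SA τ A) (m : ∀ a ∈ A, Mv (φ y) a a) : y = 1 := by
  classical
  lift A to Finset (Wd d) using hf
  induction A using Finset.induction_on with
  | empty =>
    have : SA τ (↑(∅ : Finset (Wd d))) = (⊥ : Subgroup K) := by
      rw [SA]
      convert Subgroup.closure_empty
      ext k; simp
    rw [this] at hy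
    exact Subgroup.mem_bot.1 hy
  | insert a A haA ih =>
    have h1 := C.SA_fix hA (a := a) (by simp) hy (m a (by simp))
    have : (↑(insert a A) : Set (Wd d)) \ {a} = ↑A := by
      ext w
      simp only [Finset.coe_insert, Set.mem_diff, Set.mem_insert_iff, Finset.mem_coe,
        Set.mem_singleton_iff]
      constructor
      · rintro ⟨h | h, h'⟩
        · exact absurd h h'
        · exact h
      · intro h; exact ⟨Or.inr h, fun e => haA (e ▸ h)⟩
    rw [this] at h1
    exact ih (hA.mono (by simp)) h1 (fun b hb => m b (by simp [Finset.mem_coe.1 hb]))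

end VTSec

/-! ## Complete antichains -/
section CASec
variable {d : ℕ}

structure CA (A : Set (Wd d)) : Prop where
  anti : Anti A
  fin : A.Finite
  cover : ∀ y : Cs d, ∃ a ∈ A, y ∈ cone a

def xp (A : Set (Wd d)) (p : Wd d) : Set (Wd d) := {w | (w ∈ A ∧ w ≠ p) ∨ ∃ i, w = p ++ [i]}
def rd (A : Set (Wd d)) (p : Wd d) : Set (Wd d) := {w | (w ∈ A ∧ ∀ i, w ≠ p ++ [i]) ∨ w = p}
def A3 : Set (Wd d) := {w | w.length = 3}

theorem Anti.not_pfx {A : Set (Wd d)} (h : Anti A) {a b : Wd d} (ha : a ∈ A) (hb : b ∈ A)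
    (hp : a <+: b) : a = b := by
  by_contra hne
  exact (h.dj a ha b hb hne).1 hp

theorem ca_A3 : CA (A3 : Set (Wd d)) := by
  refine ⟨⟨fun a ha => ?_, fun a ha b hb hab => ?_⟩, List.finite_length_eq _ 3, fun y => ?_⟩
  · exact le_of_eq (Eq.symm ha)
  · exact dj_of_len ((show a.length = 3 from ha).trans (show b.length = 3 from hb).symm) hab
  · obtain ⟨α, z, h, rfl⟩ := wa_decomp 3 y
    exact ⟨α, h, ⟨z, rfl⟩⟩

theorem xp_self_not_mem {A : Set (Wd d)} (h : Anti A) {p : Wd d} (hp : p ∈ A) (i : Fin (d+2)) :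
    p ++ [i] ∉ A := fun hi => by
  have := h.not_pfx hp hi (List.prefix_append _ _)
  simpa using congrArg List.length this

theorem dj_one {p : Wd d} {i j : Fin (d + 2)} (h : i ≠ j) : Dj (p ++ [i]) (p ++ [j]) :=
  dj_of_len (by simp) (by simpa using h)

theorem CA.xp {A : Set (Wd d)} (h : CA A) {p : Wd d} (hp : p ∈ A) : CA (xp A p) := by
  have hl := h.anti.len p hp
  refine ⟨⟨?_, ?_⟩, ?_, ?_⟩
  · rintro a (⟨ha, _⟩ | ⟨i, rfl⟩)
    · exact h.anti.len a ha
    · simp; omega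
  · rintro a (⟨ha, hap⟩ | ⟨i, rfl⟩) b (⟨hb, hbp⟩ | ⟨j, rfl⟩) hab
    · exact h.anti.dj a ha b hb hab
    · exact (h.anti.dj a ha p hp hap).right _
    · exact (h.anti.dj p hp b hb (Ne.symm hbp)).left _
    · exact dj_one (by rintro rfl; exact hab rfl)
  · have : _root_.xp A p ⊆ A ∪ Set.range (fun i => p ++ [i]) := by
      rintro a (⟨ha, hap⟩ | ⟨i, rfl⟩)
      · exact Or.inl ha
      · exact Or.inr ⟨i, rfl⟩
    exact (h.fin.union (Set.finite_range _)).subset this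
  · intro y
    obtain ⟨a, ha, z, rfl⟩ := h.cover y
    by_cases hap : a = p
    · subst hap
      obtain ⟨β, z', hβ, rfl⟩ := wa_decomp 1 z
      obtain ⟨i, rfl⟩ := List.length_eq_one_iff.1 hβ
      exact ⟨a ++ [i], Or.inr ⟨i, rfl⟩, ⟨z', wa_append _ _ _⟩⟩
    · exact ⟨a, Or.inl ⟨ha, hap⟩, ⟨z, rfl⟩⟩

theorem CA.p_not_mem {A : Set (Wd d)} (h : CA A) {p : Wd d} (hp : ∀ i, p ++ [i] ∈ A) : p ∉ A := by
  intro hpA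
  exact xp_self_not_mem h.anti hpA 0 (hp 0)

theorem CA.dj_p {A : Set (Wd d)} (h : CA A) {p : Wd d} (hp : ∀ i, p ++ [i] ∈ A) {a : Wd d}
    (ha : a ∈ A) (hne : ∀ i, a ≠ p ++ [i]) : Dj p a := by
  constructor
  · rintro ⟨u, rfl⟩
    cases u with
    | nil => exact h.p_not_mem hp (by simpa using ha)
    | cons i u => exact hne i (h.anti.not_pfx (hp i) ha ⟨u, by simp⟩).symm
  · intro hap
    exact hne 0 (h.anti.not_pfx ha (hp 0) (hap.trans (List.prefix_append _ _)))

theorem CA.rd {A : Set (Wd d)} (h : CA A) {p : Wd d} (hl : 3 ≤ p.length)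
    (hp : ∀ i, p ++ [i] ∈ A) : CA (rd A p) := by
  refine ⟨⟨?_, ?_⟩, ?_, ?_⟩
  · rintro a (⟨ha, _⟩ | rfl)
    · exact h.anti.len a ha
    · exact hl
  · rintro a (⟨ha, hap⟩ | rfl) b (⟨hb, hbp⟩ | rfl) hab
    · exact h.anti.dj a ha b hb hab
    · exact (h.dj_p hp ha hap).symm
    · exact h.dj_p hp hb hbp
    · exact absurd rfl hab
  · have : _root_.rd A p ⊆ insert p A := by
      rintro a (⟨ha, hap⟩ | rfl)
      · exact Or.inr ha
      · exact Or.inl rfl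
    exact (h.fin.insert p).subset this
  · intro y
    obtain ⟨a, ha, z, rfl⟩ := h.cover y
    by_cases hap : ∃ i, a = p ++ [i]
    · obtain ⟨i, rfl⟩ := hap
      exact ⟨p, Or.inr rfl, ⟨[i] ⌢ z, (wa_append _ _ _).symm⟩⟩
    · push Not at hap
      exact ⟨a, Or.inl ⟨ha, hap⟩, ⟨z, rfl⟩⟩

theorem mem_rd_self (A : Set (Wd d)) (p : Wd d) : p ∈ rd A p := Or.inr rfl

theorem xp_rd {A : Set (Wd d)} (h : CA A) {p : Wd d} (hp : ∀ i, p ++ [i] ∈ A) :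
    xp (rd A p) p = A := by
  ext w
  constructor
  · rintro (⟨⟨hw, _⟩ | rfl, hne⟩ | ⟨i, rfl⟩)
    · exact hw
    · exact absurd rfl hne
    · exact hp i
  · intro hw
    by_cases hi : ∃ i, w = p ++ [i]
    · exact Or.inr hi
    · push Not at hi
      refine Or.inl ⟨Or.inl ⟨hw, hi⟩, ?_⟩
      rintro rfl; exact h.p_not_mem hp hw

theorem rd_xp {A : Set (Wd d)} (h : CA A) {p : Wd d} (hp : p ∈ A) : rd (xp A p) p = A := by
  ext w
  constructor
  · rintro (⟨⟨hw, _⟩ | ⟨i, rfl⟩, hne⟩ | rfl)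
    · exact hw
    · exact absurd rfl (hne i)
    · exact hp
  · intro hw
    by_cases hi : w = p
    · exact Or.inr hi
    · refine Or.inl ⟨Or.inl ⟨hw, hi⟩, ?_⟩
      rintro i rfl; exact xp_self_not_mem h.anti hp i hw

theorem rd_xp_comm {A : Set (Wd d)} {p q : Wd d} (hpq : p ≠ q)
    (h1 : ∀ i, p ≠ q ++ [i]) :
    rd (xp A p) q = xp (rd A q) p := by
  ext w
  have e1 : ∀ i j, p ++ [i] ≠ q ++ [j] := by
    intro i j e
    exact hpq (List.append_inj' e rfl).1
  constructor
  · rintro (⟨⟨hw, hne⟩ | ⟨i, rfl⟩, hne'⟩ | rfl)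
    · exact Or.inl ⟨Or.inl ⟨hw, hne'⟩, hne⟩
    · exact Or.inr ⟨i, rfl⟩
    · exact Or.inl ⟨Or.inr rfl, hpq.symm⟩
  · rintro (⟨⟨hw, hne⟩ | rfl, hne'⟩ | ⟨i, rfl⟩)
    · exact Or.inl ⟨Or.inl ⟨hw, hne'⟩, hne⟩
    · exact Or.inr rfl
    · exact Or.inl ⟨Or.inr ⟨i, rfl⟩, e1 i⟩

theorem xp_ncard {A : Set (Wd d)} (h : CA A) {p : Wd d} (hp : p ∈ A) :
    (xp A p).ncard = A.ncard + (d + 1) := by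
  have e : xp A p = (A \ {p}) ∪ Set.range (fun i : Fin (d + 2) => p ++ [i]) := by
    ext w
    simp only [xp, Set.mem_ofPred_eq, Set.mem_union, Set.mem_sdiff, Set.mem_singleton_iff,
      Set.mem_range, @eq_comm _ w (p ++ _), ne_eq]
  rw [e, Set.ncard_union_eq ?_ (h.fin.subset Set.sdiff_subset) (Set.finite_range _)]
  · have h1 : (Set.range (fun i : Fin (d + 2) => p ++ [i])).ncard = d + 2 := by
      rw [← Set.image_univ, Set.ncard_image_of_injective _ (fun i j hij => by simpa using hij)]
      simp [Set.ncard_univ]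
    have h2 := Set.ncard_sdiff_singleton_add_one hp h.fin
    omega
  · rw [Set.disjoint_left]
    rintro w ⟨hw, _⟩ ⟨i, rfl⟩
    exact xp_self_not_mem h.anti hp i hw

def Refines (A B : Set (Wd d)) : Prop := ∀ a ∈ A, ∃ b ∈ B, b <+: a

theorem CA.eq_of_subset {A B : Set (Wd d)} (hA : CA A) (hB : CA B) (h : A ⊆ B) : A = B := by
  apply Set.Subset.antisymm h
  intro b hb
  obtain ⟨a, ha, z, hz⟩ := hA.cover (b ⌢ (fun _ => 0))
  have := wa_comparable hz
  by_cases hab : a = b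
  · exact hab ▸ ha
  · exact absurd (hB.anti.dj a (h ha) b hb hab) this

theorem CA.caret {A B : Set (Wd d)} (hA : CA A) (hB : CA B) (hr : Refines A B) (hne : A ≠ B) :
    ∃ p : Wd d, 3 ≤ p.length ∧ (∃ b ∈ B, b <+: p) ∧ ∀ j, p ++ [j] ∈ A := by
  have hne' : (A \ B).Nonempty := by
    by_contra h
    rw [Set.not_nonempty_iff_eq_empty, Set.sdiff_eq_empty] at h
    exact hne (hA.eq_of_subset hB h)
  obtain ⟨w, ⟨hwA, hwB⟩, hmax⟩ := Set.exists_max_image (A \ B) List.length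
    (hA.fin.subset Set.sdiff_subset) hne'
  obtain ⟨b, hb, hbw⟩ := hr w hwA
  have hbne : b ≠ w := by rintro rfl; exact hwB hb
  have hbl := hB.anti.len b hb
  obtain ⟨u, rfl⟩ := hbw
  rcases List.eq_nil_or_concat u with rfl | ⟨u, i, rfl⟩
  · simp at hbne
  · refine ⟨b ++ u, by simp; omega, ⟨b, hb, List.prefix_append _ _⟩, fun j => ?_⟩
    obtain ⟨a, ha, z, hz⟩ := hA.cover ((b ++ u ++ [j]) ⌢ (fun _ => 0))
    have hc := wa_comparable hz
    rcases le_or_gt a.length (b ++ u).length with hl | hl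
    · exfalso
      have h1 : a <+: b ++ u ++ [j] := wa_pfx (by simp at hl ⊢; omega) hz
      have h2 : a <+: b ++ u := List.prefix_of_prefix_length_le h1 (List.prefix_append _ _) hl
      have h3 := hA.anti.not_pfx ha hwA (h2.trans ⟨[i], by simp⟩)
      rw [h3] at hl; simp at hl
    · have h1 : b ++ u ++ [j] <+: a := wa_pfx (by simp at hl ⊢; omega) hz.symm
      have haB : a ∉ B := by
        intro h
        have := hB.anti.not_pfx hb h (((List.prefix_append b u).trans
          (List.prefix_append _ [j])).trans h1)
        rw [this] at hl; simp at hl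
      have h2 := hmax a ⟨ha, haB⟩
      have h3 := h1.eq_of_length (by simp at hl h2 ⊢; omega)
      rw [h3]; exact ha

theorem CA.refines_rd {A B : Set (Wd d)} (hr : Refines A B) {p : Wd d} (h : ∃ b ∈ B, b <+: p) :
    Refines (_root_.rd A p) B := by
  rintro a (⟨ha, _⟩ | rfl)
  · exact hr a ha
  · exact h

theorem CA.refines_A3 {A : Set (Wd d)} (hA : CA A) : Refines A A3 := fun a ha =>
  ⟨a.take 3, by simpa [A3] using hA.anti.len a ha, take_pfx _ _⟩

/-- induction along refinements -/
theorem CA.refine_induct {B : Set (Wd d)} (hB : CA B) {P : Set (Wd d) → Prop} (h0 : P B)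
    (hs : ∀ A p, CA A → Refines A B → p ∈ A → P A → P (_root_.xp A p)) {A : Set (Wd d)} (hA : CA A)
    (hr : Refines A B) : P A := by
  induction hn : A.ncard using Nat.strong_induction_on generalizing A with
  | _ n ih =>
    by_cases hne : A = B
    · rw [hne]; exact h0
    · obtain ⟨p, hl, hp, hj⟩ := hA.caret hB hr hne
      have h1 := hA.rd hl hj
      have h2 := xp_ncard h1 (mem_rd_self A p)
      rw [xp_rd hA hj] at h2
      rw [← xp_rd hA hj]
      exact hs _ _ h1 (CA.refines_rd hr hp) (mem_rd_self A p)
        (ih _ (by omega) h1 (CA.refines_rd hr hp) rfl)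

def ee (n : ℕ) : Wd d := List.replicate (3 + n) 0
theorem ee_succ (n : ℕ) : (ee (n + 1) : Wd d) = ee n ++ [0] := by
  simp [ee, ← add_assoc, List.replicate_succ']

def LL : ℕ → Set (Wd d)
  | 0 => A3
  | n + 1 => xp (LL n) (ee n)

theorem LL_spec (n : ℕ) : CA (LL n : Set (Wd d)) ∧ ee n ∈ (LL n : Set (Wd d)) := by
  induction n with
  | zero => exact ⟨ca_A3, by simp [LL, A3, ee]⟩
  | succ n ih => exact ⟨ih.1.xp ih.2, Or.inr ⟨0, ee_succ n⟩⟩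

theorem LL_ca (n : ℕ) : CA (LL n : Set (Wd d)) := (LL_spec n).1
theorem ee_mem (n : ℕ) : ee n ∈ (LL n : Set (Wd d)) := (LL_spec n).2

end CASec

/-! ## Tree diagrams: injectivity on `VT` -/
section GoodSec
variable {d : ℕ} {K : Type*} [Group K] {N : Set (Hm d)} {φ : K →* Hm d}
  {τ : Wd d → Wd d → K} {x : Hm d → Wd d → K}

inductive Good (φ : K →* Hm d) (τ : Wd d → Wd d → K) : ℕ → Set (Wd d) → K → Prop
  | base : Good φ τ 0 A3 1
  | perm {n A y σ} : σ ∈ SA τ (LL n) → Good φ τ n A y → Good φ τ n A (σ * y)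
  | exp {n A y p} : p ∈ A → Mv (φ y) p (ee n) → Good φ τ n A y → Good φ τ (n + 1) (xp A p) y

theorem Cor.SA_mv' (C : Cor N φ τ x) {A : Set (Wd d)} (hA : Anti A) {y : K} (hy : y ∈ SA τ A) :
    ∀ a ∈ A, ∃ b ∈ A, Mv (φ y) b a := by
  intro a ha
  obtain ⟨b, hb, m⟩ := C.SA_mv hA (inv_mem hy) a ha
  rw [map_inv] at m
  exact ⟨b, hb, by simpa using m.inv⟩

theorem Cor.good1 (C : Cor N φ τ x) {n : ℕ} {A : Set (Wd d)} {y : K} (h : Good φ τ n A y) :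
    CA A ∧ y ∈ VT τ ∧ (∀ a ∈ A, ∃ b ∈ LL n, Mv (φ y) a b) ∧ (∀ b ∈ LL n, ∃ a ∈ A, Mv (φ y) a b)
    ∧ A.ncard = (A3 : Set (Wd d)).ncard + n * (d + 1) := by
  induction h with
  | base =>
    exact ⟨ca_A3, one_mem _, fun a ha => ⟨a, ha, by rw [map_one]; exact mv_one a⟩,
      fun a ha => ⟨a, ha, by rw [map_one]; exact mv_one a⟩, by simp⟩
  | @perm n A y σ hσ _ ih =>
    obtain ⟨i1, i2, i3, i4, i5⟩ := ih
    refine ⟨i1, mul_mem (C.SA_le (LL_ca n).anti hσ) i2, ?_, ?_, i5⟩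
    · intro a ha
      obtain ⟨b, hb, m⟩ := i3 a ha
      obtain ⟨c, hc, m'⟩ := C.SA_mv (LL_ca n).anti hσ b hb
      exact ⟨c, hc, by rw [map_mul]; exact m'.mul m⟩
    · intro c hc
      obtain ⟨b, hb, m⟩ := C.SA_mv' (LL_ca n).anti hσ c hc
      obtain ⟨a, ha, m'⟩ := i4 b hb
      exact ⟨a, ha, by rw [map_mul]; exact m.mul m'⟩
  | @exp n A y p hp m _ ih =>
    obtain ⟨i1, i2, i3, i4, i5⟩ := ih
    refine ⟨i1.xp hp, i2, ?_, ?_, ?_⟩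
    · rintro a (⟨ha, hne⟩ | ⟨i, rfl⟩)
      · obtain ⟨b, hb, m'⟩ := i3 a ha
        refine ⟨b, Or.inl ⟨hb, ?_⟩, m'⟩
        rintro rfl
        exact hne (m'.inv.unique m.inv)
      · exact ⟨_, Or.inr ⟨i, rfl⟩, m.append _⟩
    · rintro b (⟨hb, hne⟩ | ⟨i, rfl⟩)
      · obtain ⟨a, ha, m'⟩ := i4 b hb
        refine ⟨a, Or.inl ⟨ha, ?_⟩, m'⟩
        rintro rfl
        exact hne (m'.unique m)
      · exact ⟨_, Or.inr ⟨i, rfl⟩, m.append _⟩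
    · rw [xp_ncard i1 hp, i5]; ring

theorem Cor.good_n (C : Cor N φ τ x) {n m : ℕ} {A B : Set (Wd d)} {y z : K} (h : Good φ τ n A y)
    (h' : Good φ τ m B z) (e : A.ncard = B.ncard) : n = m := by
  have h1 := (C.good1 h).2.2.2.2
  have h2 := (C.good1 h').2.2.2.2
  rw [h1, h2] at e
  exact Nat.eq_of_mul_eq_mul_right (Nat.succ_pos d) (Nat.add_left_cancel e)

theorem Good.inv0 {A : Set (Wd d)} {y : K} (h : Good φ τ 0 A y) : A = A3 ∧ y ∈ SA τ (LL 0) := by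
  generalize hn : 0 = n at h
  induction h with
  | base => exact ⟨rfl, one_mem _⟩
  | perm hσ _ ih =>
    subst hn
    exact ⟨(ih rfl).1, mul_mem hσ (ih rfl).2⟩
  | exp => omega

theorem Good.invS {n : ℕ} {A : Set (Wd d)} {y : K} (h : Good φ τ (n + 1) A y) :
    ∃ σ ∈ SA τ (LL (n + 1)), ∃ y0 A0 p, y = σ * y0 ∧ A = xp A0 p ∧ p ∈ A0 ∧ Good φ τ n A0 y0 ∧
      Mv (φ y0) p (ee n) := by
  generalize hn : n + 1 = m at h
  induction h with
  | base => omega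
  | perm hσ _ ih =>
    subst hn
    obtain ⟨σ', hσ', y0, A0, p, rfl, h2⟩ := ih rfl
    exact ⟨_, mul_mem hσ hσ', y0, A0, p, by rw [mul_assoc], h2⟩
  | @exp n' A y p hp m h0 ih =>
    obtain rfl : n = n' := by omega
    exact ⟨1, one_mem _, y, A, p, (one_mul y).symm, rfl, hp, h0, m⟩

theorem Cor.adjust (C : Cor N φ τ x) {n : ℕ} {A : Set (Wd d)} {y : K} (h : Good φ τ n A y)
    {p : Wd d} (hp : p ∈ A) : ∃ σ ∈ SA τ (LL n), Good φ τ n A (σ * y) ∧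
      Mv (φ (σ * y)) p (ee n) := by
  obtain ⟨b, hb, m⟩ := (C.good1 h).2.2.1 p hp
  have hL := (LL_ca (d := d) n).anti
  by_cases hbe : b = ee n
  · subst hbe
    exact ⟨1, one_mem _, by rwa [one_mul], by rwa [one_mul]⟩
  · have hs : τ b (ee n) ∈ SA τ (LL n) := SA_mem hb (ee_mem n) hbe
    refine ⟨_, hs, Good.perm hs h, ?_⟩
    have hd := hL.dj _ hb _ (ee_mem n) hbe
    rw [map_mul, C.phi_t (hL.len _ hb) (hL.len _ (ee_mem n)) hd]
    exact (swapH_left hd).mul m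

theorem Cor.good_exists (C : Cor N φ τ x) {A : Set (Wd d)} (hA : CA A) :
    ∃ n y, Good φ τ n A y := by
  refine CA.refine_induct ca_A3 (P := fun A => ∃ n y, Good φ τ n A y) ⟨0, 1, Good.base⟩ ?_ hA
    hA.refines_A3
  rintro A p hA _ hp ⟨n, y, h⟩
  obtain ⟨σ, _, h1, h2⟩ := C.adjust h hp
  exact ⟨_, _, Good.exp hp h2 h1⟩

/-- elements of `S_n` fixing `e_n` lie in `S_{n+1}` -/
theorem Cor.SA_up (C : Cor N φ τ x) {n : ℕ} {σ : K} (h : σ ∈ SA τ (LL n : Set (Wd d)))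
    (m : Mv (φ σ) (ee n) (ee n)) : σ ∈ SA τ (LL (n + 1)) := by
  refine SA_mono ?_ (C.SA_fix (LL_ca n).anti (ee_mem n) h m)
  rintro w ⟨hw, hne⟩
  exact Or.inl ⟨hw, hne⟩

theorem SA_trans {A : Set (Wd d)} {a b c : K} (h1 : a * b⁻¹ ∈ SA τ A) (h2 : b * c⁻¹ ∈ SA τ A) :
    a * c⁻¹ ∈ SA τ A := by
  have := mul_mem h1 h2
  simpa [mul_assoc] using this

theorem SA_sym {A : Set (Wd d)} {a b : K} (h1 : a * b⁻¹ ∈ SA τ A) : b * a⁻¹ ∈ SA τ A := by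
  have := inv_mem h1
  simpa using this

theorem Cor.exch (C : Cor N φ τ x) {m : ℕ} {a : Wd d} (ha : a ∈ LL m) (hne : a ≠ ee m) :
    τ a (ee (m + 1)) * τ a (ee m) * (τ a (ee (m + 1)))⁻¹ ∈ SA τ (LL (m + 2)) := by
  have hL := (LL_ca (d := d) m).anti
  have hL1 := (LL_ca (d := d) (m + 1)).anti
  have hL2 := (LL_ca (d := d) (m + 2)).anti
  have ha1 : a ∈ LL (m + 1) := Or.inl ⟨ha, hne⟩
  have he1 := ee_mem (d := d) (m + 1)
  have hd := hL.dj _ ha _ (ee_mem m) hne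
  have hd1 : Dj a (ee (m + 1)) := by rw [ee_succ]; exact hd.right _
  have hle := hL.len _ (ee_mem m)
  have hla := hL.len _ ha
  have hle1 := hL1.len _ he1
  have ha2 : a ∈ LL (m + 2) := Or.inl ⟨ha1, hd1.ne⟩
  have hc : ∀ i, ee (m + 1) ++ [i] ∈ (LL (m + 2) : Set (Wd d)) := fun i => Or.inr ⟨i, rfl⟩
  have hφ := C.phi_t hla hle1 hd1
  have hm := C.tmem hla hle1 hd1
  rw [C.split hla hle hd, pr_conj]
  apply pr_mem
  intro i
  by_cases hi : i = 0
  · subst hi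
    rw [C.f3 hm (α := a ++ [0]) (β := ee m ++ [0]) (α' := ee (m + 1) ++ [0]) (β' := a)
      (by simp; omega) (by simp; omega) (hd.append _ _) (by simp; omega) hla
      (by rw [hφ]; exact (swapH_left hd1).append _)
      (by rw [hφ, ← ee_succ]; exact swapH_right hd1)]
    exact SA_mem (hc 0) ha2 ((hd1.symm.left _).ne)
  · have hdi : Dj (ee m ++ [i]) (ee (m + 1)) := by rw [ee_succ]; exact dj_one hi
    rw [C.f3 hm (α := a ++ [i]) (β := ee m ++ [i]) (α' := ee (m + 1) ++ [i]) (β' := ee m ++ [i])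
      (by simp; omega) (by simp; omega) (hd.append _ _) (by simp; omega) (by simp; omega)
      (by rw [hφ]; exact (swapH_left hd1).append _)
      (by rw [hφ]; exact swapH_fix (hd.symm.left _) hdi)]
    exact SA_mem (hc i) (Or.inl ⟨Or.inr ⟨i, rfl⟩, hdi.ne⟩) ((hdi.symm.left _).ne)

theorem Cor.good2 (C : Cor N φ τ x) {n : ℕ} : ∀ {A : Set (Wd d)} {y y' : K}, Good φ τ n A y →
    Good φ τ n A y' → y' * y⁻¹ ∈ SA τ (LL n) := by
  induction n with
  | zero =>
    intro A y y' h h'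
    exact mul_mem h'.inv0.2 (inv_mem h.inv0.2)
  | succ n ih =>
    have step : ∀ {A : Set (Wd d)} {p : Wd d} {y y' : K}, Good φ τ n A y → Good φ τ n A y' →
        Mv (φ y) p (ee n) → Mv (φ y') p (ee n) → y' * y⁻¹ ∈ SA τ (LL (n + 1)) := by
      intro A p y y' h h' m m'
      apply C.SA_up (ih h h')
      rw [map_mul, map_inv]
      exact m'.mul m.inv
    intro A y y' h h'
    obtain ⟨σ, hσ, y0, A0, p, rfl, rfl, hp, h0, m0⟩ := h.invS
    obtain ⟨σ', hσ', y0', A0', p', rfl, hA, hp', h0', m0'⟩ := h'.invS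
    suffices hh : y0' * y0⁻¹ ∈ SA τ (LL (n + 1)) by
      have := mul_mem (mul_mem hσ' hh) (inv_mem hσ)
      simpa [mul_assoc] using this
    have hc0 := (C.good1 h0).1
    have hc0' := (C.good1 h0').1
    have hA1 : rd (xp A0 p) p' = A0' := by rw [hA, rd_xp hc0' hp']
    by_cases hpp : p = p'
    · subst hpp
      rw [rd_xp hc0 hp] at hA1
      subst hA1
      exact step h0 h0' m0 m0'
    · have hin : ∀ i, p' ++ [i] ∈ A0 ∧ p' ++ [i] ≠ p := by
        intro i
        have : p' ++ [i] ∈ xp A0 p := by rw [hA]; exact Or.inr ⟨i, rfl⟩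
        rcases this with h | ⟨j, e⟩
        · exact h
        · exact absurd (List.append_inj' e rfl).1.symm hpp
      have hl' := hc0'.anti.len _ hp'
      have hne : ∀ i, p ≠ p' ++ [i] := fun i => (hin i).2.symm
      rw [rd_xp_comm hpp hne] at hA1
      have hcc := hc0.rd hl' (fun i => (hin i).1)
      have hx0 : xp (rd A0 p') p' = A0 := xp_rd hc0 (fun i => (hin i).1)
      obtain ⟨m, y1, g1⟩ := C.good_exists hcc
      have hp1 : p ∈ rd A0 p' := Or.inl ⟨hp, hne⟩
      obtain ⟨σ1, _, g2, mm⟩ := C.adjust g1 hp1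
      generalize σ1 * y1 = z at g2 mm
      obtain ⟨a, ha, ma⟩ := (C.good1 g2).2.2.1 p' (mem_rd_self _ _)
      have hae : a ≠ ee m := by
        rintro rfl
        exact hpp (mm.inv.unique ma.inv)
      have hL := (LL_ca (d := d) m).anti
      have hd := hL.dj _ ha _ (ee_mem m) hae
      have hd1 : Dj a (ee (m + 1)) := by rw [ee_succ]; exact hd.right _
      have hle := hL.len _ (ee_mem m)
      have hla := hL.len _ ha
      have hle1 := (LL_ca (d := d) (m + 1)).anti.len _ (ee_mem (m + 1))
      have ha1 : a ∈ LL (m + 1) := Or.inl ⟨ha, hae⟩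
      have q1 : Good φ τ (m + 1) (xp (rd A0 p') p) z := Good.exp hp1 mm g2
      have hs1 : τ a (ee (m + 1)) ∈ SA τ (LL (m + 1)) := SA_mem ha1 (ee_mem _) hd1.ne
      have q2 := Good.perm hs1 q1
      have s1 : τ a (ee m) ∈ SA τ (LL m) := SA_mem ha (ee_mem _) hae
      have q3 := Good.perm s1 g2
      have hφ := C.phi_t hla hle hd
      have hφ1 := C.phi_t hla hle1 hd1
      have m3 : Mv (φ (τ a (ee m) * z)) p' (ee m) := by
        rw [map_mul, hφ]; exact (swapH_left hd).mul ma
      have m3' : Mv (φ (τ a (ee m) * z)) p a := by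
        rw [map_mul, hφ]; exact (swapH_right hd).mul mm
      have q4 := Good.exp (mem_rd_self _ _) m3 q3
      have q5 := Good.perm hs1 q4
      rw [hA1] at q2
      rw [hx0] at q5
      obtain rfl : m + 1 = n := C.good_n q5 h0 rfl
      have r1 := step h0' q2 m0' (by rw [map_mul, hφ1]; exact (swapH_left hd1).mul ma)
      have r2 := step h0 q5 m0 (by
        rw [map_mul (φ) (τ a (ee (m + 1))), hφ1]; exact (swapH_left hd1).mul m3')
      have r3 := C.exch ha hae
      refine SA_trans (SA_sym r1) (SA_trans (SA_sym ?_) r2)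
      convert r3 using 1
      group

/-- Good elements absorb generators on the right -/
theorem Cor.good_mul (C : Cor N φ τ x) {B : Set (Wd d)} (hB : CA B) {γ γ' : Wd d} (hγ : γ ∈ B)
    (hγ' : γ' ∈ B) (hne : γ ≠ γ') {A : Set (Wd d)} (hA : CA A) (hr : Refines A B) :
    ∀ n a, Good φ τ n A a → ∃ J, Good φ τ n J (a * τ γ γ') := by
  refine CA.refine_induct hB (P := fun A => ∀ n a, Good φ τ n A a →
    ∃ J, Good φ τ n J (a * τ γ γ')) ?_ ?_ hA hr
  · intro n a h
    obtain ⟨g1, g2, g3, -⟩ := C.good1 h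
    obtain ⟨b, hb, m⟩ := g3 γ hγ
    obtain ⟨b', hb', m'⟩ := g3 γ' hγ'
    have hL := (LL_ca (d := d) n).anti
    have hd := hB.anti.dj _ hγ _ hγ' hne
    have e := C.f3 g2 (hB.anti.len _ hγ) (hB.anti.len _ hγ') hd (hL.len _ hb) (hL.len _ hb') m m'
    refine ⟨B, ?_⟩
    have : a * τ γ γ' = τ b b' * a := by rw [← e]; group
    rw [this]
    exact Good.perm (SA_mem hb hb' (m.dj m' hd).ne) h
  · intro A p hA hr hp ih n a h
    obtain ⟨n0, y, h0⟩ := C.good_exists hA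
    obtain ⟨σ, hσ, h1, m1⟩ := C.adjust h0 hp
    generalize σ * y = z at h1 m1
    obtain ⟨J, hJ⟩ := ih _ _ h1
    have h2 := Good.exp hp m1 h1
    obtain rfl : n = n0 + 1 := C.good_n h h2 rfl
    have h3 := C.good2 h2 h
    obtain ⟨q, hq, mq⟩ := (C.good1 hJ).2.2.2.1 _ (ee_mem n0)
    have h4 := Good.perm h3 (Good.exp hq mq hJ)
    exact ⟨_, by simpa [mul_assoc] using h4⟩

/-- tree pair representation -/
def TRep (φ : K →* Hm d) (τ : Wd d → Wd d → K) (n : ℕ) (A : Set (Wd d)) (y : K) : Prop :=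
  ∃ B a b, Good φ τ n A a ∧ Good φ τ n B b ∧ y = b⁻¹ * a

theorem Cor.rep_exp (C : Cor N φ τ x) {n A p} {y : K} (h : TRep φ τ n A y) (hp : p ∈ A) :
    TRep φ τ (n + 1) (xp A p) y := by
  obtain ⟨B, a, b, ha, hb, rfl⟩ := h
  obtain ⟨σ, hσ, h1, m1⟩ := C.adjust ha hp
  obtain ⟨q, hq, m2⟩ := (C.good1 (Good.perm hσ hb)).2.2.2.1 _ (ee_mem n)
  exact ⟨_, _, _, Good.exp hp m1 h1, Good.exp hq m2 (Good.perm hσ hb), by group⟩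

theorem Cor.rep_refine (C : Cor N φ τ x) {n A B} {y : K} (h : TRep φ τ n A y) (hA : CA A)
    (hB : CA B) (hr : Refines B A) : ∃ m, TRep φ τ m B y :=
  CA.refine_induct hA (P := fun B => ∃ m, TRep φ τ m B y) ⟨n, h⟩
    (fun _ _ _ _ hp ⟨m, hm⟩ => ⟨m + 1, C.rep_exp hm hp⟩) hB hr

/-- common refinement -/
def jn (A B : Set (Wd d)) : Set (Wd d) :=
  {w | (w ∈ A ∨ w ∈ B) ∧ (∃ a ∈ A, a <+: w) ∧ (∃ b ∈ B, b <+: w)}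

theorem CA.jn {A B : Set (Wd d)} (hA : CA A) (hB : CA B) : CA (jn A B) := by
  refine ⟨⟨?_, ?_⟩, ?_, ?_⟩
  · rintro a ⟨h | h, _⟩
    · exact hA.anti.len a h
    · exact hB.anti.len a h
  · have key : ∀ a b : Wd d, a ∈ _root_.jn A B → b ∈ _root_.jn A B → a <+: b → a = b := by
      rintro a b ⟨_, ⟨a1, ha1, pa1⟩, ⟨a2, ha2, pa2⟩⟩ ⟨hb | hb, ⟨b1, hb1, pb1⟩, ⟨b2, hb2, pb2⟩⟩ hp
      · have := hA.anti.not_pfx ha1 hb (pa1.trans hp)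
        subst this
        exact List.prefix_iff_eq_append.1 hp ▸ (hp.eq_of_length_le pa1.length_le)
      · have := hB.anti.not_pfx ha2 hb (pa2.trans hp)
        subst this
        exact hp.eq_of_length_le pa2.length_le
    intro a ha b hb hne
    exact ⟨fun h => hne (key a b ha hb h), fun h => hne (key b a hb ha h).symm⟩
  · exact (hA.fin.union hB.fin).subset (fun w hw => hw.1)
  · intro y
    obtain ⟨a, ha, z, hz⟩ := hA.cover y
    obtain ⟨b, hb, z', hz'⟩ := hB.cover y
    rcases le_total a.length b.length with hl | hl
    · exact ⟨b, ⟨Or.inr hb, ⟨a, ha, wa_pfx hl (hz.trans hz'.symm)⟩, ⟨b, hb, List.prefix_rfl⟩⟩,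
        ⟨z', hz'⟩⟩
    · exact ⟨a, ⟨Or.inl ha, ⟨a, ha, List.prefix_rfl⟩, ⟨b, hb, wa_pfx hl (hz'.trans hz.symm)⟩⟩,
        ⟨z, hz⟩⟩

theorem sig_ca {γ γ' : Wd d} (sg : Sig0 γ γ') : ∃ B : Set (Wd d), CA B ∧ γ ∈ B ∧ γ' ∈ B := by
  obtain ⟨h1 | h1, h2, h3⟩ := sg
  · exact ⟨A3, ca_A3, h1, h2⟩
  · rcases List.eq_nil_or_concat γ with rfl | ⟨p, i, rfl⟩
    · simp at h1
    · have hp : p.length = 3 := by simpa using h1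
      refine ⟨xp A3 p, ca_A3.xp hp, Or.inr ⟨i, by simp⟩, Or.inl ⟨h2, ?_⟩⟩
      rintro rfl
      exact h3.2 (by simp)

theorem Cor.vt_induct_right (C : Cor N φ τ x) {P : K → Prop} (h1 : P 1)
    (hm : ∀ γ γ' y, Sig0 γ γ' → y ∈ VT τ → P y → P (y * τ γ γ')) {y : K} (hy : y ∈ VT τ) : P y := by
  induction hy using Subgroup.closure_induction_right with
  | one => exact h1
  | mul_right a _ y hy ih =>
    obtain ⟨γ, γ', sg, rfl⟩ := hy
    exact hm _ _ _ sg ‹_› ih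
  | mul_inv_cancel a _ y hy ih =>
    obtain ⟨γ, γ', sg, rfl⟩ := hy
    rw [C.sinv sg]
    exact hm _ _ _ sg ‹_› ih

theorem Cor.rep_all (C : Cor N φ τ x) {y : K} (hy : y ∈ VT τ) : ∃ n A, TRep φ τ n A y := by
  refine C.vt_induct_right (P := fun y => ∃ n A, TRep φ τ n A y)
    ⟨0, A3, A3, 1, 1, Good.base, Good.base, by simp⟩ ?_ hy
  rintro γ γ' y sg _ ⟨n, A, h⟩
  obtain ⟨B, hB, hγ, hγ'⟩ := sig_ca sg
  have hA : CA A := by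
    obtain ⟨_, _, _, ha, _⟩ := h
    exact (C.good1 ha).1
  have hj := hA.jn hB
  obtain ⟨m, D, a, b, ha, hb, rfl⟩ := C.rep_refine h hA hj (fun w hw => hw.2.1)
  obtain ⟨J, hJ⟩ := C.good_mul hB hγ hγ' sg.2.2.ne hj (fun w hw => hw.2.2) m a ha
  exact ⟨m, J, D, _, b, hJ, hb, by group⟩

/-- `φ` is injective on `VT`. -/
theorem Cor.vt_inj (C : Cor N φ τ x) {y : K} (hy : y ∈ VT τ) (h1 : φ y = 1) : y = 1 := by
  obtain ⟨n, A, B, a, b, ha, hb, rfl⟩ := C.rep_all hy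
  have e : φ a = φ b := by
    rw [map_mul, map_inv] at h1
    exact (inv_mul_eq_one.1 h1).symm
  obtain ⟨cA, _, a3, -, -⟩ := C.good1 ha
  obtain ⟨cB, _, _, b4, -⟩ := C.good1 hb
  have hAB : A = B := by
    apply cA.eq_of_subset cB
    intro w hw
    obtain ⟨l, hl, m⟩ := a3 w hw
    obtain ⟨w', hw', m'⟩ := b4 l hl
    rw [e] at m
    rw [m.inv.unique m'.inv]; exact hw'
  subst hAB
  have h2 := C.good2 hb ha
  have h3 := C.SA_inj (LL_ca n).anti (LL_ca n).fin h2 (fun l _ => by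
    rw [map_mul, map_inv, e, mul_inv_cancel]; exact mv_one l)
  rw [mul_inv_eq_one.1 h3]; group

end GoodSec

/-! ## Injectivity of `φ` -/
section InjSec
variable {d : ℕ} {K : Type*} [Group K] {N : Set (Hm d)} {φ : K →* Hm d}
  {τ : Wd d → Wd d → K} {x : Hm d → Wd d → K}

theorem Cor.USub_le (C : Cor N φ τ x) {α : Wd d} (h : 3 ≤ α.length) : USub τ α ≤ VT τ := by
  rw [USub, Subgroup.closure_le]
  rintro _ ⟨i, j, hij, rfl⟩
  exact C.tmem (by simp; omega) (by simp; omega) (dj_one hij)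

theorem Cor.vt_eq (C : Cor N φ τ x) {y z : K} (hy : y ∈ VT τ) (hz : z ∈ VT τ) (h : φ y = φ z) :
    y = z := by
  have := C.vt_inj (mul_mem hy (inv_mem hz)) (by rw [map_mul, map_inv, h, mul_inv_cancel])
  exact mul_inv_eq_one.1 this

theorem Cor.xs (C : Cor N φ τ x) {g : Hm d} {α : Wd d} {π : Equiv.Perm (Fin (d + 2))}
    {s : Fin (d + 2) → Hm d} (hg : g ∈ N) (h : ∀ i, At g [i] [π i] (s i)) (hs : ∀ i, s i ∈ N)
    (hα : 3 ≤ α.length) : ∃ u ∈ VT τ, φ u = atH (pm π) α ∧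
      x g α = u * pr fun i => x (s i) (α ++ [i]) := by
  obtain ⟨u, hu, e⟩ := C.xsplit hg h hs hα
  refine ⟨u, C.USub_le hα hu, ?_, e⟩
  have e2 := congrArg φ e
  rw [map_mul, C.phi_x hg hα, map_pr, atH_split h] at e2
  have e3 : (pr fun i => φ (x (s i) (α ++ [i]))) = pr fun i => atH (s i) (α ++ [i]) :=
    pr_congr fun i => C.phi_x (hs i) (by simp; omega)
  rw [e3] at e2
  exact (mul_right_cancel e2).symm

theorem Cor.f3x (C : Cor N φ τ x) (hN : Nuc N) {y : K} (hy : y ∈ VT τ) {g : Hm d} (hg : g ∈ N)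
    {α α' : Wd d} (h1 : 3 ≤ α.length) (h1' : 3 ≤ α'.length) (m1 : Mv (φ y) α α') :
    y * x g α * y⁻¹ = x g α' := by
  obtain ⟨n, hn, d1, d2, d3⟩ := C.deep hy
  have key : ∀ m, ∀ g ∈ N, ∀ α α' : Wd d, n ≤ α.length + m → 3 ≤ α.length → 3 ≤ α'.length →
      Mv (φ y) α α' → y * x g α * y⁻¹ = x g α' := by
    intro m
    induction m with
    | zero =>
      intro g hg α α' hα _ _ m1
      exact d3 g hg α α' hα m1
    | succ m ih =>
      intro g hg α α' hα h1 h1' m1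
      obtain ⟨π, s, hs, hA⟩ := hN.sec g hg
      obtain ⟨u, hu, eu, e⟩ := C.xs hg hA hs h1
      obtain ⟨u', hu', eu', e'⟩ := C.xs hg hA hs h1'
      have e1 : y * u * y⁻¹ = u' := by
        apply C.vt_eq (mul_mem (mul_mem hy hu) (inv_mem hy)) hu'
        rw [map_mul, map_mul, map_inv, eu, eu', at_conj_mv m1]
      have e2 : y * (pr fun i => x (s i) (α ++ [i])) * y⁻¹ = pr fun i => x (s i) (α' ++ [i]) := by
        rw [pr_conj]
        apply pr_congr
        intro i
        exact ih _ (hs i) _ _ (by simp; omega) (by simp; omega) (by simp; omega) (m1.append _)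
      rw [e, e', ← e1, ← e2]; group
  exact key n g hg α α' (by omega) h1 h1' m1

theorem Cor.x_one (C : Cor N φ τ x) (hN : Nuc N) {α : Wd d} (h : 3 ≤ α.length) : x 1 α = 1 := by
  have := C.xmul hN.one hN.one (by simpa using hN.one) h
  simpa using this

/-- decorated lists -/
def prL (x : Hm d → Wd d → K) (L : List (Wd d × Hm d)) : K := (L.map fun e => x e.2 e.1).prod

structure Ok (N : Set (Hm d)) (L : List (Wd d × Hm d)) : Prop where
  mem : ∀ e ∈ L, e.2 ∈ N
  len : ∀ e ∈ L, 3 ≤ e.1.length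
  pw : L.Pairwise fun a b => Dj a.1 b.1

theorem prL_append (L1 L2 : List (Wd d × Hm d)) : prL x (L1 ++ L2) = prL x L1 * prL x L2 := by
  simp [prL]
theorem prL_cons (e : Wd d × Hm d) (L : List (Wd d × Hm d)) :
    prL x (e :: L) = x e.2 e.1 * prL x L := by simp [prL]
theorem prL_nil : prL x [] = 1 := rfl

theorem Ok.nil : Ok N ([] : List (Wd d × Hm d)) := ⟨by simp, by simp, List.Pairwise.nil⟩

theorem ok_append {L1 L2 : List (Wd d × Hm d)} : Ok N (L1 ++ L2) ↔ Ok N L1 ∧ Ok N L2 ∧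
    ∀ a ∈ L1, ∀ b ∈ L2, Dj a.1 b.1 := by
  constructor
  · rintro ⟨h1, h2, h3⟩
    rw [List.pairwise_append] at h3
    exact ⟨⟨fun e he => h1 e (by simp [he]), fun e he => h2 e (by simp [he]), h3.1⟩,
      ⟨fun e he => h1 e (by simp [he]), fun e he => h2 e (by simp [he]), h3.2.1⟩, h3.2.2⟩
  · rintro ⟨h1, h2, h3⟩
    refine ⟨?_, ?_, List.pairwise_append.2 ⟨h1.pw, h2.pw, h3⟩⟩
    · intro e he
      rcases List.mem_append.1 he with h | h
      exacts [h1.mem e h, h2.mem e h]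
    · intro e he
      rcases List.mem_append.1 he with h | h
      exacts [h1.len e h, h2.len e h]

theorem ok_single {a : Wd d} {g : Hm d} (hg : g ∈ N) (ha : 3 ≤ a.length) : Ok N [(a, g)] :=
  ⟨by simpa using hg, by simpa using ha, by simp⟩

theorem ok_cons {a : Wd d × Hm d} {L : List (Wd d × Hm d)} : Ok N (a :: L) ↔
    (a.2 ∈ N ∧ 3 ≤ a.1.length) ∧ Ok N L ∧ ∀ b ∈ L, Dj a.1 b.1 := by
  have := ok_append (N := N) (L1 := [a]) (L2 := L)
  rw [List.singleton_append] at this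
  rw [this]
  simp only [List.mem_singleton, forall_eq]
  constructor
  · rintro ⟨h1, h2⟩
    exact ⟨⟨h1.mem a (by simp), h1.len a (by simp)⟩, h2⟩
  · rintro ⟨h1, h2⟩
    exact ⟨ok_single h1.1 h1.2, h2⟩

theorem Ok.perm {L L' : List (Wd d × Hm d)} (h : Ok N L) (p : L.Perm L') : Ok N L' :=
  ⟨fun e he => h.mem e (p.mem_iff.2 he), fun e he => h.len e (p.mem_iff.2 he),
    (p.pairwise_iff (fun h => h.symm)).1 h.pw⟩

theorem Cor.prL_perm (C : Cor N φ τ x) {L L' : List (Wd d × Hm d)} (h : Ok N L)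
    (p : L.Perm L') : prL x L = prL x L' := by
  apply List.Perm.prod_eq' (p.map _)
  rw [List.pairwise_map]
  refine List.Pairwise.imp_of_mem ?_ h.pw
  intro a b ha hb hd
  exact C.xcomm (h.mem a ha) (h.mem b hb) (h.len a ha) (h.len b hb) hd

/-- an element of `VT` commutes with decorated lists it fixes -/
theorem Cor.prL_conj (C : Cor N φ τ x) (hN : Nuc N) {v : K} (hv : v ∈ VT τ) (β : Wd d → Wd d)
    {L : List (Wd d × Hm d)}
    (h : Ok N L) (hm : ∀ e ∈ L, 3 ≤ (β e.1).length ∧ Mv (φ v) e.1 (β e.1)) :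
    v * prL x L * v⁻¹ = prL x (L.map fun e => (β e.1, e.2)) ∧ Ok N (L.map fun e => (β e.1, e.2))
    := by
  constructor
  · induction L with
    | nil => simp [prL]
    | cons a L ih =>
      have h' := ok_cons.1 h
      rw [List.map_cons, prL_cons, prL_cons, ← ih h'.2.1 (fun e he => hm e (by simp [he])),
        ← C.f3x hN hv h'.1.1 h'.1.2 (hm a (by simp)).1 (hm a (by simp)).2]
      group
  · refine ⟨?_, ?_, ?_⟩
    · intro e he
      obtain ⟨e', he', rfl⟩ := List.mem_map.1 he
      exact h.mem e' he'
    · intro e he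
      obtain ⟨e', he', rfl⟩ := List.mem_map.1 he
      exact (hm e' he').1
    · rw [List.pairwise_map]
      refine List.Pairwise.imp_of_mem ?_ h.pw
      intro a b ha hb hd
      exact (hm a ha).2.dj (hm b hb).2 hd

theorem Cor.prL_fix (C : Cor N φ τ x) (hN : Nuc N) {v : K} (hv : v ∈ VT τ)
    {L : List (Wd d × Hm d)}
    (h : Ok N L) (hm : ∀ e ∈ L, Mv (φ v) e.1 e.1) : prL x L * v = v * prL x L := by
  have := (C.prL_conj hN hv id h (fun e he => ⟨h.len e he, hm e he⟩)).1
  simp only [id, Prod.mk.eta, List.map_id'] at this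
  rw [mul_inv_eq_iff_eq_mul] at this
  exact this.symm

/-- supported forms -/
def Fm (N : Set (Hm d)) (φ : K →* Hm d) (τ : Wd d → Wd d → K) (x : Hm d → Wd d → K)
    (Q : K → Prop) (R : Wd d → Prop) (S : Set (Wd d)) (z : K) : Prop :=
  ∃ u L, z = u * prL x L ∧ u ∈ VT τ ∧ Q u ∧ (∀ w, (∀ a ∈ S, Dj w a) → Mv (φ u) w w) ∧ Ok N L ∧
    ∀ e ∈ L, R e.1 ∧ ∃ a ∈ S, a <+: e.1

theorem Cor.fm_mul (C : Cor N φ τ x) (hN : Nuc N) {Q : K → Prop}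
    (hQ : ∀ a b, Q a → Q b → Q (a * b))
    {R : Wd d → Prop} {S T : Set (Wd d)} {y z : K} (hd : ∀ a ∈ S, ∀ b ∈ T, Dj a b)
    (h1 : Fm N φ τ x Q R S y) (h2 : Fm N φ τ x Q R T z) : Fm N φ τ x Q R (S ∪ T) (y * z) := by
  obtain ⟨u, L, rfl, hu, qu, fu, oL, rL⟩ := h1
  obtain ⟨u', L', rfl, hu', qu', fu', oL', rL'⟩ := h2
  refine ⟨u * u', L ++ L', ?_, mul_mem hu hu', hQ _ _ qu qu', ?_, ?_, ?_⟩
  · have := C.prL_fix hN hu' oL (fun e he => fu' _ (fun b hb => by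
      obtain ⟨_, a, ha, hp⟩ := rL e he
      exact (hd a ha b hb).mono hp List.prefix_rfl))
    rw [prL_append, mul_assoc, ← mul_assoc _ u', this]; group
  · intro w hw
    rw [map_mul]
    exact (fu w fun a ha => hw a (Or.inl ha)).mul (fu' w fun a ha => hw a (Or.inr ha))
  · refine ok_append.2 ⟨oL, oL', ?_⟩
    intro a ha b hb
    obtain ⟨_, a', ha', hp⟩ := rL a ha
    obtain ⟨_, b', hb', hp'⟩ := rL' b hb
    exact (hd _ ha' _ hb').mono hp hp'
  · intro e he
    rcases List.mem_append.1 he with h | h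
    · obtain ⟨h1, a, ha, hp⟩ := rL e h
      exact ⟨h1, a, Or.inl ha, hp⟩
    · obtain ⟨h1, a, ha, hp⟩ := rL' e h
      exact ⟨h1, a, Or.inr ha, hp⟩

theorem Cor.fm_list (C : Cor N φ τ x) (hN : Nuc N) {Q : K → Prop} (hQ1 : Q 1)
    (hQ : ∀ a b, Q a → Q b → Q (a * b)) {R : Wd d → Prop} {ι : Type*} (a : ι → Wd d) (z : ι → K)
    (l : List ι) (hl : l.Pairwise fun i j => Dj (a i) (a j))
    (h : ∀ i ∈ l, Fm N φ τ x Q R {a i} (z i)) :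
    Fm N φ τ x Q R {w | ∃ i ∈ l, w = a i} (l.map z).prod := by
  induction l with
  | nil => exact ⟨1, [], by simp [prL], one_mem _, hQ1, fun w _ => by
      rw [map_one]; exact mv_one w, Ok.nil, by simp⟩
  | cons i l ih =>
    rw [List.pairwise_cons] at hl
    have h1 := C.fm_mul hN hQ (S := {a i}) ?_ (h i (by simp))
      (ih hl.2 (fun j hj => h j (by simp [hj])))
    · rw [List.map_cons, List.prod_cons]
      convert h1 using 1
      ext w; simp
    · rintro _ rfl b ⟨j, hj, rfl⟩
      exact hl.1 j hj

theorem Cor.fm_pr (C : Cor N φ τ x) (hN : Nuc N) {Q : K → Prop} (hQ1 : Q 1)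
    (hQ : ∀ a b, Q a → Q b → Q (a * b)) {R : Wd d → Prop} (a : Wd d) (z : Fin (d + 2) → K)
    (h : ∀ i, Fm N φ τ x Q R {a ++ [i]} (z i)) {u : K} (hu : u ∈ VT τ) (qu : Q u)
    (fu : ∀ w, Dj w a → Mv (φ u) w w) :
    Fm N φ τ x Q R {a} (u * pr z) := by
  obtain ⟨u', L', e, hu', qu', fu', oL', rL'⟩ := C.fm_list hN hQ1 hQ (fun i => a ++ [i]) z
    (List.finRange (d + 2)) ((List.nodup_finRange _).imp (fun h => dj_one h)) (fun i _ => h i)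
  refine ⟨u * u', L', ?_, mul_mem hu hu', hQ _ _ qu qu', ?_, oL', ?_⟩
  · rw [pr, e, mul_assoc]
  · intro w hw
    rw [map_mul]
    refine (fu w (hw a rfl)).mul (fu' w ?_)
    rintro _ ⟨i, _, rfl⟩
    exact (hw a rfl).right _
  · intro e he
    obtain ⟨h1, _, ⟨i, _, rfl⟩, hp⟩ := rL' e he
    exact ⟨h1, a, rfl, (List.prefix_append _ _).trans hp⟩

/-- level-preserving -/
def LP (φ : K →* Hm d) (n : ℕ) (u : K) : Prop :=
  ∀ w : Wd d, n ≤ w.length → ∃ w', w'.length = w.length ∧ Mv (φ u) w w'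

theorem LP.one (n : ℕ) : LP φ n (1 : K) := fun w _ => ⟨w, rfl, by rw [map_one]; exact mv_one w⟩
theorem LP.mul {n : ℕ} {u v : K} (hu : LP φ n u) (hv : LP φ n v) : LP φ n (u * v) := by
  intro w hw
  obtain ⟨w', h', m'⟩ := hv w hw
  obtain ⟨w'', h'', m''⟩ := hu w' (by omega)
  exact ⟨w'', by omega, by rw [map_mul]; exact m''.mul m'⟩

theorem pm_lp (π : Equiv.Perm (Fin (d + 2))) (a w : Wd d) (h : a.length + 1 ≤ w.length) :
    ∃ w', w'.length = w.length ∧ Mv (atH (pm π) a) w w' := by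
  rcases prefix_or_dj (γ := a) (w := w) (by omega) with ⟨u, rfl⟩ | h3
  · cases u with
    | nil => simp at h
    | cons i u =>
      refine ⟨a ++ (π i :: u), by simp, fun y => ?_⟩
      have e : ∀ j : Fin (d + 2), (a ++ j :: u) ⌢ y = a ⌢ ([j] ⌢ (u ⌢ y)) := by
        intro j; rw [← wa_append, ← wa_append]; simp
      rw [e, e, atH_at, pm_mv]
  · exact ⟨w, rfl, atH_fix _ h3.symm⟩

theorem Cor.x_level (C : Cor N φ τ x) (hN : Nuc N) {n : ℕ} : ∀ {g : Hm d} {a : Wd d}, g ∈ N →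
    3 ≤ a.length → a.length ≤ n →
    Fm N φ τ x (LP φ n) (fun w => w.length = n) {a} (x g a) := by
  have key : ∀ m, ∀ {g : Hm d} {a : Wd d}, g ∈ N →
    3 ≤ a.length → a.length + m = n →
    Fm N φ τ x (LP φ n) (fun w => w.length = n) {a} (x g a) := by
    intro m
    induction m with
    | zero =>
      intro g a hg ha hn
      exact ⟨1, [(a, g)], by simp [prL], one_mem _, LP.one n, fun w _ => by
        rw [map_one]; exact mv_one w, ok_single hg ha, by
          intro e he
          rw [List.mem_singleton] at he
          subst he
          exact ⟨by simpa using hn, a, rfl, List.prefix_rfl⟩⟩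
    | succ m ih =>
      intro g a hg ha hn
      obtain ⟨π, s, hs, hA⟩ := hN.sec g hg
      obtain ⟨u, hu, eu, e⟩ := C.xs hg hA hs ha
      rw [e]
      refine C.fm_pr hN (LP.one n) (fun _ _ => LP.mul) a _ ?_ hu ?_ ?_
      · intro i
        exact ih (hs i) (by simp; omega) (by simp; omega)
      · intro w hw
        rw [eu]; exact pm_lp π a w (by omega)
      · intro w hw
        rw [eu]; exact atH_fix _ hw
  intro g a hg ha hn
  exact key (n - a.length) hg ha (by omega)

theorem Cor.list_level (C : Cor N φ τ x) (hN : Nuc N) {n : ℕ} {L : List (Wd d × Hm d)}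
    (h : Ok N L) (hn : ∀ e ∈ L, e.1.length ≤ n) :
    ∃ u L', prL x L = u * prL x L' ∧ u ∈ VT τ ∧ LP φ n u ∧ Ok N L' ∧ ∀ e ∈ L', e.1.length = n := by
  obtain ⟨u, L', e, hu, qu, fu, oL, rL⟩ := C.fm_list hN (LP.one (φ := φ) n) (fun _ _ => LP.mul)
    (R := fun w => w.length = n) Prod.fst
    (fun e => x e.2 e.1) L h.pw (fun e he => C.x_level hN (h.mem e he) (h.len e he) (hn e he))
  exact ⟨u, L', e, hu, qu, oL, fun e he => (rL e he).1⟩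

theorem list_prod_mul {ι : Type*} (f g : ι → K) (l : List ι) (hl : l.Nodup)
    (h : ∀ i j, i ≠ j → f i * g j = g j * f i) :
    (l.map f).prod * (l.map g).prod = (l.map fun i => f i * g i).prod := by
  induction l with
  | nil => simp
  | cons i l ih =>
    rw [List.nodup_cons] at hl
    have hc : ∀ l' : List ι, i ∉ l' → (l'.map f).prod * g i = g i * (l'.map f).prod := by
      intro l'
      induction l' with
      | nil => simp
      | cons j l' ih' =>
        intro hi
        rw [List.mem_cons, not_or] at hi
        rw [List.map_cons, List.prod_cons, mul_assoc, ih' hi.2, ← mul_assoc, h j i (Ne.symm hi.1),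
          mul_assoc]
    simp only [List.map_cons, List.prod_cons]
    rw [← ih hl.2, mul_assoc, ← mul_assoc _ (g i), hc l hl.1]
    simp only [mul_assoc]

theorem At.single_perm {g h : Hm d} {π ρ : Equiv.Perm (Fin (d + 2))} {s t : Fin (d + 2) → Hm d}
    (h1 : ∀ i, At g [i] [π i] (s i)) (h2 : ∀ i, At h [i] [ρ i] (t i)) (i) :
    At (g * h) [i] [π (ρ i)] (s (ρ i) * t i) := (h1 (ρ i)).mul (h2 i)

theorem at_sec_unique {g : Hm d} {i j k : Fin (d + 2)} {s t : Hm d} (h1 : At g [i] [j] s)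
    (h2 : At g [i] [k] t) : s = t := by
  apply hm_ext
  intro y
  have e := (h1 y).symm.trans (h2 y)
  have := wa_eq_len (by simp) e
  rw [← this.1] at e
  exact wa_inj e

/-- products of two decorations -/
theorem Cor.x_mul (C : Cor N φ τ x) (hN : Nuc N) {k : Hm d} (hk : Contr N k) :
    ∀ {g h : Hm d} {a : Wd d}, g ∈ N → h ∈ N → k = g * h → 3 ≤ a.length →
    Fm N φ τ x (fun _ => True) (fun _ => True) {a} (x g a * x h a) := by
  induction hk with
  | mem k hk =>
    rintro g h a hg hh rfl ha
    rw [C.xmul hg hh hk ha]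
    exact ⟨1, [(a, g * h)], by simp [prL], one_mem _, trivial, fun w _ => by
        rw [map_one]; exact mv_one w, ok_single hk ha, by
          intro e he
          rw [List.mem_singleton] at he
          subst he
          exact ⟨trivial, a, rfl, List.prefix_rfl⟩⟩
  | node k ω r hr _ ih =>
    rintro g h a hg hh rfl ha
    obtain ⟨π, s, hs, hA⟩ := hN.sec g hg
    obtain ⟨u, hu, eu, e⟩ := C.xs hg hA hs ha
    obtain ⟨ρ, t, ht, hB⟩ := hN.sec h hh
    obtain ⟨v, hv, ev, e'⟩ := C.xs hh hB ht ha
    have hl : ∀ i, 3 ≤ (a ++ [i]).length := fun i => by simp; omega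
    have mv : ∀ i, Mv (φ v) (a ++ [i]) (a ++ [ρ i]) := by
      intro i y
      rw [ev, wa_append, atH_at, pm_mv, wa_append]
    have key : (pr fun i => x (s i) (a ++ [i])) = v * (pr fun i => x (s (ρ i)) (a ++ [i])) * v⁻¹ := by
      rw [pr_conj]
      have : (fun i => v * x (s (ρ i)) (a ++ [i]) * v⁻¹) = fun i => x (s (ρ i)) (a ++ [ρ i]) := by
        funext i
        exact C.f3x hN hv (hs _) (hl i) (hl _) (mv i)
      rw [this, pr, pr]
      have e2 : (List.finRange (d + 2)).map (fun i => x (s (ρ i)) (a ++ [ρ i])) =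
        ((List.finRange (d + 2)).map ρ).map (fun i => x (s i) (a ++ [i])) := by
        simp [Function.comp_def]
      rw [e2]
      apply List.Perm.prod_eq'
      · apply List.Perm.map
        rw [List.perm_ext_iff_of_nodup (List.nodup_finRange _)
          ((List.nodup_finRange _).map ρ.injective)]
        intro i
        simp only [List.mem_finRange, List.mem_map, true_and, true_iff]
        exact ρ.surjective i
      · rw [List.pairwise_map]
        exact (List.nodup_finRange _).imp (fun hij => C.xcomm (hs _) (hs _) (hl _) (hl _)
          (dj_one hij))
    have e3 : x g a * x h a = (u * v) * pr fun i => x (s (ρ i)) (a ++ [i]) * x (t i) (a ++ [i]) := by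
      rw [e, e', key]
      have := list_prod_mul (fun i => x (s (ρ i)) (a ++ [i])) (fun i => x (t i) (a ++ [i]))
        (List.finRange (d + 2)) (List.nodup_finRange _) (fun i j hij =>
          C.xcomm (hs _) (ht _) (hl _) (hl _) (dj_one hij))
      rw [← pr, ← pr, ← pr] at this
      rw [← this]; group
    rw [e3]
    refine C.fm_pr hN trivial (fun _ _ _ _ => trivial) a _ ?_ (mul_mem hu hv) trivial ?_
    · intro i
      exact ih i (hs _) (ht _) (at_sec_unique (hr i) (At.single_perm hA hB i)) (hl i)
    · intro w hw
      rw [map_mul, eu, ev]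
      exact (atH_fix _ hw).mul (atH_fix _ hw)

/-- merging two decorated lists of the same level -/
theorem Cor.merge (C : Cor N φ τ x) (hN : Nuc N) {n : ℕ} (L0 : List (Wd d × Hm d)) (h0 : Ok N L0)
    (n0 : ∀ e ∈ L0, e.1.length = n) : ∀ L : List (Wd d × Hm d), Ok N L →
    (∀ e ∈ L, e.1.length = n) → ∃ w L', prL x L0 * prL x L = w * prL x L' ∧ w ∈ VT τ ∧ Ok N L' ∧
      (∀ a, (∀ e ∈ L0, Dj a e.1) → Mv (φ w) a a) ∧
      (∀ e ∈ L', ∃ e' ∈ L0 ++ L, e'.1 <+: e.1) := by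
  classical
  induction L0 with
  | nil =>
    intro L hL _
    refine ⟨1, L, by simp [prL], one_mem _, hL, fun a _ => by rw [map_one]; exact mv_one a, ?_⟩
    intro e he
    exact ⟨e, by simpa using he, List.prefix_rfl⟩
  | cons b L0 ih =>
    obtain ⟨p, h⟩ := b
    intro L hL hn
    obtain ⟨⟨hh, hp⟩, o0, d0⟩ := ok_cons.1 h0
    have pn : p.length = n := n0 (p, h) (by simp)
    have ih := ih o0 (fun e he => n0 e (by simp [he]))
    by_cases hin : ∃ g, (p, g) ∈ L
    · obtain ⟨g, hg⟩ := hin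
      have pp := List.perm_cons_erase hg
      set L1 := L.erase (p, g)
      have hL1 := hL.perm pp
      obtain ⟨⟨gN, _⟩, o1, d1⟩ := ok_cons.1 hL1
      obtain ⟨w, L', e, hw, oL', fw, sL'⟩ := ih L1 o1 (fun e he => hn e (pp.mem_iff.2 (by simp [he])))
      obtain ⟨v, Lp, ep, hv, _, fv, oLp, sLp⟩ :=
        C.x_mul hN (hN.contr h hh g gN) hh gN rfl hp
      have c1 : prL x L0 * x g p = x g p * prL x L0 := by
        have q1 : Ok N ((p, g) :: L0) := ok_cons.2 ⟨⟨gN, hp⟩, o0, d0⟩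
        have := C.prL_perm q1 (List.perm_append_comm (l₁ := [(p, g)]) (l₂ := L0))
        rw [prL_append, prL_cons, prL_cons, prL_nil, mul_one] at this
        exact this.symm
      have sp : ∀ e ∈ Lp, p <+: e.1 := by
        intro e he
        obtain ⟨_, a, rfl, h⟩ := sLp e he
        exact h
      have pL' : ∀ e ∈ L', Dj p e.1 := by
        intro e he
        obtain ⟨e', he', hpre⟩ := sL' e he
        rcases List.mem_append.1 he' with h1 | h1
        · exact (d0 e' h1).mono List.prefix_rfl hpre
        · exact (d1 e' h1).mono List.prefix_rfl hpre
      have c2 : prL x Lp * w = w * prL x Lp := by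
        apply C.prL_fix hN hw oLp
        intro e he
        exact fw _ (fun e' he' => (d0 e' he').mono (sp e he) List.prefix_rfl)
      refine ⟨v * w, Lp ++ L', ?_, mul_mem hv hw, ?_, ?_, ?_⟩
      · rw [C.prL_perm hL pp, prL_cons, prL_cons, prL_append]
        calc x h p * prL x L0 * (x g p * prL x L1) = x h p * (prL x L0 * x g p) * prL x L1 := by
              group
          _ = (x h p * x g p) * (prL x L0 * prL x L1) := by rw [c1]; group
          _ = v * (prL x Lp * w) * prL x L' := by rw [e, ep]; group
          _ = _ := by rw [c2]; group
      · refine ok_append.2 ⟨oLp, oL', ?_⟩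
        intro a ha b hb
        exact (pL' b hb).mono (sp a ha) List.prefix_rfl
      · intro a ha
        rw [map_mul]
        refine (fv a ?_).mul (fw a fun e he => ha e (by simp [he]))
        intro b hb
        rw [Set.mem_singleton_iff.1 hb]
        exact ha (p, h) (by simp)
      · intro e he
        rcases List.mem_append.1 he with h1 | h1
        · exact ⟨(p, h), by simp, sp e h1⟩
        · obtain ⟨e', he', hpre⟩ := sL' e h1
          refine ⟨e', ?_, hpre⟩
          rcases List.mem_append.1 he' with h2 | h2
          · simp [h2]
          · have : e' ∈ L := pp.mem_iff.2 (by simp [h2])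
            simp [this]
    · obtain ⟨w, L', e, hw, oL', fw, sL'⟩ := ih L hL hn
      have pL' : ∀ e ∈ L', Dj p e.1 := by
        intro e he
        obtain ⟨e', he', hpre⟩ := sL' e he
        rcases List.mem_append.1 he' with h1 | h1
        · exact (d0 e' h1).mono List.prefix_rfl hpre
        · refine Dj.mono (dj_of_len (pn.trans (hn e' h1).symm) ?_) List.prefix_rfl hpre
          rintro rfl
          exact hin ⟨e'.2, h1⟩
      refine ⟨w, (p, h) :: L', ?_, hw, ok_cons.2 ⟨⟨hh, hp⟩, oL', pL'⟩, ?_, ?_⟩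
      · have c2 : x h p * w = w * x h p := by
          have := C.prL_fix hN hw (ok_single hh hp) (by
            intro e he
            rw [List.mem_singleton] at he
            subst he
            exact fw _ d0)
          rw [prL_cons, prL_nil, mul_one] at this
          exact this
        rw [prL_cons, prL_cons, mul_assoc, e, ← mul_assoc]
        change x h p * w * _ = _
        rw [c2, mul_assoc]
      · intro a ha
        exact fw a fun e he => ha e (by simp [he])
      · intro e he
        rcases List.mem_cons.1 he with rfl | h1
        · exact ⟨(p, h), by simp, List.prefix_rfl⟩
        · obtain ⟨e', he', hpre⟩ := sL' e h1
          exact ⟨e', by rw [List.cons_append]; exact List.mem_cons_of_mem _ he', hpre⟩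

theorem exists_bd (L : List (Wd d × Hm d)) : ∃ n, ∀ e ∈ L, e.1.length ≤ n := by
  induction L with
  | nil => exact ⟨0, by simp⟩
  | cons a L ih =>
    obtain ⟨n, h⟩ := ih
    refine ⟨n + a.1.length, ?_⟩
    intro e he
    rcases List.mem_cons.1 he with rfl | h1
    · omega
    · have := h e h1; omega

/-- normal forms `v * prL L` -/
def NF (N : Set (Hm d)) (τ : Wd d → Wd d → K) (x : Hm d → Wd d → K) (z : K) : Prop :=
  ∃ u ∈ VT τ, ∃ L, Ok N L ∧ z = u * prL x L

theorem Cor.nf_mul_vt (C : Cor N φ τ x) (hN : Nuc N) {L : List (Wd d × Hm d)} (h : Ok N L) {v : K}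
    (hv : v ∈ VT τ) : NF N τ x (prL x L * v) := by
  classical
  obtain ⟨m, hm, d1, -, -⟩ := C.deep (inv_mem hv)
  obtain ⟨n, hn⟩ := exists_bd L
  obtain ⟨u, L', e, hu, _, oL, lL⟩ := C.list_level hN (n := n + m) h
    (fun e he => (hn e he).trans (by omega))
  choose! β hβ using d1
  have hq := C.prL_conj hN (inv_mem hv) β oL (fun e he => by
    have := hβ e.1 (by rw [lL e he]; omega)
    exact ⟨this.1, this.2.2⟩)
  refine ⟨u * v, mul_mem hu hv, _, hq.2, ?_⟩
  rw [← hq.1, e]; group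

theorem Cor.nf_mul_list (C : Cor N φ τ x) (hN : Nuc N) {L0 L : List (Wd d × Hm d)} (h0 : Ok N L0)
    (h : Ok N L) : NF N τ x (prL x L0 * prL x L) := by
  classical
  obtain ⟨n1, hn1⟩ := exists_bd L
  obtain ⟨n2, hn2⟩ := exists_bd L0
  obtain ⟨u, L', e, hu, lu, oL, lL⟩ := C.list_level hN (n := n1 + n2) h
    (fun e he => (hn1 e he).trans (by omega))
  obtain ⟨u0, L0', e0, hu0, lu0, oL0, lL0⟩ := C.list_level hN (n := n1 + n2) h0
    (fun e he => (hn2 e he).trans (by omega))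
  obtain ⟨m, hm⟩ : ∃ β : Wd d → Wd d, ∀ w : Wd d, n1 + n2 ≤ w.length →
      (β w).length = w.length ∧ Mv (φ u⁻¹) w (β w) := by
    have : ∀ w : Wd d, ∃ w' : Wd d, n1 + n2 ≤ w.length →
      w'.length = w.length ∧ Mv (φ u⁻¹) w w' := by
      intro w
      by_cases hw : n1 + n2 ≤ w.length
      · have hsurj : ∃ w', w'.length = w.length ∧ Mv (φ u) w' w := by
          choose! β hβ using lu
          let f : {v : Wd d // v.length = w.length} → {v : Wd d // v.length = w.length} :=
            fun v => ⟨β v.1, by rw [(hβ v.1 (by rw [v.2]; exact hw)).1, v.2]⟩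
          have hf : Function.Injective f := by
            intro a b hab
            have h1 := (hβ a.1 (by rw [a.2]; exact hw)).2
            have h2 := (hβ b.1 (by rw [b.2]; exact hw)).2
            have h3 : β a.1 = β b.1 := congrArg Subtype.val hab
            rw [h3] at h1
            exact Subtype.ext (h1.inv.unique h2.inv)
          have : Finite {v : Wd d // v.length = w.length} := List.finite_length_eq _ _
          obtain ⟨w', hw'⟩ := Finite.surjective_of_injective hf ⟨w, rfl⟩
          refine ⟨w'.1, w'.2, ?_⟩
          have h1 := (hβ w'.1 (by rw [w'.2]; exact hw)).2
          have h3 : β w'.1 = w := congrArg Subtype.val hw'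
          rwa [h3] at h1
        obtain ⟨w', h1, h2⟩ := hsurj
        exact ⟨w', fun _ => ⟨h1, by rw [map_inv]; exact h2.inv⟩⟩
      · exact ⟨w, fun h => absurd h hw⟩
    choose β hβ using this
    exact ⟨β, hβ⟩
  have hq := C.prL_conj hN (inv_mem hu) m oL0 (fun e he => by
    have h1 := hm e.1 (by rw [lL0 e he])
    exact ⟨by rw [h1.1]; exact oL0.len e he, h1.2⟩)
  obtain ⟨w, Lf, ef, hw, of, -, -⟩ := C.merge hN (n := n1 + n2) _ hq.2 (by
    intro e he
    obtain ⟨e', he', rfl⟩ := List.mem_map.1 he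
    exact ((hm e'.1 (by rw [lL0 e' he'])).1).trans (lL0 e' he')) L' oL lL
  refine ⟨u0 * u * w, mul_mem (mul_mem hu0 hu) hw, Lf, of, ?_⟩
  rw [mul_assoc, ← ef, ← hq.1, e0, e]; group

theorem Cor.nf_all (C : Cor N φ τ x) (hN : Nuc N) (k : K) : NF N τ x k := by
  have hk : k ∈ Subgroup.closure ({k | ∃ γ γ', Sig0 γ γ' ∧ τ γ γ' = k} ∪
    {k | ∃ g ∈ N, ∃ α, 3 ≤ α.length ∧ x g α = k}) := by rw [C.gen]; trivial
  have vt : ∀ v ∈ VT τ, ∀ z, NF N τ x z → NF N τ x (v * z) := by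
    rintro v hv _ ⟨u, hu, L, hL, rfl⟩
    exact ⟨v * u, mul_mem hv hu, L, hL, by group⟩
  have xx : ∀ g ∈ N, ∀ α : Wd d, 3 ≤ α.length → ∀ z, NF N τ x z → NF N τ x (x g α * z) := by
    rintro g hg α hα _ ⟨u, hu, L, hL, rfl⟩
    obtain ⟨v, hv, L', hL', e⟩ := C.nf_mul_vt hN (ok_single hg hα) hu
    rw [prL_cons, prL_nil, mul_one] at e
    have e2 : x g α * (u * prL x L) = v * (prL x L' * prL x L) := by
      rw [← mul_assoc, ← mul_assoc, ← e]
    rw [e2]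
    exact vt v hv _ (C.nf_mul_list hN hL' hL)
  induction hk using Subgroup.closure_induction_left with
  | one => exact ⟨1, one_mem _, [], Ok.nil, by simp [prL]⟩
  | mul_left a ha y hy ih =>
    rcases ha with ⟨γ, γ', sg, rfl⟩ | ⟨g, hg, α, hα, rfl⟩
    · exact vt _ (Subgroup.subset_closure ⟨γ, γ', sg, rfl⟩) _ ih
    · exact xx g hg α hα _ ih
  | inv_mul_cancel a ha y hy ih =>
    rcases ha with ⟨γ, γ', sg, rfl⟩ | ⟨g, hg, α, hα, rfl⟩
    · exact vt _ (inv_mem (Subgroup.subset_closure ⟨γ, γ', sg, rfl⟩)) _ ih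
    · have : (x g α)⁻¹ = x g⁻¹ α := by
        apply inv_eq_of_mul_eq_one_right
        rw [C.xmul hg (hN.inv g hg) (by simpa using hN.one) hα, mul_inv_cancel, C.x_one hN hα]
      rw [this]
      exact xx _ (hN.inv g hg) α hα _ ih

theorem Cor.prL_at (C : Cor N φ τ x) {L : List (Wd d × Hm d)} (h : Ok N L) :
    (∀ e ∈ L, At (φ (prL x L)) e.1 e.1 e.2) ∧
    ∀ w, (∀ e ∈ L, Dj w e.1) → Mv (φ (prL x L)) w w := by
  induction L with
  | nil => exact ⟨by simp, fun w _ => by rw [prL_nil, map_one]; exact mv_one w⟩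
  | cons a L ih =>
    obtain ⟨⟨h1, h2⟩, h3, h4⟩ := ok_cons.1 h
    obtain ⟨i1, i2⟩ := ih h3
    rw [prL_cons, map_mul, C.phi_x h1 h2]
    constructor
    · intro e he
      rcases List.mem_cons.1 he with rfl | he
      · have := (atH_at e.2 e.1).mul (mv_iff_at.1 (i2 e.1 h4))
        simpa using this
      · simpa using ((mv_iff_at.1 (atH_fix a.2 (h4 e he).symm)).mul (i1 e he))
    · intro w hw
      exact (atH_fix a.2 (hw a (by simp))).mul (i2 w fun e he => hw e (by simp [he]))

theorem eq_one_of_wa {α β : Wd d} {h : Hm d} (H : ∀ y, α ⌢ y = β ⌢ h y) : h = 1 := by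
  obtain ⟨κ, rfl⟩ := wa_forall_pfx (fun y => ⟨h y, H y⟩)
  have H2 : ∀ y, h y = κ ⌢ y := by
    intro y
    have := H y
    rw [wa_append] at this
    exact (wa_inj this).symm
  have hκ : κ = [] := by
    cases κ with
    | nil => rfl
    | cons i κ =>
      exfalso
      obtain ⟨j, hj⟩ := exists_ne i
      obtain ⟨y, hy⟩ := h.surjective (fun _ => j)
      rw [H2] at hy
      have := congrFun hy 0
      rw [wa_cons_zero] at this
      exact hj this.symm
  subst hκ
  apply hm_ext
  intro y
  rw [H2, wa_nil]; rfl

/-- **`φ` is injective.** -/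
theorem Cor.inj (C : Cor N φ τ x) (hN : Nuc N) : Function.Injective φ := by
  rw [injective_iff_map_eq_one]
  intro k hk
  obtain ⟨v, hv, L, hL, rfl⟩ := C.nf_all hN k
  obtain ⟨m, hm, d1, -, -⟩ := C.deep hv
  obtain ⟨n, hn⟩ := exists_bd L
  obtain ⟨u, L', e, hu, lu, oL, lL⟩ := C.list_level hN (n := n + m) hL
    (fun e he => (hn e he).trans (by omega))
  rw [e, ← mul_assoc] at hk ⊢
  have hvu : φ (v * u) = (φ (prL x L'))⁻¹ := by
    rw [map_mul] at hk
    exact eq_inv_of_mul_eq_one_left hk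
  have h1 : prL x L' = 1 := by
    apply List.prod_eq_one
    intro z hz
    obtain ⟨a, ha, rfl⟩ := List.mem_map.1 hz
    have : a.2 = 1 := by
      obtain ⟨w', hw', m1⟩ := lu a.1 (by rw [lL a ha])
      obtain ⟨w'', _, _, m2⟩ := d1 w' (by rw [hw', lL a ha]; omega)
      have m3 : Mv (φ (v * u)) a.1 w'' := by rw [map_mul]; exact m2.mul m1
      have m4 := ((C.prL_at oL).1 a ha).inv
      rw [← hvu] at m4
      have := eq_one_of_wa (fun y => (m3 y).symm.trans (m4 y))
      exact inv_eq_one.1 this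
    change x a.2 a.1 = 1
    rw [this]
    exact C.x_one hN (oL.len a ha)
  rw [h1, mul_one] at hk ⊢
  exact C.vt_inj (mul_mem hv hu) hk

end InjSec

/-! ## Thompson's group inside the generated group -/
section ThompsonSec
variable {d : ℕ}

/-- `f` acts by prefix replacement on all sufficiently deep cones. -/
def VV (f : Hm d) : Prop := ∃ n, ∀ w : Wd d, n ≤ w.length → ∃ β, Mv f w β

theorem vv_of_level {f : Hm d} (n : ℕ) (h : ∀ w : Wd d, w.length = n → ∃ β, Mv f w β) : VV f := by
  refine ⟨n, fun w hw => ?_⟩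
  obtain ⟨β, hβ⟩ := h (w.take n) (by simp; omega)
  refine ⟨β ++ w.drop n, ?_⟩
  have := hβ.append (w.drop n)
  rwa [List.take_append_drop] at this

theorem dj_of_disjoint {α β : Wd d} (h : Disjoint (cone α) (cone β)) : Dj α β := by
  have key : ∀ {α β : Wd d}, Disjoint (cone α) (cone β) → ¬ α <+: β := by
    rintro α _ h ⟨u, rfl⟩
    exact (Set.disjoint_left.1 h) ⟨u ⌢ fun _ => 0, (wa_append _ _ _).symm⟩ ⟨_, rfl⟩
  exact ⟨key h, key h.symm⟩

theorem disjoint_of_dj {α β : Wd d} (h : Dj α β) : Disjoint (cone α) (cone β) := by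
  rw [Set.disjoint_left]
  rintro _ ⟨x, rfl⟩
  exact not_mem_cone_of_dj h x

theorem thompson_iff {f : Hm d} : InThompsonV f ↔ VV f := by
  constructor
  · rintro ⟨k, αs, βs, hα, -, -, -, hf⟩
    refine ⟨∑ i, (αs i).length, fun w hw => ?_⟩
    have : (w ⌢ fun _ => 0) ∈ ⋃ i, cone (αs i) := by rw [hα]; trivial
    obtain ⟨i, y, hy⟩ := Set.mem_iUnion.1 this
    have hl : (αs i).length ≤ w.length :=
      (Finset.single_le_sum (f := fun i => (αs i).length) (fun _ _ => Nat.zero_le _)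
        (Finset.mem_univ i)).trans hw
    obtain ⟨u, rfl⟩ := wa_pfx hl hy
    exact ⟨βs i ++ u, Mv.append (hf i) u⟩
  · rintro ⟨n, hn⟩
    have hfin : Finite {w : Wd d // w.length = n} := (List.finite_length_eq _ n)
    have : Fintype {w : Wd d // w.length = n} := Fintype.ofFinite _
    let e := (Fintype.equivFin {w : Wd d // w.length = n}).symm
    choose! b hb using hn
    have hb' : ∀ w : Wd d, w.length = n → Mv f w (b w) := fun w hw => hb w hw.ge
    refine ⟨_, fun i => (e i).1, fun i => b (e i).1, ?_, ?_, ?_, ?_, ?_⟩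
    · refine Set.eq_univ_of_forall fun y => ?_
      obtain ⟨α, z, h, rfl⟩ := wa_decomp n y
      refine Set.mem_iUnion.2 ⟨e.symm ⟨α, h⟩, z, by simp⟩
    · intro i j hij
      refine disjoint_of_dj (dj_of_len ((e i).2.trans (e j).2.symm) ?_)
      exact fun h => hij (e.injective (Subtype.ext h))
    · refine Set.eq_univ_of_forall fun y => ?_
      obtain ⟨α, z, h, hz⟩ := wa_decomp n (f⁻¹ y)
      refine Set.mem_iUnion.2 ⟨e.symm ⟨α, h⟩, z, ?_⟩
      have := hb' α h z
      rw [← hz, hm_apply_inv_self] at this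
      simp [this]
    · intro i j hij
      refine disjoint_of_dj (Mv.dj (hb' _ (e i).2) (hb' _ (e j).2)
        (dj_of_len ((e i).2.trans (e j).2.symm) ?_))
      exact fun h => hij (e.injective (Subtype.ext h))
    · intro i
      exact hb' _ (e i).2

variable {K : Type*} [Group K] {N : Set (Hm d)} {φ : K →* Hm d}
  {τ : Wd d → Wd d → K} {x : Hm d → Wd d → K}

theorem Cor.perm_gen (C : Cor N φ τ x) {A : Set (Wd d)} (hA : CA A) {h : Hm d}
    (hh : ∀ a ∈ A, ∃ b ∈ A, Mv h a b) : ∃ σ ∈ SA τ A, φ σ = h := by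
  classical
  have key : ∀ s : Finset (Wd d), ∀ h : Hm d, (∀ a ∈ A, ∃ b ∈ A, Mv h a b) →
      (∀ a ∈ A, a ∉ s → Mv h a a) → ∃ σ ∈ SA τ A, φ σ = h := by
    intro s
    induction s using Finset.induction_on with
    | empty =>
      intro h _ hf
      refine ⟨1, one_mem _, ?_⟩
      rw [map_one]
      refine hm_ext fun y => ?_
      obtain ⟨a, ha, z, rfl⟩ := hA.cover y
      exact (hf a ha (by simp) z).symm
    | insert p s hps ih =>
      intro h hh hf
      by_cases hp : p ∈ A
      swap
      · refine ih h hh fun a ha has => hf a ha ?_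
        rw [Finset.mem_insert, not_or]
        exact ⟨fun e => hp (e ▸ ha), has⟩
      obtain ⟨q, hq, m⟩ := hh p hp
      by_cases hpq : p = q
      · subst hpq
        refine ih h hh fun a ha has => ?_
        by_cases e : a = p
        · rw [e]; exact m
        · exact hf a ha (by simp [e, has])
      have hdj := hA.anti.dj p hp q hq hpq
      have hsw : ∀ a ∈ A, ∃ b ∈ A, Mv (swapH p q) a b := by
        intro a ha
        by_cases h1 : a = p
        · subst h1; exact ⟨q, hq, swapH_left hdj⟩
        by_cases h2 : a = q
        · subst h2; exact ⟨p, hp, swapH_right hdj⟩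
        exact ⟨a, ha, swapH_fix (hA.anti.dj a ha p hp h1) (hA.anti.dj a ha q hq h2)⟩
      obtain ⟨σ, hσ, e⟩ := ih (swapH p q * h) (fun a ha => by
          obtain ⟨b, hb, m1⟩ := hh a ha
          obtain ⟨c, hc, m2⟩ := hsw b hb
          exact ⟨c, hc, m2.mul m1⟩) (fun a ha has => by
          by_cases e : a = p
          · rw [e]; exact (swapH_right hdj).mul m
          have m1 := hf a ha (by simp [e, has])
          have h2 : a ≠ q := by
            rintro rfl
            have := (m.inv).unique m1.inv
            exact hpq this
          exact (swapH_fix (hA.anti.dj a ha p hp e) (hA.anti.dj a ha q hq h2)).mul m1)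
      refine ⟨τ p q * σ, mul_mem (Subgroup.subset_closure ⟨p, hp, q, hq, hpq, rfl⟩) hσ, ?_⟩
      rw [map_mul, e, C.phi_t (hA.anti.len p hp) (hA.anti.len q hq) hdj, ← mul_assoc,
        swapH_mul_self, one_mul]
  exact key hA.fin.toFinset h hh fun a ha hn => (hn (by simpa using ha)).elim

theorem Cor.vv_range (C : Cor N φ τ x) {f : Hm d} (hf : VV f) : ∃ y ∈ VT τ, φ y = f := by
  obtain ⟨n, hn⟩ := hf
  have hn3 : ∀ w : Wd d, w.length = n + 3 → ∃ β, 3 ≤ β.length ∧ Mv f w β := by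
    intro w hw
    obtain ⟨β, hβ⟩ := hn (w.take n) (by simp; omega)
    refine ⟨β ++ w.drop n, by simp; omega, ?_⟩
    have := hβ.append (w.drop n)
    rwa [List.take_append_drop] at this
  choose! b hb3 hb using hn3
  let A : Set (Wd d) := {w | w.length = n + 3}
  let B : Set (Wd d) := b '' A
  have hAl : ∀ a ∈ A, a.length = n + 3 := fun _ h => h
  have hA : CA A := by
    refine ⟨⟨fun a ha => ?_, fun a ha b hb h => ?_⟩, List.finite_length_eq _ _, fun y => ?_⟩
    · rw [hAl a ha]; omega
    · exact dj_of_len ((hAl a ha).trans (hAl b hb).symm) h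
    · obtain ⟨α, z, h, rfl⟩ := wa_decomp (n + 3) y
      exact ⟨α, h, z, rfl⟩
  have hinj : Set.InjOn b A := by
    intro u hu v hv e
    have h1 := (hb u (hAl u hu)).inv
    have h2 := (hb v (hAl v hv)).inv
    rw [e] at h1
    exact h1.unique h2
  have hB : CA B := by
    refine ⟨⟨?_, ?_⟩, hA.fin.image _, fun y => ?_⟩
    · rintro _ ⟨a, ha, rfl⟩; exact hb3 a (hAl a ha)
    · rintro _ ⟨u, hu, rfl⟩ _ ⟨v, hv, rfl⟩ h
      exact (hb u (hAl u hu)).dj (hb v (hAl v hv)) (hA.anti.dj u hu v hv fun e => h (e ▸ rfl))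
    · obtain ⟨a, ha, z, hz⟩ := hA.cover (f⁻¹ y)
      refine ⟨b a, ⟨a, ha, rfl⟩, z, ?_⟩
      have := hb a (hAl a ha) z
      rw [hz, hm_apply_inv_self] at this
      exact this.symm
  obtain ⟨m, y, gy⟩ := C.good_exists hA
  obtain ⟨m', z, gz⟩ := C.good_exists hB
  obtain rfl := C.good_n gy gz hinj.ncard_image.symm
  obtain ⟨-, hy, -, y2, -⟩ := C.good1 gy
  obtain ⟨-, hz, z1, -, -⟩ := C.good1 gz
  obtain ⟨σ, hσ, e⟩ := C.perm_gen (LL_ca m) (h := φ z * f * (φ y)⁻¹) (fun c hc => by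
    obtain ⟨a, ha, ma⟩ := y2 c hc
    obtain ⟨c', hc', mc⟩ := z1 (b a) ⟨a, ha, rfl⟩
    exact ⟨c', hc', (mc.mul (hb a (hAl a ha))).mul ma.inv⟩)
  refine ⟨z⁻¹ * σ * y, mul_mem (mul_mem (inv_mem hz) (C.SA_le (LL_ca m).anti hσ)) hy, ?_⟩
  rw [map_mul, map_mul, e, map_inv]; group

open Classical in
theorem sys_sub (φ : K →* Hm d) (σ : Hm d → K) (sec : ∀ s ∈ SE N, φ (σ s) = s)
    (rel : ∀ (l1 l2 : List (Hm d)), (∀ s ∈ l1, s ∈ SE N) → (∀ s ∈ l2, s ∈ SE N) →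
          l1.length ≤ d + 5 → l2.length ≤ d + 5 → l1.prod = l2.prod →
          (List.map σ l1).prod = (List.map σ l2).prod) :
    ∃ σ' : Hm d → Subgroup.closure (σ '' SE N),
      (∀ s ∈ SE N, (σ' s : K) = σ s) ∧
      Sys N (φ.comp (Subgroup.closure (σ '' SE N)).subtype) σ' := by
  let σ' : Hm d → Subgroup.closure (σ '' SE N) := fun s =>
    if h : s ∈ SE N then ⟨σ s, Subgroup.subset_closure ⟨s, h, rfl⟩⟩ else 1
  have hσ' : ∀ s ∈ SE N, (σ' s : K) = σ s := fun s hs => by simp [σ', hs]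
  have hprod : ∀ l : List (Hm d), (∀ s ∈ l, s ∈ SE N) →
      (((l.map σ').prod : Subgroup.closure (σ '' SE N)) : K) = (l.map σ).prod := by
    intro l hl
    induction l with
    | nil => simp
    | cons a l ih =>
      simp only [List.map_cons, List.prod_cons, Subgroup.coe_mul]
      rw [ih fun s hs => hl s (by simp [hs]), hσ' a (hl a (by simp))]
  refine ⟨σ', hσ', ⟨fun s hs => ?_, fun l1 l2 h1 h2 k1 k2 e => ?_, ?_⟩⟩
  · simp [hσ' s hs, sec s hs]
  · apply Subtype.ext
    rw [hprod l1 h1, hprod l2 h2]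
    exact rel l1 l2 h1 h2 k1 k2 e
  · have : σ' '' SE N = ((Subgroup.closure (σ '' SE N)).subtype) ⁻¹' (σ '' SE N) := by
      ext ⟨k, hk⟩
      constructor
      · rintro ⟨s, hs, e⟩
        exact ⟨s, hs, by rw [← hσ' s hs, e]; rfl⟩
      · rintro ⟨s, hs, e⟩
        exact ⟨s, hs, Subtype.ext (by rw [hσ' s hs, e]; rfl)⟩
    rw [this]
    exact Subgroup.closure_closure_coe_preimage

theorem vv_mem_closure (hN : Nuc N) {f : Hm d} (hf : VV f) : f ∈ Subgroup.closure (SE N) := by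
  obtain ⟨σ', h1, S⟩ := sys_sub (N := N) (MonoidHom.id (Hm d)) id (fun _ _ => rfl)
    (fun l1 l2 _ _ _ _ e => by simpa using e)
  obtain ⟨τ, x, C⟩ := sys_cor hN S
  obtain ⟨y, -, rfl⟩ := C.vv_range hf
  have := y.2
  simpa using this

end ThompsonSec

/-! ## The subgroup `EE` of elements that can be localised -/
section ESec
variable {d : ℕ}

theorem At.comp {h : Hm d} {α β α' β' : Wd d} {g g' : Hm d} (H : At h α β g) (H' : At g α' β' g') :
    At h (α ++ α') (β ++ β') g' := by
  intro x
  rw [wa_append, H, H', wa_append]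

theorem vv_swapH (α β : Wd d) : VV (swapH α β) := by
  by_cases h : Dj α β
  · refine ⟨α.length + β.length, fun w hw => ?_⟩
    have key : ∀ γ : Wd d, γ.length ≤ w.length → γ <+: w ∨ Dj w γ := by
      intro γ hγ
      by_cases h1 : γ <+: w
      · exact Or.inl h1
      · refine Or.inr ⟨fun h2 => h1 ?_, h1⟩
        rw [h2.eq_of_length_le hγ]
    rcases key α (by omega) with ⟨u, rfl⟩ | h1
    · exact ⟨_, (swapH_left h).append u⟩
    rcases key β (by omega) with ⟨u, rfl⟩ | h2
    · exact ⟨_, (swapH_right h).append u⟩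
    exact ⟨w, swapH_fix h1 h2⟩
  · refine ⟨0, fun w _ => ⟨w, ?_⟩⟩
    have : swapH α β = 1 := by rw [swapH, dif_neg h]
    rw [this]; exact mv_one w

theorem vv_atH {v : Hm d} (hv : VV v) (p : Wd d) : VV (atH v p) := by
  obtain ⟨n, hn⟩ := hv
  refine ⟨p.length + n, fun w hw => ?_⟩
  by_cases h1 : p <+: w
  · obtain ⟨u, rfl⟩ := h1
    obtain ⟨β, hβ⟩ := hn u (by simp at hw; omega)
    exact ⟨p ++ β, fun x => by rw [wa_append, atH_at, hβ, wa_append]⟩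
  · refine ⟨w, atH_fix v ⟨fun h2 => h1 ?_, h1⟩⟩
    rw [h2.eq_of_length_le (by omega)]

theorem vv_pm (π : Equiv.Perm (Fin (d + 2))) : VV (pm π : Hm d) :=
  vv_of_level 1 fun w hw => by
    obtain ⟨i, rfl⟩ := List.length_eq_one_iff.1 hw
    exact ⟨_, pm_mv π i⟩

theorem VV.deep {f : Hm d} (hf : VV f) :
    ∃ n, 3 ≤ n ∧ ∀ w : Wd d, w.length = n → ∃ β, 3 ≤ β.length ∧ Mv f w β := by
  obtain ⟨n, hn⟩ := hf
  refine ⟨n + 3, by omega, fun w hw => ?_⟩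
  obtain ⟨β, hβ⟩ := hn (w.take n) (by simp; omega)
  refine ⟨β ++ w.drop n, by simp; omega, ?_⟩
  have := hβ.append (w.drop n)
  rwa [List.take_append_drop] at this

theorem move2 {W : Subgroup (Hm d)} (hW : ∀ f : Hm d, VV f → f ∈ W) {p q p' q' : Wd d}
    (hp : 3 ≤ p.length) (hq : 3 ≤ q.length) (hp' : 3 ≤ p'.length) (hq' : 3 ≤ q'.length)
    (h : Dj p q) (h' : Dj p' q') : ∃ f ∈ W, Mv f p p' ∧ Mv f q q' := by
  obtain ⟨c, hc3, hc⟩ := pick_dj [p, q, p', q'] (by simp) (by simp; omega)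
  obtain ⟨e, he3, he⟩ := pick_dj [p, q, p', q', c] (by simp) (by simp; omega)
  simp only [List.mem_cons, List.not_mem_nil, or_false, forall_eq_or_imp, forall_eq] at hc he
  obtain ⟨c1, c2, c3, c4⟩ := hc
  obtain ⟨e1, e2, e3, e4, e5⟩ := he
  refine ⟨swapH e q' * (swapH c p' * (swapH q e * swapH p c)),
    mul_mem (hW _ (vv_swapH _ _)) (mul_mem (hW _ (vv_swapH _ _)) (mul_mem (hW _ (vv_swapH _ _))
      (hW _ (vv_swapH _ _)))), ?_, ?_⟩
  · exact (swapH_fix e3.symm h').mul ((swapH_left c3).mul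
      ((swapH_fix c2 e5.symm).mul (swapH_left c1.symm)))
  · exact (swapH_left e4).mul ((swapH_fix e5 e3).mul
      ((swapH_left e2.symm).mul (swapH_fix h.symm c2.symm)))

theorem move1 {W : Subgroup (Hm d)} (hW : ∀ f : Hm d, VV f → f ∈ W) {p p' : Wd d}
    (hp : 3 ≤ p.length) (hp' : 3 ≤ p'.length) : ∃ f ∈ W, Mv f p p' := by
  obtain ⟨c, hc3, hc⟩ := pick_dj [p, p'] (by simp) (by simp; omega)
  simp only [List.mem_cons, List.not_mem_nil, or_false, forall_eq_or_imp, forall_eq] at hc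
  obtain ⟨f, hf, h, -⟩ := move2 hW hp (hc3.ge) hp' hc3.ge hc.1.symm hc.2.symm
  exact ⟨f, hf, h⟩

structure Ctx (G : Subgroup (Hm d)) (N : Set (Hm d)) : Prop where
  sec : ∀ g ∈ G, ∃ (π : Equiv.Perm (Fin (d + 2))) (s : Fin (d + 2) → Hm d),
    (∀ i, s i ∈ G) ∧ ∀ i, At g [i] [π i] (s i)
  fin : N.Finite
  one : 1 ∈ N
  inv : ∀ g ∈ N, g⁻¹ ∈ N
  sub : ∀ g ∈ N, g ∈ G
  nsec : ∀ g ∈ N, ∀ i j s, At g [i] [j] s → s ∈ N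
  contr : ∀ g ∈ G, ∃ n, ∀ α β k, n ≤ α.length → At g α β k → k ∈ N

def HG (G : Subgroup (Hm d)) : Subgroup (Hm d) :=
  Subgroup.closure ((G : Set (Hm d)) ∪ {h | InThompsonV h})

theorem G_le_HG {G : Subgroup (Hm d)} {g : Hm d} (h : g ∈ G) : g ∈ HG G :=
  Subgroup.subset_closure (Or.inl h)
theorem V_le_HG (G : Subgroup (Hm d)) (f : Hm d) (h : VV f) : f ∈ HG G :=
  Subgroup.subset_closure (Or.inr (thompson_iff.2 h))

/-- product of localised homeomorphisms -/
noncomputable def lX (f : Wd d → Hm d) (l : List (Wd d)) (p : Wd d) : Hm d :=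
  (l.map fun w => atH (f w) (p ++ w)).prod

theorem lX_at (f : Wd d → Hm d) (p : Wd d) {l : List (Wd d)} (hl : l.Nodup) {n : ℕ}
    (hn : ∀ w ∈ l, w.length = n) {w : Wd d} (hw : w ∈ l) :
    At (lX f l p) (p ++ w) (p ++ w) (f w) := by
  intro x
  unfold lX
  rw [list_single (fun w => atH (f w) (p ++ w)) l hl _ w hw, atH_at]
  intro v hv hvw
  rw [atH_at]
  have : Dj (p ++ w) (p ++ v) :=
    dj_append_left.2 (dj_of_len ((hn w hw).trans (hn v hv).symm) (Ne.symm hvw))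
  exact ⟨atH_fix _ this _, atH_fix _ this _⟩

theorem lX_fix (f : Wd d → Hm d) (p : Wd d) {l : List (Wd d)} {r : Wd d}
    (h : ∀ w ∈ l, Dj r (p ++ w)) : Mv (lX f l p) r r := fun x =>
  list_fix _ _ _ fun w hw => atH_fix _ (h w hw) x

theorem lX_comm (f : Wd d → Hm d) (p : Wd d) {l : List (Wd d)} {r : Wd d} (e : Hm d)
    (h : ∀ w ∈ l, Dj r (p ++ w)) : Commute (atH e r) (lX f l p) := by
  unfold lX
  induction l with
  | nil => simp
  | cons a l ih =>
    rw [List.map_cons, List.prod_cons]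
    exact Commute.mul_right (atH_comm (h a (by simp)) _ _) (ih fun w hw => h w (by simp [hw]))

theorem lX_cons (f : Wd d → Hm d) (p w : Wd d) (l : List (Wd d)) :
    lX f (w :: l) p = atH (f w) (p ++ w) * lX f l p := rfl

noncomputable def lev (d n : ℕ) : List (Wd d) :=
  (List.finite_length_eq (Fin (d + 2)) n).toFinset.toList

theorem lev_nodup (n : ℕ) : (lev d n).Nodup := Finset.nodup_toList _
theorem mem_lev {n : ℕ} {w : Wd d} : w ∈ lev d n ↔ w.length = n := by
  simp [lev]

variable {G : Subgroup (Hm d)} {N : Set (Hm d)}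

theorem Ctx.secAll (X : Ctx G N) (α : Wd d) : ∀ g ∈ G, ∃ β k, β.length = α.length ∧ k ∈ G ∧
    At g α β k := by
  induction α with
  | nil => exact fun g hg => ⟨[], g, rfl, hg, fun x => by rw [wa_nil, wa_nil]⟩
  | cons i α ih =>
    intro g hg
    obtain ⟨π, s, hs, h⟩ := X.sec g hg
    obtain ⟨β, k, h1, h2, h3⟩ := ih (s i) (hs i)
    exact ⟨[π i] ++ β, k, by simp [h1], h2, (h i).comp h3⟩

/-- `a` can be moved around -/
def P2 (G : Subgroup (Hm d)) (a : Hm d) : Prop :=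
  a ∈ G ∧ ∀ p q : Wd d, 3 ≤ p.length → 3 ≤ q.length → atH a p * (atH a q)⁻¹ ∈ HG G

theorem E1 {h g1 g2 : Hm d} {p p' q q' : Wd d} (hh : h ∈ HG G) (h1 : At h p p' g1)
    (h2 : At h q q' g2) (hd : Dj p q) (hp : 3 ≤ p'.length) (hq : 3 ≤ q'.length)
    (k1 : g1 ∈ G) (k2 : g2 ∈ G) : P2 G (g1 * g2⁻¹) := by
  have hd' := h1.dj h2 hd
  have e : h * swapH p q * h⁻¹ * swapH p' q' = atH (g1 * g2⁻¹) p' * (atH (g1 * g2⁻¹) q')⁻¹ := by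
    rw [← atH_inv]
    refine hm_ext fun y => ?_
    by_cases c1 : y ∈ cone p'
    · obtain ⟨z, rfl⟩ := c1
      simp only [hm_mul_apply]
      rw [swapH_left hd' z, h2.inv z, swapH_right hd, h1, atH_fix _ hd' z, atH_at]
      simp only [hm_mul_apply]
    by_cases c2 : y ∈ cone q'
    · obtain ⟨z, rfl⟩ := c2
      simp only [hm_mul_apply]
      rw [swapH_right hd' z, h1.inv z, swapH_left hd, h2, atH_at, atH_fix _ hd'.symm]
      simp only [mul_inv_rev, inv_inv, hm_mul_apply]
    · simp only [hm_mul_apply]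
      rw [swapH_other c1 c2, atH_out _ c2, atH_out _ c1, swapH_other, hm_apply_inv_self]
      · exact h1.inv.not_mem c1
      · exact h2.inv.not_mem c2
  have e2 : atH (g1 * g2⁻¹) p' * (atH (g1 * g2⁻¹) q')⁻¹ ∈ HG G := by
    rw [← e]
    exact mul_mem (mul_mem (mul_mem hh (V_le_HG G _ (vv_swapH _ _))) (inv_mem hh))
      (V_le_HG G _ (vv_swapH _ _))
  generalize hag : g1 * g2⁻¹ = a at *
  have aG : a ∈ G := hag ▸ mul_mem k1 (inv_mem k2)
  have key : ∀ r s : Wd d, 3 ≤ r.length → 3 ≤ s.length → Dj r s →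
      atH a r * (atH a s)⁻¹ ∈ HG G := by
    intro r s hr hs hrs
    obtain ⟨f, hf, m1, m2⟩ := move2 (V_le_HG G) hp hq hr hs hd' hrs
    have : atH a r * (atH a s)⁻¹ = f * (atH a p' * (atH a q')⁻¹) * f⁻¹ := by
      rw [← at_conj_mv m1, ← at_conj_mv m2]; group
    rw [this]
    exact mul_mem (mul_mem hf e2) (inv_mem hf)
  refine ⟨aG, fun r s hr hs => ?_⟩
  obtain ⟨c, hc3, hc⟩ := pick_dj [r, s] (by simp) (by simp; omega)
  simp only [List.mem_cons, List.not_mem_nil, or_false, forall_eq_or_imp, forall_eq] at hc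
  have := mul_mem (key r c hr hc3.ge hc.1.symm) (key c s hc3.ge hs hc.2)
  simpa [mul_assoc] using this

theorem P2_sec {a s : Hm d} {u u' : Wd d} (ha : P2 G a) (h : At a u u' s) (hs : s ∈ G) :
    P2 G s := by
  obtain ⟨p, hp3, -⟩ := pick_dj (d := d) [] (by simp) (by simp)
  obtain ⟨q, hq3, hq⟩ := pick_dj [p] (by simp) (by simp; omega)
  obtain ⟨r, hr3, hr⟩ := pick_dj [p, q] (by simp) (by simp; omega)
  simp only [List.mem_cons, List.not_mem_nil, or_false, forall_eq_or_imp, forall_eq] at hq hr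
  have h1 : At (atH a p * (atH a q)⁻¹) (p ++ u) (p ++ u') s := by
    have h0 : At (atH a p * (atH a q)⁻¹) p p a := by
      have := (atH_at a p).mul (mv_iff_at.1 ((atH_fix a hq.symm).inv))
      simpa using this
    exact h0.comp h
  have h2 : At (atH a p * (atH a q)⁻¹) r r 1 :=
    mv_iff_at.1 ((atH_fix a hr.1).mul ((atH_fix a hr.2).inv))
  have := E1 (ha.2 p q hp3.ge hq3.ge) h1 h2 (hr.1.symm.left u) (by simp; omega) hr3.ge hs (one_mem G)
  simpa using this

theorem vv_of_quot {h X : Hm d} {n : ℕ} (H : ∀ w : Wd d, w.length = n → ∃ β e,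
    At h w β e ∧ At X w w e) : VV (h * X⁻¹) := by
  refine vv_of_level n fun w hw => ?_
  obtain ⟨β, e, h1, h2⟩ := H w hw
  refine ⟨β, mv_iff_at.2 ?_⟩
  have := h1.mul h2.inv
  simpa using this

def EE (G : Subgroup (Hm d)) : Subgroup (Hm d) where
  carrier := {a | a ∈ G ∧ ∀ p : Wd d, 3 ≤ p.length → atH a p ∈ HG G}
  mul_mem' := fun ha hb => ⟨mul_mem ha.1 hb.1, fun p hp => by
    rw [atH_mul]; exact mul_mem (ha.2 p hp) (hb.2 p hp)⟩
  one_mem' := ⟨one_mem _, fun p _ => by rw [atH_one]; exact one_mem _⟩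
  inv_mem' := fun ha => ⟨inv_mem ha.1, fun p hp => by rw [atH_inv]; exact inv_mem (ha.2 p hp)⟩

theorem mem_EE {a : Hm d} : a ∈ EE G ↔ a ∈ G ∧ ∀ p : Wd d, 3 ≤ p.length → atH a p ∈ HG G := Iff.rfl

theorem EE_one {a : Hm d} (ha : a ∈ G) {p : Wd d} (hp : 3 ≤ p.length) (h : atH a p ∈ HG G) :
    a ∈ EE G := by
  refine ⟨ha, fun q hq => ?_⟩
  obtain ⟨f, hf, m⟩ := move1 (V_le_HG G) hp hq
  rw [← at_conj_mv m]
  exact mul_mem (mul_mem hf h) (inv_mem hf)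

theorem lX_step {f : Wd d → Hm d} {p w : Wd d} {l : List (Wd d)} (hf : P2 G (f w))
    (hp3 : p.length = 3) (hw : w.length = 3) (hl : ∀ v ∈ l, v.length = 3) (hpl : p ∉ l)
    (hwl : w ∉ l) (h : lX f l [] * (lX f l p)⁻¹ ∈ HG G) :
    lX f (w :: l) [] * (lX f (w :: l) p)⁻¹ ∈ HG G := by
  have c1 : Commute (atH (f w) (p ++ w)) (lX f l []) := by
    refine lX_comm f [] (f w) fun v hv => Dj.left (dj_of_len (by simp [hp3, hl v hv]) ?_) w
    rintro rfl; exact hpl (by simpa using hv)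
  have c2 : Commute (atH (f w) (p ++ w)) (lX f l p) := by
    refine lX_comm f p (f w) fun v hv => dj_append_left.2 (dj_of_len (by rw [hw, hl v hv]) ?_)
    rintro rfl; exact hwl hv
  have c3 : Commute (atH (f w) (p ++ w))⁻¹ (lX f l [] * (lX f l p)⁻¹) :=
    ((c1.mul_right c2.inv_right)).inv_left
  have : lX f (w :: l) [] * (lX f (w :: l) p)⁻¹ =
      (atH (f w) w * (atH (f w) (p ++ w))⁻¹) * (lX f l [] * (lX f l p)⁻¹) := by
    rw [lX_cons, lX_cons, mul_assoc (atH (f w) w), c3.eq]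
    simp only [List.nil_append]; group
  rw [this]
  exact mul_mem (hf.2 _ _ hw.ge (by simp; omega)) h

theorem Ctx.P2_EE (X : Ctx G N) {a : Hm d} (ha : P2 G a) : a ∈ EE G := by
  choose b f h1 h2 h3 using fun w => X.secAll w a ha.1
  obtain ⟨p, hp3, -⟩ := pick_dj (d := d) [] (by simp) (by simp)
  have hP : ∀ w, P2 G (f w) := fun w => P2_sec ha (h3 w) (h2 w)
  have key : ∀ l : List (Wd d), l.Nodup → (∀ v ∈ l, v.length = 3) → p ∉ l →
      lX f l [] * (lX f l p)⁻¹ ∈ HG G := by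
    intro l
    induction l with
    | nil => intro _ _ _; simpa [lX] using one_mem (HG G)
    | cons w l ih =>
      intro hn hl hp
      rw [List.nodup_cons] at hn
      have hp' : p ∉ l := fun h => hp (by simp [h])
      have hl' : ∀ v ∈ l, v.length = 3 := fun v hv => hl v (by simp [hv])
      exact lX_step (hP w) hp3 (hl w (by simp)) hl' hp' hn.1 (ih hn.2 hl' hp')
  classical
  set l0 := (lev d 3).erase p with hl0
  have hp0 : p ∉ l0 := (lev_nodup 3).not_mem_erase
  have hlen0 : ∀ v ∈ l0, v.length = 3 := fun v hv => mem_lev.1 (List.mem_of_mem_erase hv)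
  have hnd0 : l0.Nodup := (lev_nodup 3).erase p
  have hfin := lX_step (hP p) hp3 hp3 hlen0 hp0 hp0 (key l0 hnd0 hlen0 hp0)
  set l := p :: l0 with hl
  have hnd : l.Nodup := List.nodup_cons.2 ⟨hp0, hnd0⟩
  have hlen : ∀ v ∈ l, v.length = 3 := by
    intro v hv
    rcases List.mem_cons.1 hv with rfl | hv
    · exact hp3
    · exact hlen0 v hv
  have hmem : ∀ w : Wd d, w.length = 3 → w ∈ l := by
    intro w hw
    by_cases e : w = p
    · simp [hl, e]
    · exact List.mem_cons_of_mem _ ((List.mem_erase_of_ne e).2 (mem_lev.2 hw))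
  have m1 : lX f l [] ∈ HG G := by
    have := V_le_HG G _ (vv_of_quot (h := a) (X := lX f l []) (n := 3) fun w hw =>
      ⟨b w, f w, h3 w, by simpa using lX_at f [] hnd hlen (hmem w hw)⟩)
    have h := mul_mem (inv_mem this) (G_le_HG ha.1)
    simpa using h
  have m2 : lX f l p ∈ HG G := by
    have h := mul_mem (inv_mem hfin) m1
    simpa using h
  have m3 : VV (atH a p * (lX f l p)⁻¹) := by
    refine vv_of_quot (n := 6) fun w hw => ?_
    by_cases hpw : p <+: w
    · obtain ⟨u, rfl⟩ := hpw
      have hu : u.length = 3 := by simp at hw; omega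
      exact ⟨p ++ b u, f u, (atH_at a p).comp (h3 u), lX_at f p hnd hlen (hmem u hu)⟩
    · have hdj : Dj w p := ⟨fun h2 => hpw (by rw [h2.eq_of_length_le (by omega)]), hpw⟩
      exact ⟨w, 1, mv_iff_at.1 (atH_fix a hdj), mv_iff_at.1 (lX_fix f p fun v _ => hdj.right v)⟩
  refine EE_one ha.1 hp3.ge ?_
  have h := mul_mem (V_le_HG G _ m3) m2
  simpa using h

theorem Ctx.EE_sec (X : Ctx G N) {e s : Hm d} {u u' : Wd d} (he : e ∈ EE G) (h : At e u u' s)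
    (hs : s ∈ G) : s ∈ EE G :=
  X.P2_EE (P2_sec ⟨he.1, fun p q hp hq => mul_mem (he.2 p hp) (inv_mem (he.2 q hq))⟩ h hs)

theorem Ctx.secdiff (X : Ctx G N) {g k1 k2 : Hm d} {u u' v v' : Wd d} (hg : g ∈ G)
    (h1 : At g u u' k1) (h2 : At g v v' k2) (hu : 3 ≤ u.length) (hu' : 3 ≤ u'.length)
    (hv : 3 ≤ v.length) (hv' : 3 ≤ v'.length) (g1 : k1 ∈ G) (g2 : k2 ∈ G) :
    k2 * k1⁻¹ ∈ EE G := by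
  obtain ⟨r, hr3, hr⟩ := pick_dj [u, v] (by simp) (by simp; omega)
  simp only [List.mem_cons, List.not_mem_nil, or_false, forall_eq_or_imp, forall_eq] at hr
  obtain ⟨r', k, hl, hk, h3⟩ := X.secAll r g hg
  have a1 := X.P2_EE (E1 (G_le_HG hg) h1 h3 hr.1.symm hu' (by omega) g1 hk)
  have a2 := X.P2_EE (E1 (G_le_HG hg) h2 h3 hr.2.symm hv' (by omega) g2 hk)
  have := mul_mem a2 (inv_mem a1)
  simpa using this

def NE (G : Subgroup (Hm d)) (N : Set (Hm d)) : Set (Hm d) := N ∩ EE G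

theorem Ctx.contrE (X : Ctx G N) (n : ℕ) : ∀ g ∈ EE G,
    (∀ α β k, n ≤ α.length → At g α β k → k ∈ N) → Contr (NE G N) g := by
  induction n with
  | zero =>
    intro g hg h
    exact Contr.mem g ⟨h [] [] g (by simp) fun x => by rw [wa_nil, wa_nil], hg⟩
  | succ n ih =>
    intro g hg h
    obtain ⟨π, s, hs, hat⟩ := X.sec g hg.1
    refine Contr.node g π s hat fun i => ih (s i) (X.EE_sec hg (hat i) (hs i)) ?_
    intro α β k hα hk
    exact h _ _ k (by simp; omega) ((hat i).comp hk)

theorem Ctx.contrE' (X : Ctx G N) {g : Hm d} (hg : g ∈ EE G) : Contr (NE G N) g := by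
  obtain ⟨n, hn⟩ := X.contr g hg.1
  exact X.contrE n g hg hn

theorem Ctx.nuc (X : Ctx G N) : Nuc (NE G N) := by
  refine ⟨⟨X.one, one_mem _⟩, fun g hg => ⟨X.inv g hg.1, inv_mem hg.2⟩, fun g hg => ?_,
    fun g hg h hh => X.contrE' (mul_mem hg.2 hh.2)⟩
  obtain ⟨π, s, hs, hat⟩ := X.sec g hg.2.1
  exact ⟨π, s, fun i => ⟨X.nsec g hg.1 i _ _ (hat i), X.EE_sec hg.2 (hat i) (hs i)⟩, hat⟩

def HE (G : Subgroup (Hm d)) (N : Set (Hm d)) : Subgroup (Hm d) := Subgroup.closure (SE (NE G N))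

theorem HE_le : HE G N ≤ HG G := by
  refine (Subgroup.closure_le _).2 ?_
  rintro h ((⟨α, β, -, -, -, -, -, rfl⟩ | ⟨g, hg, α, h3, -, rfl⟩) | ⟨b, π, -, rfl⟩)
  · exact V_le_HG G _ (vv_swapH _ _)
  · exact hg.2.2 α h3
  · exact V_le_HG G _ (vv_atH (vv_pm π) b)

theorem Ctx.V_le_HE (X : Ctx G N) (f : Hm d) (h : VV f) : f ∈ HE G N := vv_mem_closure X.nuc h

theorem Ctx.at_mem (X : Ctx G N) {e : Hm d} (he : e ∈ EE G) :
    ∀ p : Wd d, 3 ≤ p.length → atH e p ∈ HE G N := by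
  have := X.contrE' he
  clear he
  induction this with
  | mem g hg =>
    intro p hp
    obtain ⟨q, hq3, -⟩ := pick_dj (d := d) [] (by simp) (by simp)
    obtain ⟨f, hf, m⟩ := move1 X.V_le_HE hq3.ge hp
    rw [← at_conj_mv m]
    refine mul_mem (mul_mem hf (Subgroup.subset_closure ?_)) (inv_mem hf)
    exact Or.inl (Or.inr ⟨g, hg, q, hq3.ge, by omega, rfl⟩)
  | node g π s hat _ ih =>
    intro p hp
    rw [atH_split hat p]
    exact mul_mem (X.V_le_HE _ (vv_atH (vv_pm π) p)) (pr_mem fun i => ih i _ (by simp; omega))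

theorem Ctx.T (X : Ctx G N) {h : Hm d} {n : ℕ} (hn : 3 ≤ n)
    (H : ∀ w : Wd d, w.length = n → ∃ β e, e ∈ EE G ∧ At h w β e) : h ∈ HE G N := by
  choose! b f h1 h2 using H
  have hX : lX f (lev d n) [] ∈ HE G N := by
    refine Subgroup.list_prod_mem _ fun y hy => ?_
    obtain ⟨w, hw, rfl⟩ := List.mem_map.1 hy
    have := mem_lev.1 hw
    exact X.at_mem (h1 w this) _ (by simp; omega)
  have := X.V_le_HE _ (vv_of_quot (h := h) (X := lX f (lev d n) []) (n := n) fun w hw =>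
      ⟨b w, f w, h2 w hw, by
        simpa using lX_at f [] (lev_nodup n) (fun w hw => mem_lev.1 hw) (mem_lev.2 hw)⟩)
  have h := mul_mem this hX
  simpa using h

theorem Ctx.conjV (X : Ctx G N) {g v : Hm d} (hg : g ∈ G) (hv : VV v) :
    g * v * g⁻¹ ∈ HE G N := by
  obtain ⟨n, hn3, hn⟩ := hv.deep
  refine X.T hn3 fun w hw => ?_
  obtain ⟨u, k, hl, hk, hat⟩ := X.secAll w g⁻¹ (inv_mem hg)
  obtain ⟨β, hβ3, hβ⟩ := hn u (by omega)
  obtain ⟨β', k', hl', hk', hat'⟩ := X.secAll β g hg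
  have h1 : At g u w k⁻¹ := by simpa using hat.inv
  refine ⟨β', k' * k, ?_, ?_⟩
  · have := X.secdiff hg h1 hat' (by omega) (by omega) hβ3 (by omega) (inv_mem hk) hk'
    simpa using this
  · have := (hat'.mul (mv_iff_at.1 hβ)).mul hat
    simpa using this

theorem Ctx.conjG (X : Ctx G N) {g : Hm d} (hg : g ∈ G) {y : Hm d} (hy : y ∈ HE G N) :
    g * y * g⁻¹ ∈ HE G N := by
  have key : (HE G N) ≤ (HE G N).comap (MulAut.conj g).toMonoidHom := by
    refine (Subgroup.closure_le _).2 ?_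
    rintro h ((⟨α, β, -, -, -, -, -, rfl⟩ | ⟨e, he, p, h3, -, rfl⟩) | ⟨b, π, -, rfl⟩)
    · exact X.conjV hg (vv_swapH _ _)
    · obtain ⟨p', k, hl, hk, hat⟩ := X.secAll p g hg
      have h1 := at_conj hat e
      have h2 : g * atH e p * g⁻¹ ∈ HG G :=
        mul_mem (mul_mem (G_le_HG hg) (he.2.2 p h3)) (inv_mem (G_le_HG hg))
      rw [h1] at h2
      have h4 := EE_one (mul_mem (mul_mem hk he.2.1) (inv_mem hk)) (by omega) h2
      change g * atH e p * g⁻¹ ∈ HE G N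
      rw [h1]
      exact X.at_mem h4 _ (by omega)
    · exact X.conjV hg (vv_atH (vv_pm π) b)
  exact key hy

theorem Ctx.same (X : Ctx G N) {g g' k : Hm d} {q q1 q2 : Wd d} (hg : g ∈ G) (hg' : g' ∈ G)
    (hq1 : 3 ≤ q1.length) (hq2 : 3 ≤ q2.length) (h1 : At g q q1 k) (h2 : At g' q q2 k) :
    g'⁻¹ * g ∈ HE G N := by
  have hf : g * g'⁻¹ ∈ G := mul_mem hg (inv_mem hg')
  have hat : At (g * g'⁻¹) q2 q1 1 := by simpa using h1.mul h2.inv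
  have hm : g * g'⁻¹ ∈ HE G N := by
    refine X.T hq2 fun w hw => ?_
    obtain ⟨β, k', hl, hk', hat'⟩ := X.secAll w _ hf
    refine ⟨β, k', ?_, hat'⟩
    have := X.secdiff hf hat hat' hq2 hq1 (by omega) (by omega) (one_mem G) hk'
    simpa using this
  have := X.conjG (inv_mem hg') hm
  simpa [mul_assoc] using this

theorem Ctx.reps (X : Ctx G N) : ∃ R : Set (Hm d), R.Finite ∧ (∀ r ∈ R, r ∈ G) ∧
    ∀ g ∈ G, ∃ r ∈ R, r⁻¹ * g ∈ HE G N := by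
  have hfin : Finite (G ⧸ (HE G N).subgroupOf G) := by
    by_contra hinf
    rw [not_finite_iff_infinite] at hinf
    obtain ⟨s, hs⟩ := Infinite.exists_subset_card_eq (G ⧸ (HE G N).subgroupOf G) (N.ncard + 1)
    choose n hn using fun c : G ⧸ (HE G N).subgroupOf G => X.contr c.out.1 c.out.2
    let m := s.sup n + 3
    let w : Wd d := List.replicate m 0
    choose b k hb hk hat using fun c : G ⧸ (HE G N).subgroupOf G => X.secAll w c.out.1 c.out.2
    have hwl : w.length = m := by simp [w]
    obtain ⟨c, hc, c', hc', hne, he⟩ := Finset.exists_ne_map_eq_of_card_lt_of_maps_to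
      (s := s) (t := X.fin.toFinset) (by rw [hs, Set.ncard_eq_toFinset_card N X.fin]; omega)
      (f := k) (fun c hc => by
        have : n c ≤ s.sup n := Finset.le_sup hc
        simpa using hn c w (b c) (k c) (by omega) (hat c))
    apply hne
    have h2 := hat c'
    rw [← he] at h2
    have := X.same c.out.2 c'.out.2 (by rw [hb]; omega) (by rw [hb]; omega) (hat c) h2
    rw [← c.out_eq', ← c'.out_eq']
    refine (QuotientGroup.eq.2 ?_).symm
    exact Subgroup.mem_subgroupOf.2 this
  refine ⟨Set.range fun c : G ⧸ (HE G N).subgroupOf G => (c.out : Hm d), Set.finite_range _, ?_, ?_⟩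
  · rintro _ ⟨c, rfl⟩; exact c.out.2
  · intro g hg
    refine ⟨_, ⟨QuotientGroup.mk ⟨g, hg⟩, rfl⟩, ?_⟩
    have := QuotientGroup.eq.1 (QuotientGroup.mk (s := (HE G N).subgroupOf G) (⟨g, hg⟩ : G)).out_eq'
    exact Subgroup.mem_subgroupOf.1 this

theorem Ctx.HG_decomp (X : Ctx G N) {h : Hm d} (hh : h ∈ HG G) :
    ∃ g ∈ G, g⁻¹ * h ∈ HE G N := by
  induction hh using Subgroup.closure_induction with
  | mem x hx =>
    rcases hx with hx | hx
    · exact ⟨x, hx, by simp⟩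
    · exact ⟨1, one_mem _, by simpa using X.V_le_HE x (thompson_iff.1 hx)⟩
  | one => exact ⟨1, one_mem _, by simp⟩
  | mul x y _ _ hx hy =>
    obtain ⟨g, hg, h1⟩ := hx
    obtain ⟨g', hg', h2⟩ := hy
    refine ⟨g * g', mul_mem hg hg', ?_⟩
    have := mul_mem (X.conjG (inv_mem hg') h1) h2
    simpa [mul_assoc] using this
  | inv x _ hx =>
    obtain ⟨g, hg, h1⟩ := hx
    refine ⟨g⁻¹, inv_mem hg, ?_⟩
    have := X.conjG hg (inv_mem h1)
    simpa [mul_assoc] using this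

theorem Ctx.conjHG (X : Ctx G N) {h y : Hm d} (hh : h ∈ HG G) (hy : y ∈ HE G N) :
    h * y * h⁻¹ ∈ HE G N := by
  obtain ⟨g, hg, h1⟩ := X.HG_decomp hh
  have := X.conjG hg (mul_mem (mul_mem h1 hy) (inv_mem h1))
  simpa [mul_assoc] using this

end ESec

/-! ## Finite presentations -/
section FPSec

theorem presK {H : Type} [Group H] (S : Set H) (hS : S.Finite) (M : ℕ) :
    ∃ (K : Type) (_ : Group K) (φ : K →* H) (σ : H → K), (∀ s ∈ S, φ (σ s) = s) ∧
      (∀ l1 l2 : List H, (∀ s ∈ l1, s ∈ S) → (∀ s ∈ l2, s ∈ S) → l1.length ≤ M → l2.length ≤ M →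
        l1.prod = l2.prod → (l1.map σ).prod = (l2.map σ).prod) ∧
      Subgroup.closure (σ '' S) = ⊤ ∧
      (Function.Injective φ → IsFinitelyPresented (Subgroup.closure S)) := by
  classical
  have : Fintype S := hS.fintype
  let n := Fintype.card S
  let e : S ≃ Fin n := Fintype.equivFin S
  let ρ : H → FreeGroup (Fin n) := fun s => if h : s ∈ S then FreeGroup.of (e ⟨s, h⟩) else 1
  let L : Set (List H) := {l | (∀ s ∈ l, s ∈ S) ∧ l.length ≤ M}
  have hL : L.Finite := by
    refine ((List.finite_length_le S M).image (List.map Subtype.val)).subset ?_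
    rintro l ⟨h1, h2⟩
    refine ⟨l.attach.map fun s => ⟨s.1, h1 s.1 s.2⟩, by simpa using h2, ?_⟩
    simp [Function.comp_def]
  let R0 : Set (FreeGroup (Fin n)) := (fun p : List H × List H => (p.1.map ρ).prod * ((p.2.map ρ).prod)⁻¹) ''
    {p ∈ L ×ˢ L | p.1.prod = p.2.prod}
  have hR0 : R0.Finite := ((hL.prod hL).subset (Set.sep_subset _ _)).image _
  let R : Finset (FreeGroup (Fin n)) := hR0.toFinset
  let φ0 : FreeGroup (Fin n) →* H := FreeGroup.lift fun i => (e.symm i : H)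
  have hφ0 : ∀ s ∈ S, φ0 (ρ s) = s := by
    intro s hs
    simp [φ0, ρ, hs]
  have hφl : ∀ l : List H, (∀ s ∈ l, s ∈ S) → φ0 (l.map ρ).prod = l.prod := by
    intro l hl
    induction l with
    | nil => simp
    | cons a l ih =>
      rw [List.map_cons, List.prod_cons, map_mul, ih fun s hs => hl s (by simp [hs]),
        hφ0 a (hl a (by simp)), List.prod_cons]
  have hker : Subgroup.normalClosure (R : Set (FreeGroup (Fin n))) ≤ φ0.ker := by
    refine Subgroup.normalClosure_le_normal ?_
    intro r hr
    have hr' : r ∈ R0 := by simpa [R] using hr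
    obtain ⟨⟨l1, l2⟩, ⟨⟨h1, h2⟩, h3⟩, rfl⟩ := hr'
    change φ0 _ = 1
    simp only at h3
    simp only [map_mul, map_inv]
    rw [hφl l1 h1.1, hφl l2 h2.1, h3, mul_inv_cancel]
  let q : FreeGroup (Fin n) →* FreeGroup (Fin n) ⧸ Subgroup.normalClosure (R : Set (FreeGroup (Fin n))) := QuotientGroup.mk' _
  let φ : FreeGroup (Fin n) ⧸ Subgroup.normalClosure (R : Set (FreeGroup (Fin n))) →* H := QuotientGroup.lift _ φ0 hker
  have hφq : ∀ f, φ (q f) = φ0 f := fun f => rfl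
  have hgen : Subgroup.closure ((fun s => q (ρ s)) '' S) = ⊤ := by
    rw [eq_top_iff]
    rintro k -
    obtain ⟨f, rfl⟩ := QuotientGroup.mk'_surjective _ k
    refine FreeGroup.induction_on f ?_ ?_ ?_ ?_
    · exact one_mem _
    · intro i
      refine Subgroup.subset_closure ⟨e.symm i, (e.symm i).2, ?_⟩
      simp [ρ, q]
    · intro i h
      rw [map_inv]; exact inv_mem h
    · intro x y hx hy
      rw [map_mul]; exact mul_mem hx hy
  refine ⟨FreeGroup (Fin n) ⧸ Subgroup.normalClosure (R : Set (FreeGroup (Fin n))), inferInstance, φ, fun s => q (ρ s),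
    fun s hs => by rw [hφq, hφ0 s hs], ?_, hgen, ?_⟩
  · intro l1 l2 h1 h2 k1 k2 he
    have c : ∀ l : List H, (l.map fun s => q (ρ s)).prod = q (l.map ρ).prod := by
      intro l
      rw [map_list_prod, List.map_map]; rfl
    rw [c, c, ← mul_inv_eq_one, ← map_inv, ← map_mul]
    refine (QuotientGroup.eq_one_iff _).2 (Subgroup.subset_normalClosure ?_)
    have : (l1.map ρ).prod * ((l2.map ρ).prod)⁻¹ ∈ R0 :=
      ⟨(l1, l2), ⟨⟨⟨h1, k1⟩, ⟨h2, k2⟩⟩, he⟩, rfl⟩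
    simpa [R] using this
  · intro hinj
    have hr : φ.range = Subgroup.closure S := by
      rw [MonoidHom.range_eq_map, ← hgen, MonoidHom.map_closure, ← Set.image_comp]
      congr 1
      ext s
      constructor
      · rintro ⟨t, ht, rfl⟩
        simpa [hφq, hφ0 t ht] using ht
      · intro hs
        exact ⟨s, hs, by simp [hφq, hφ0 s hs]⟩
    refine ⟨n, R, ⟨?_⟩⟩
    exact (MulEquiv.subgroupCongr hr.symm).trans (MonoidHom.ofInjective hinj).symm

variable {d : ℕ}

theorem SE_finite {N : Set (Hm d)} (hN : N.Finite) : (SE N).Finite := by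
  have hW : {w : Wd d | w.length ≤ 4}.Finite := List.finite_length_le _ 4
  refine Set.Finite.union (Set.Finite.union ?_ ?_) ?_
  · refine ((hW.prod hW).image fun p : Wd d × Wd d => swapH p.1 p.2).subset ?_
    rintro _ ⟨α, β, -, h1, -, h2, -, rfl⟩
    exact ⟨(α, β), ⟨h1, h2⟩, rfl⟩
  · refine ((hN.prod hW).image fun p : Hm d × Wd d => atH p.1 p.2).subset ?_
    rintro _ ⟨g, hg, α, -, h1, rfl⟩
    exact ⟨(g, α), ⟨hg, h1⟩, rfl⟩
  · refine ((hW.prod (Set.finite_univ (α := Equiv.Perm (Fin (d + 2))))).image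
      fun p : Wd d × Equiv.Perm (Fin (d + 2)) => atH (pm p.2) p.1).subset ?_
    rintro _ ⟨b, π, hb, rfl⟩
    refine ⟨(b, π), ⟨?_, trivial⟩, rfl⟩
    change b.length ≤ 4
    omega

theorem SE_inv {N : Set (Hm d)} (hN : Nuc N) {s : Hm d} (hs : s ∈ SE N) : s⁻¹ ∈ SE N := by
  rcases hs with (⟨α, β, h1, h2, h3, h4, h5, rfl⟩ | ⟨g, hg, α, h1, h2, rfl⟩) | ⟨b, π, hb, rfl⟩
  · rw [swapH_inv]; exact Or.inl (Or.inl ⟨α, β, h1, h2, h3, h4, h5, rfl⟩)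
  · rw [← atH_inv]; exact Or.inl (Or.inr ⟨g⁻¹, hN.inv g hg, α, h1, h2, rfl⟩)
  · rw [← atH_inv, ← map_inv]; exact Or.inr ⟨b, π⁻¹, hb, rfl⟩

theorem closure_list {H : Type*} [Group H] {S : Set H} (hS : ∀ s ∈ S, s⁻¹ ∈ S) {h : H}
    (hh : h ∈ Subgroup.closure S) : ∃ l : List H, (∀ s ∈ l, s ∈ S) ∧ l.prod = h := by
  induction hh using Subgroup.closure_induction with
  | mem x hx => exact ⟨[x], by simpa using hx, by simp⟩
  | one => exact ⟨[], by simp, rfl⟩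
  | mul x y _ _ hx hy =>
    obtain ⟨l, h1, rfl⟩ := hx
    obtain ⟨l', h2, rfl⟩ := hy
    refine ⟨l ++ l', fun s hs => ?_, by simp⟩
    rcases List.mem_append.1 hs with h | h
    · exact h1 s h
    · exact h2 s h
  | inv x _ hx =>
    obtain ⟨l, h1, rfl⟩ := hx
    refine ⟨(l.map fun s => s⁻¹).reverse, fun s hs => ?_, (List.prod_inv_reverse l).symm⟩
    simp only [List.mem_reverse, List.mem_map] at hs
    obtain ⟨t, ht, rfl⟩ := hs
    exact hS t (h1 t ht)

theorem closure_list_bd {H : Type*} [Group H] {S : Set H} (hS : ∀ s ∈ S, s⁻¹ ∈ S) {F : Set H}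
    (hF : F.Finite) : ∃ M, ∀ h ∈ F, h ∈ Subgroup.closure S →
      ∃ l : List H, (∀ s ∈ l, s ∈ S) ∧ l.prod = h ∧ l.length ≤ M := by
  classical
  choose! l h1 h2 using fun (h : H) (hh : h ∈ Subgroup.closure S) => closure_list hS hh
  refine ⟨hF.toFinset.sup fun h => (l h).length, fun h hF' hh => ⟨l h, h1 h hh, h2 h hh, ?_⟩⟩
  exact Finset.le_sup (f := fun h => (l h).length) (by simpa using hF')

theorem fp_main {N R : Set (Hm d)} (hN : Nuc N) (hNf : N.Finite) (hR : R.Finite)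
    (hcov : ∀ h ∈ Subgroup.closure (SE N ∪ R), ∃ r ∈ R, r⁻¹ * h ∈ Subgroup.closure (SE N))
    (hnorm : ∀ h ∈ Subgroup.closure (SE N ∪ R), ∀ y ∈ Subgroup.closure (SE N),
      h * y * h⁻¹ ∈ Subgroup.closure (SE N)) :
    IsFinitelyPresented (Subgroup.closure (SE N ∪ R)) := by
  set E := SE N with hE
  have hEf : E.Finite := SE_finite hNf
  have hEi : ∀ s ∈ E, s⁻¹ ∈ E := fun s hs => SE_inv hN hs
  let S := E ∪ R
  have hSf : S.Finite := hEf.union hR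
  let S' : Set (Hm d) := S ∪ S⁻¹ ∪ {1}
  have hS'f : S'.Finite := (hSf.union hSf.inv).union (Set.finite_singleton _)
  have hS1 : ∀ s ∈ S, s ∈ S' := fun s hs => Or.inl (Or.inl hs)
  have hSi : ∀ s ∈ S, s⁻¹ ∈ S' := fun s hs => Or.inl (Or.inr (by simpa using hs))
  have h1S : (1 : Hm d) ∈ S' := Or.inr rfl
  obtain ⟨M, hM⟩ := closure_list_bd hEi ((hS'f.mul hS'f).mul hS'f)
  have hM' : ∀ a ∈ S', ∀ b ∈ S', ∀ c ∈ S', a * b * c ∈ Subgroup.closure E →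
      ∃ l : List (Hm d), (∀ s ∈ l, s ∈ E) ∧ l.prod = a * b * c ∧ l.length ≤ M :=
    fun a ha b hb c hc h => hM _ (Set.mul_mem_mul (Set.mul_mem_mul ha hb) hc) h
  obtain ⟨K, _, φ, σ, sec, rel, gen, fin⟩ := presK S hSf (M + d + 5)
  apply fin
  have hrelE := fun (l1 l2 : List (Hm d)) (h1 : ∀ s ∈ l1, s ∈ E) (h2 : ∀ s ∈ l2, s ∈ E)
    (k1 : l1.length ≤ d + 5) (k2 : l2.length ≤ d + 5) (e : l1.prod = l2.prod) =>
    rel l1 l2 (fun s hs => Or.inl (h1 s hs)) (fun s hs => Or.inl (h2 s hs)) (by omega) (by omega) e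
  obtain ⟨σ', hσ', Sy⟩ := sys_sub (N := N) φ σ (fun s hs => sec s (Or.inl hs)) hrelE
  obtain ⟨τ, x, C⟩ := sys_cor hN Sy
  have hinjE := C.inj hN
  set KE := Subgroup.closure (σ '' SE N) with hKE
  have hword : ∀ l : List (Hm d), (∀ s ∈ l, s ∈ E) → (l.map σ).prod ∈ KE := by
    intro l hl
    refine Subgroup.list_prod_mem _ fun k hk => ?_
    obtain ⟨s, hs, rfl⟩ := List.mem_map.1 hk
    exact Subgroup.subset_closure ⟨s, hl s hs, rfl⟩
  have hSc : ∀ s ∈ S, s ∈ Subgroup.closure (E ∪ R) := fun s hs => Subgroup.subset_closure hs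
  have hφKE : ∀ k ∈ KE, φ k ∈ Subgroup.closure E := by
    intro k hk
    have : KE ≤ (Subgroup.closure E).comap φ := by
      refine (Subgroup.closure_le _).2 ?_
      rintro _ ⟨s, hs, rfl⟩
      change φ (σ s) ∈ Subgroup.closure E
      rw [sec s (Or.inl hs)]
      exact Subgroup.subset_closure hs
    exact this hk
  -- left multiplication by a generator
  have hmul : ∀ s ∈ S, ∀ r ∈ R, ∃ r' ∈ R, ∃ k ∈ KE, σ s * σ r = σ r' * k := by
    intro s hs r hr
    obtain ⟨r', hr', h1⟩ := hcov (s * r) (mul_mem (hSc s hs) (hSc r (Or.inr hr)))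
    rw [← mul_assoc] at h1
    obtain ⟨l, hl, he, hlen⟩ := hM' _ (hSi r' (Or.inr hr')) _ (hS1 s hs) _ (hS1 r (Or.inr hr)) h1
    refine ⟨r', hr', _, hword l hl, ?_⟩
    have := rel [s, r] (r' :: l) (by rintro t ht; simp at ht; rcases ht with rfl | rfl
                                     · exact hs
                                     · exact Or.inr hr)
      (by
        rintro t ht
        rcases List.mem_cons.1 ht with rfl | ht
        · exact Or.inr hr'
        · exact Or.inl (hl t ht)) (by simp) (by simp only [List.length_cons]; omega)
      (by simp [he, mul_assoc])
    simpa using this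
  have hmul' : ∀ s ∈ S, ∀ r ∈ R, ∃ r' ∈ R, ∃ k ∈ KE, (σ s)⁻¹ * σ r = σ r' * k := by
    intro s hs r hr
    obtain ⟨r', hr', h1⟩ := hcov (s⁻¹ * r) (mul_mem (inv_mem (hSc s hs)) (hSc r (Or.inr hr)))
    rw [← mul_assoc] at h1
    obtain ⟨l, hl, he, hlen⟩ := hM' _ (hSi r' (Or.inr hr')) _ (hSi s hs) _ (hS1 r (Or.inr hr)) h1
    refine ⟨r', hr', _, hword l hl, ?_⟩
    have := rel [r] (s :: r' :: l) (by rintro t ht; simp at ht; rw [ht]; exact Or.inr hr)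
      (by
        rintro t ht
        rcases List.mem_cons.1 ht with rfl | ht
        · exact hs
        rcases List.mem_cons.1 ht with rfl | ht
        · exact Or.inr hr'
        · exact Or.inl (hl t ht)) (by simp) (by simp only [List.length_cons]; omega)
      (by simp [he, mul_assoc])
    simp only [List.map_cons, List.prod_cons, List.map_nil, List.prod_nil, mul_one] at this
    rw [this]; group
  have hall : ∀ k : K, ∃ r ∈ R, ∃ y ∈ KE, k = σ r * y := by
    intro k
    have hk : k ∈ Subgroup.closure (σ '' S) := by rw [gen]; trivial
    induction hk using Subgroup.closure_induction_left with
    | one =>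
      obtain ⟨r, hr, h1⟩ := hcov 1 (one_mem _)
      obtain ⟨l, hl, he, hlen⟩ := hM' _ (hSi r (Or.inr hr)) _ h1S _ h1S (by simpa using h1)
      refine ⟨r, hr, _, hword l hl, ?_⟩
      have := rel [] (r :: l) (by simp) (by
        rintro t ht
        rcases List.mem_cons.1 ht with rfl | ht
        · exact Or.inr hr
        · exact Or.inl (hl t ht)) (by simp) (by simp; omega)
        (by simp [he])
      simpa using this
    | mul_left a ha y _ ih =>
      obtain ⟨s, hs, rfl⟩ := ha
      obtain ⟨r, hr, z, hz, rfl⟩ := ih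
      obtain ⟨r', hr', k, hk, e⟩ := hmul s hs r hr
      exact ⟨r', hr', k * z, mul_mem hk hz, by rw [← mul_assoc, e, mul_assoc]⟩
    | inv_mul_cancel a ha y _ ih =>
      obtain ⟨s, hs, rfl⟩ := ha
      obtain ⟨r, hr, z, hz, rfl⟩ := ih
      obtain ⟨r', hr', k, hk, e⟩ := hmul' s hs r hr
      exact ⟨r', hr', k * z, mul_mem hk hz, by rw [← mul_assoc, e, mul_assoc]⟩
  rw [injective_iff_map_eq_one]
  intro k hk
  obtain ⟨r, hr, y, hy, rfl⟩ := hall k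
  rw [map_mul, sec r (Or.inr hr)] at hk
  have hrE : r ∈ Subgroup.closure E := by
    rw [eq_inv_of_mul_eq_one_left hk]
    exact inv_mem (hφKE y hy)
  obtain ⟨l, hl, he, hlen⟩ := hM' _ (hS1 r (Or.inr hr)) _ h1S _ h1S (by simpa using hrE)
  have hσr : σ r ∈ KE := by
    have := rel [r] l (by intro t ht; rw [List.mem_singleton.1 ht]; exact Or.inr hr)
      (fun t ht => Or.inl (hl t ht)) (by simp)
      (by omega) (by rw [he]; simp)
    have h2 := hword l hl
    rw [← this] at h2
    simpa using h2
  have hkE : σ r * y ∈ KE := mul_mem hσr hy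
  have := @hinjE ⟨σ r * y, hkE⟩ 1 (by
    rw [map_one]
    change φ (σ r * y) = 1
    rw [map_mul, sec r (Or.inr hr)]; exact hk)
  exact congrArg Subtype.val this

theorem Ctx.fp {G : Subgroup (Hm d)} {N : Set (Hm d)} (X : Ctx G N) :
    IsFinitelyPresented (HG G) := by
  obtain ⟨R, hRf, hRG, hR⟩ := X.reps
  have hle : Subgroup.closure (SE (NE G N) ∪ R) ≤ HG G := by
    refine (Subgroup.closure_le _).2 (Set.union_subset ?_ fun r hr => G_le_HG (hRG r hr))
    exact fun s hs => HE_le (N := N) (Subgroup.subset_closure hs)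
  have hcov : ∀ h ∈ HG G, ∃ r ∈ R, r⁻¹ * h ∈ HE G N := by
    intro h hh
    obtain ⟨g, hg, h1⟩ := X.HG_decomp hh
    obtain ⟨r, hr, h2⟩ := hR g hg
    refine ⟨r, hr, ?_⟩
    have := mul_mem h2 h1
    simpa [mul_assoc] using this
  have heq : Subgroup.closure (SE (NE G N) ∪ R) = HG G := by
    refine le_antisymm hle fun h hh => ?_
    obtain ⟨r, hr, h1⟩ := hcov h hh
    have h2 : r⁻¹ * h ∈ Subgroup.closure (SE (NE G N) ∪ R) :=
      Subgroup.closure_mono Set.subset_union_left h1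
    have h3 : r ∈ Subgroup.closure (SE (NE G N) ∪ R) := Subgroup.subset_closure (Or.inr hr)
    have := mul_mem h3 h2
    simpa using this
  rw [← heq]
  exact fp_main X.nuc (X.fin.subset Set.inter_subset_left) hRf
    (fun h hh => hcov h (hle hh)) (fun h hh y hy => X.conjHG (hle hh) hy)

/-- Extracting the combinatorial data from the hypotheses of the theorem. -/
theorem isLocalAction_of_at {g k : Hm d} {α β : Wd d} (h : At g α β k) : IsLocalAction g α k := by
  refine ⟨β, h, k⁻¹ (fun _ => 0), k⁻¹ (fun _ => 1), ?_⟩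
  rw [hm_apply_inv_self, hm_apply_inv_self]
  simp

theorem at_of_cone {G : Subgroup (Hm d)}
    (hself : ∀ g ∈ G, ∀ (α : Wd d) (h : Cs d → Cs d),
      IsLocalAction g α h → ∃ g' ∈ G, ⇑(g' : Hm d) = h) {g : Hm d} (hg : g ∈ G) {α β : Wd d}
    (h : g '' cone α = cone β) : ∃ k ∈ G, At g α β k := by
  have h1 : ∀ x, ∃ y, g (α ⌢ x) = β ⌢ y := by
    intro x
    have : g (α ⌢ x) ∈ cone β := by rw [← h]; exact ⟨_, ⟨x, rfl⟩, rfl⟩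
    obtain ⟨y, hy⟩ := this
    exact ⟨y, hy.symm⟩
  choose f hf using h1
  have hsurj : Function.Surjective f := by
    intro y
    have : β ⌢ y ∈ g '' cone α := by rw [h]; exact ⟨y, rfl⟩
    obtain ⟨_, ⟨x, rfl⟩, hx⟩ := this
    refine ⟨x, ?_⟩
    rw [hf] at hx
    exact wa_inj hx
  obtain ⟨x0, hx0⟩ := hsurj (fun _ => 0)
  obtain ⟨x1, hx1⟩ := hsurj (fun _ => 1)
  obtain ⟨k, hk, rfl⟩ := hself g hg α f ⟨β, hf, x0, x1, by rw [hx0, hx1]; simp⟩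
  exact ⟨k, hk, hf⟩

theorem cone_inj {α β : Wd d} (h : cone α = cone β) : α = β := by
  have key : ∀ {α β : Wd d}, cone α = cone β → β <+: α := by
    intro α β h
    refine wa_forall_pfx fun x => ?_
    have : α ⌢ x ∈ cone β := by rw [← h]; exact ⟨x, rfl⟩
    obtain ⟨y, hy⟩ := this
    exact ⟨y, hy.symm⟩
  have h1 := key h
  exact ((key h.symm).eq_of_length_le h1.length_le)

theorem sec_of_sync {g : Hm d} (hg : IsSynchronous g) :
    ∃ π : Equiv.Perm (Fin (d + 2)), ∀ i, g '' cone [i] = cone [π i] := by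
  choose b hb using fun i : Fin (d + 2) => hg [i]
  have hdj : ∀ i j, i ≠ j → Dj (b i) (b j) := by
    intro i j hij
    apply dj_of_disjoint
    rw [← hb, ← hb, Set.disjoint_image_iff g.injective]
    exact disjoint_of_dj (dj_of_len rfl (by simpa using hij))
  have hne : ∀ i, b i ≠ [] := by
    intro i h
    obtain ⟨j, hj⟩ := exists_ne i
    have := (hdj i j hj.symm).1
    rw [h] at this
    exact this ⟨_, rfl⟩
  have hcov : ∀ j : Fin (d + 2), ∃ i u, b i = j :: u := by
    intro j
    obtain ⟨w, z, hw, hz⟩ := wa_decomp 1 (g⁻¹ ([j] ⌢ fun _ => 0))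
    obtain ⟨i, rfl⟩ := List.length_eq_one_iff.1 hw
    have : [j] ⌢ (fun _ => 0) ∈ cone (b i) := by
      rw [← hb]; exact ⟨_, ⟨z, rfl⟩, by rw [← hz, hm_apply_inv_self]⟩
    obtain ⟨y, hy⟩ := this
    refine ⟨i, ?_⟩
    cases hbi : b i with
    | nil => exact (hne i hbi).elim
    | cons a u =>
      rw [hbi] at hy
      have := congrFun hy 0
      rw [wa_cons_zero, wa_cons_zero] at this
      exact ⟨u, by rw [this]⟩
  choose c u hc using hcov
  have hcinj : Function.Injective c := by
    intro j j' h
    have h1 := hc j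
    rw [h, hc j'] at h1
    exact (List.cons.inj h1).1.symm
  have hcb : Function.Bijective c := Finite.injective_iff_bijective.1 hcinj
  have hu : ∀ j, u j = [] := by
    intro j
    have : [j] = b (c j) := by
      apply cone_inj
      apply Set.Subset.antisymm
      · rintro _ ⟨z, rfl⟩
        obtain ⟨w, z', hw, hz'⟩ := wa_decomp 1 (g⁻¹ ([j] ⌢ z))
        obtain ⟨i, rfl⟩ := List.length_eq_one_iff.1 hw
        have hm : [j] ⌢ z ∈ cone (b i) := by
          rw [← hb]; exact ⟨_, ⟨z', rfl⟩, by rw [← hz', hm_apply_inv_self]⟩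
        obtain ⟨j', rfl⟩ := hcb.2 i
        obtain ⟨y, hy⟩ := hm
        have := congrFun hy 0
        rw [hc, wa_cons_zero, wa_cons_zero] at this
        rw [← this]
        rw [← this] at hy
        exact ⟨y, hy⟩
      · rintro _ ⟨z, rfl⟩
        rw [hc]
        exact ⟨u j ⌢ z, (wa_append [j] (u j) z).symm⟩
    rw [hc] at this
    exact (List.cons.inj this).2.symm
  refine ⟨(Equiv.ofBijective c hcb).symm, fun i => ?_⟩
  obtain ⟨j, rfl⟩ := hcb.2 i
  rw [hb, hc, hu]
  congr 2
  exact ((Equiv.ofBijective c hcb).symm_apply_apply j).symm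

theorem local_unique {g : Hm d} {α β : Wd d} {k : Hm d} {f : Cs d → Cs d} (h : At g α β k)
    (hf : IsLocalAction g α f) : ⇑k = f := by
  obtain ⟨γ, h1, x, y, hxy⟩ := hf
  have key : ∀ z, β ⌢ k z = γ ⌢ f z := fun z => by rw [← h, h1]
  have p1 : γ <+: β := by
    refine wa_forall_pfx fun z => ⟨f (k⁻¹ z), ?_⟩
    rw [← key, hm_apply_inv_self]
  obtain ⟨u, rfl⟩ := p1
  cases u with
  | nil =>
    funext z
    have := key z
    rw [List.append_nil] at this
    exact wa_inj this
  | cons a u =>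
    exfalso
    apply hxy
    have e : ∀ z, f z 0 = a := by
      intro z
      have := key z
      rw [wa_append] at this
      rw [← wa_inj this, wa_cons_zero]
    rw [e, e]

theorem ctx_of {G : Subgroup (Hm d)}
    (hrat : ∀ g ∈ G, IsRational g)
    (hsync : ∀ g ∈ G, IsSynchronous g)
    (hself : ∀ g ∈ G, ∀ (α : Wd d) (h : Cs d → Cs d),
      IsLocalAction g α h → ∃ g' ∈ G, ⇑(g' : Hm d) = h)
    (hcon : {h : Cs d → Cs d | ∃ g ∈ G, {α : Wd d |
        IsLocalAction (g : Hm d) α h}.Infinite}.Finite) :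
    ∃ N, Ctx G N := by
  have hsec : ∀ g ∈ G, ∃ (π : Equiv.Perm (Fin (d + 2))) (s : Fin (d + 2) → Hm d),
    (∀ i, s i ∈ G) ∧ ∀ i, At g [i] [π i] (s i) := by
    intro g hg
    obtain ⟨π, hπ⟩ := sec_of_sync (hsync g hg)
    choose s hs hat using fun i => at_of_cone hself hg (hπ i)
    exact ⟨π, s, hs, hat⟩
  have hall : ∀ α : Wd d, ∀ g ∈ G, ∃ β k, k ∈ G ∧ At g α β k := by
    intro α g hg
    obtain ⟨β, hβ⟩ := hsync g hg α
    obtain ⟨k, hk, h⟩ := at_of_cone hself hg hβ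
    exact ⟨β, k, hk, h⟩
  let N : Set (Hm d) := {k | k ∈ G ∧ ∃ g ∈ G, {α : Wd d | ∃ β, At g α β k}.Infinite}
  have hloc : ∀ {g k : Hm d} {α : Wd d}, g ∈ G → IsLocalAction g α k → ∃ β, At g α β k := by
    intro g k α hg h
    obtain ⟨β, k', _, hk'⟩ := hall α g hg
    have := local_unique hk' h
    have e : k' = k := DFunLike.coe_injective this
    exact ⟨β, e ▸ hk'⟩
  refine ⟨N, ⟨hsec, ?_, ?_, ?_, fun g hg => hg.1, ?_, ?_⟩⟩
  · refine Set.Finite.of_finite_image (f := fun k : Hm d => (⇑k : Cs d → Cs d))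
      (hcon.subset ?_) (DFunLike.coe_injective.injOn)
    rintro _ ⟨k, ⟨-, g, hg, hinf⟩, rfl⟩
    refine ⟨g, hg, hinf.mono ?_⟩
    rintro α ⟨β, h⟩
    exact isLocalAction_of_at h
  · refine ⟨one_mem _, 1, one_mem _, ?_⟩
    have : {α : Wd d | ∃ β, At (1 : Hm d) α β 1} = Set.univ :=
      Set.eq_univ_of_forall fun α => ⟨α, mv_one α⟩
    rw [this]
    exact Set.infinite_univ
  · rintro k ⟨hk, g, hg, hinf⟩
    refine ⟨inv_mem hk, g⁻¹, inv_mem hg, ?_⟩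
    choose! b hb using fun (α : Wd d) (h : ∃ β, At g α β k) => h
    refine (hinf.image (f := b) ?_).mono ?_
    · intro α hα α' hα' e
      have h1 := hb α hα
      have h2 := hb α' hα'
      rw [e] at h1
      refine wa_forall_eq fun x => g.injective ?_
      change g (α ⌢ x) = g (α' ⌢ x)
      rw [h1, h2]
    · rintro _ ⟨α, hα, rfl⟩
      exact ⟨α, (hb α hα).inv⟩
  · rintro k ⟨hk, g, hg, hinf⟩ i j s hs
    obtain ⟨s', hs', e⟩ := hself k hk [i] s (isLocalAction_of_at hs)
    obtain rfl : s' = s := DFunLike.coe_injective e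
    refine ⟨hs', g, hg, ?_⟩
    refine (hinf.image (f := fun α => α ++ [i]) (fun a _ b _ e => by simpa using e)).mono ?_
    rintro _ ⟨α, ⟨β, h⟩, rfl⟩
    exact ⟨β ++ [j], h.comp hs⟩
  · intro g hg
    -- the finitely many words with local action outside the core
    have hbad : {α : Wd d | ∃ β k, At g α β k ∧ k ∉ N}.Finite := by
      have hr : {f | ∃ α, IsLocalAction g α f}.Finite := hrat g hg
      have : {α : Wd d | ∃ β k, At g α β k ∧ k ∉ N} ⊆
          ⋃ f ∈ {f ∈ {f | ∃ α, IsLocalAction g α f} | {α : Wd d | IsLocalAction g α f}.Finite},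
            {α : Wd d | IsLocalAction g α f} := by
        rintro α ⟨β, k, h, hk⟩
        have hl := isLocalAction_of_at h
        refine Set.mem_biUnion (x := (⇑k : Cs d → Cs d)) ⟨⟨α, hl⟩, ?_⟩ hl
        by_contra hinf
        apply hk
        obtain ⟨k', hk', e⟩ := hself g hg α k hl
        obtain rfl : k' = k := DFunLike.coe_injective e
        exact ⟨hk', g, hg, Set.Infinite.mono (fun α' h' => hloc hg h') hinf⟩
      refine Set.Finite.subset (Set.Finite.biUnion (hr.subset (Set.sep_subset _ _)) ?_) this
      exact fun f hf => hf.2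
    refine ⟨hbad.toFinset.sup List.length + 1, fun α β k hα h => ?_⟩
    by_contra hk
    have : α ∈ hbad.toFinset := by simpa using ⟨β, k, h, hk⟩
    have := Finset.le_sup (f := List.length) this
    omega

end FPSec

/-!
Nekrashevych (2018): if `G` is a contracting self-similar group of synchronous
rational homeomorphisms of the `d`-ary Cantor space, then the Röver–Nekrashevych
group `V_d G`, the subgroup of the homeomorphism group generated by `G` together
with Thompson's group `V_d`, is finitely presented.  (`G` is contracting when the
union of the cores of its elements is finite, the core of `g` consisting of those
local actions of `g` occurring at infinitely many words.)
-/
theorem nekrashevych_finitely_presented (d : ℕ) (hd : 2 ≤ d)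
    (G : Subgroup ((ℕ → Fin d) ≃ₜ (ℕ → Fin d)))
    (hrat : ∀ g ∈ G, IsRational g)
    (hsync : ∀ g ∈ G, IsSynchronous g)
    (hselfsim : ∀ g ∈ G, ∀ (α : List (Fin d)) (h : (ℕ → Fin d) → (ℕ → Fin d)),
      IsLocalAction g α h → ∃ g' ∈ G, ⇑(g' : (ℕ → Fin d) ≃ₜ (ℕ → Fin d)) = h)
    (hcontracting : {h : (ℕ → Fin d) → (ℕ → Fin d) |
      ∃ g ∈ G, {α : List (Fin d) |
        IsLocalAction (g : (ℕ → Fin d) ≃ₜ (ℕ → Fin d)) α h}.Infinite}.Finite) :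
    IsFinitelyPresented
      ↥(Subgroup.closure ((G : Set ((ℕ → Fin d) ≃ₜ (ℕ → Fin d))) ∪
          {h : (ℕ → Fin d) ≃ₜ (ℕ → Fin d) | InThompsonV h})) := by
  obtain ⟨n, rfl⟩ : ∃ n, d = n + 2 := ⟨d - 2, by omega⟩
  obtain ⟨N, X⟩ := ctx_of hrat hsync hselfsim hcontracting
  exact X.fp
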